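/- arXiv:2210.10082 — 3 statements merged into one kernel-verified Lean document; each statement's English description precedes it below -/
import Mathlib

section
/- Let k be an algebraically closed field of characteristic 2, S = V(x^2 + y^2*z + y*z^2) in A^3, and S_m its m-th jet scheme. Then S_m is irreducible of dimension 2m+2 for every m >= 0. -/
open Finset

/-- The universal `m`-jet `∑_{i=0}^m x_i t^i` in the `j`-th coordinate
(`j = 0, 1, 2` for `x, y, z`), with coefficients in
`R_m = k[x_0,...,x_m, y_0,...,y_m, z_0,...,z_m]`. -/
noncomputable def jetSer (k : Type*) [Field k] (m : ℕ) (j : Fin 3) :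
    Polynomial (MvPolynomial (Fin 3 × Fin (m + 1)) k) :=
  ∑ i : Fin (m + 1), Polynomial.C (MvPolynomial.X (j, i)) * Polynomial.X ^ (i : ℕ)

/-- The coefficient polynomial `f^{(j)} ∈ R_m` for `f = x^2 + y^2 z + y z^2`. -/
noncomputable def fC (k : Type*) [Field k] (m j : ℕ) :
    MvPolynomial (Fin 3 × Fin (m + 1)) k :=
  ((jetSer k m 0) ^ 2 + (jetSer k m 1) ^ 2 * jetSer k m 2
    + jetSer k m 1 * (jetSer k m 2) ^ 2).coeff j

/-- Krull dimension does not increase along integral extensions. -/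
theorem jd_dim_le_of_integral {A B : Type*} [CommRing A] [CommRing B] (g : A →+* B)
    (hg : g.IsIntegral) : ringKrullDim B ≤ ringKrullDim A := by
  algebraize [g]
  refine Order.krullDim_le_of_strictMono (PrimeSpectrum.comap (algebraMap A B)) ?_
  intro I J hIJ
  exact Ideal.IsIntegral.comap_lt_comap (R := A) (I := I.asIdeal) (J := J.asIdeal) hIJ

/-- The dimension of a finitely generated domain is at most its transcendence degree. -/
theorem jd_dim_le_trdeg {k A : Type*} [Field k] [CommRing A] [IsDomain A] [Algebra k A]
    [Algebra.FiniteType k A] (d : ℕ) (hd : Algebra.trdeg k A ≤ d) :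
    ringKrullDim A ≤ d := by
  obtain ⟨s, g, hinj, hgint⟩ := exists_integral_inj_algHom_of_fg k A
  have h1 := jd_dim_le_of_integral g.toRingHom hgint
  rw [MvPolynomial.ringKrullDim_of_isNoetherianRing, ringKrullDim_eq_zero_of_field] at h1
  have h2 : AlgebraicIndependent k (fun i : Fin s => g (MvPolynomial.X i)) :=
    (MvPolynomial.algebraicIndependent_X (Fin s) k).map' hinj
  have h3 := h2.lift_cardinalMk_le_trdeg
  have h4 : s ≤ d := by
    have h5 : (s : Cardinal) ≤ Cardinal.lift.{0} (Algebra.trdeg k A) := by simpa using h3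
    rw [Cardinal.lift_uzero] at h5
    exact_mod_cast h5.trans hd
  refine h1.trans ?_
  simp only [Nat.card_eq_fintype_card, Fintype.card_fin, zero_add]
  exact_mod_cast h4

/-- All maximal ideals of a polynomial ring over a field have full height. -/
theorem jd_height_maximal {k : Type*} [Field k] (ι : Type*) [Finite ι]
    (M : Ideal (MvPolynomial ι k)) (hM : M.IsMaximal) : M.height = Nat.card ι := by
  induction ι using Finite.induction_empty_option with
  | of_equiv e H =>
    have := H (M.comap (MvPolynomial.renameEquiv k e).toRingEquiv) (Ideal.comap_isMaximal_of_equiv _)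
    rw [← Nat.card_congr e, ← this]
    exact (RingEquiv.height_comap (MvPolynomial.renameEquiv k e).toRingEquiv M).symm
  | h_empty =>
    have h1 := Ideal.height_le_ringKrullDim_of_ne_top hM.ne_top
    rw [MvPolynomial.ringKrullDim_of_isNoetherianRing, ringKrullDim_eq_zero_of_field] at h1
    simp at h1 ⊢
    exact h1
  | @h_option ι _ IH =>
    let e := (MvPolynomial.optionEquivLeft k ι).toRingEquiv
    have hc : (M.comap e.symm).IsMaximal := Ideal.comap_isMaximal_of_equiv _
    rw [← RingEquiv.height_comap e.symm M]
    generalize M.comap e.symm = N at hc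
    have hN : (N.comap (Polynomial.C : MvPolynomial ι k →+* _)).IsMaximal :=
      Polynomial.isMaximal_comap_C_of_isJacobsonRing N
    have hlies : N.LiesOver (N.comap (Polynomial.C : MvPolynomial ι k →+* _)) := ⟨rfl⟩
    have h2 := Polynomial.height_eq_height_add_one
      (N.comap (Polynomial.C : MvPolynomial ι k →+* _)) N
    rw [h2, IH _ hN]
    simp

/-- A minimal prime over an ideal generated by `c` elements has a quotient of dimension at least
`N - c`. -/
theorem jd_dim_ge {k : Type*} [Field k] {ι : Type*} [Finite ι] (s : Set (MvPolynomial ι k))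
    (P : Ideal (MvPolynomial ι k)) (hP : P ∈ (Ideal.span s).minimalPrimes) (c d : ℕ)
    (hc : s.encard ≤ c) (hd : c + d ≤ Nat.card ι) :
    (d : WithBot ℕ∞) ≤ ringKrullDim (MvPolynomial ι k ⧸ P) := by
  classical
  have hPp : P.IsPrime := hP.1.1
  set I := Ideal.span s with hI
  have hfin := Ideal.finite_minimalPrimes_of_isNoetherianRing _ I
  -- an element in all the other minimal primes
  obtain ⟨h, hhP, hh⟩ : ∃ h, h ∉ P ∧ ∀ Q : Ideal (MvPolynomial ι k), Q.IsPrime → I ≤ Q → h ∉ Q →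
      P ≤ Q := by
    let F := hfin.toFinset.erase P
    have h1 : ¬ (F.inf id ≤ P) := by
      intro hle
      rw [Ideal.IsPrime.inf_le' hPp] at hle
      obtain ⟨Q, hQ, hQP⟩ := hle
      simp only [F, Finset.mem_erase, Set.Finite.mem_toFinset] at hQ
      exact hQ.1 (le_antisymm hQP (hP.2 hQ.2.1 hQP))
    obtain ⟨h, hF, hhP⟩ := SetLike.not_le_iff_exists.1 h1
    refine ⟨h, hhP, fun Q hQ hIQ hhQ => ?_⟩
    obtain ⟨Q', hQ', hle⟩ := Ideal.exists_minimalPrimes_le hIQ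
    by_cases heq : Q' = P
    · exact heq ▸ hle
    · have hQF : Q' ∈ F := by simp [F, heq, hQ']
      have hle2 : F.inf id ≤ Q' := Finset.inf_le (f := id) hQF
      exact absurd (hle (hle2 hF)) hhQ
  obtain ⟨M, hM, hPM, hhM⟩ : ∃ M : Ideal (MvPolynomial ι k), M.IsMaximal ∧ P ≤ M ∧ h ∉ M := by
    by_contra hcon
    push Not at hcon
    apply hhP
    rw [← hPp.radical, Ideal.radical_eq_jacobson]
    exact Ideal.mem_sInf.2 fun {J} hJ => hcon J hJ.2 hJ.1
  have hIM : I ≤ M := hP.1.2.trans hPM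
  have hMp := hM.isPrime
  have h1 := Ideal.height_le_height_add_encard_of_subset s (p := M)
    (Ideal.span_le.1 hIM)
  rw [jd_height_maximal ι M hM] at h1
  have hMI : (M.map (Ideal.Quotient.mk I)).IsPrime := Ideal.isPrime_map_quotientMk_of_isPrime hIM
  obtain ⟨l, hl, hlen⟩ := Ideal.exists_ltSeries_length_eq_height (M.map (Ideal.Quotient.mk I))
  rw [← hI, ← hlen] at h1
  have h2 : d ≤ l.length := by
    have h3 : (Nat.card ι : ℕ∞) ≤ l.length + c := h1.trans (by gcongr)
    have : Nat.card ι ≤ l.length + c := by exact_mod_cast h3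
    omega
  have hsurj : Function.Surjective (Ideal.Quotient.mk I) := Ideal.Quotient.mk_surjective
  have hmem : ∀ i, PrimeSpectrum.comap (Ideal.Quotient.mk I) (l i) ∈
      PrimeSpectrum.zeroLocus (P : Set (MvPolynomial ι k)) := by
    intro i
    refine hh _ inferInstance ?_ ?_
    · intro a ha
      simp [Ideal.Quotient.eq_zero_iff_mem.2 ha]
    · intro hmem
      apply hhM
      have hle : l i ≤ l.last := l.monotone (Fin.le_last i)
      rw [hl] at hle
      have : Ideal.Quotient.mk I h ∈ M.map (Ideal.Quotient.mk I) := hle hmem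
      have h5 : h ∈ (M.map (Ideal.Quotient.mk I)).comap (Ideal.Quotient.mk I) := this
      rwa [Ideal.comap_map_of_surjective _ hsurj, ← RingHom.ker_eq_comap_bot, Ideal.mk_ker,
        sup_eq_left.2 hIM] at h5
  rw [ringKrullDim_quotient]
  let l' : LTSeries (PrimeSpectrum.zeroLocus (P : Set (MvPolynomial ι k))) :=
    { length := l.length
      toFun := fun i => ⟨_, hmem i⟩
      step := by
        intro i
        have this : l.toFun i.castSucc < l.toFun i.succ := l.step i
        have hle : (l.toFun i.castSucc).asIdeal ≤ (l.toFun i.succ).asIdeal := le_of_lt this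
        refine lt_of_le_of_ne (Ideal.comap_mono hle) ?_
        intro heq
        have heq2 : PrimeSpectrum.comap (Ideal.Quotient.mk I) (l.toFun i.castSucc) =
          PrimeSpectrum.comap (Ideal.Quotient.mk I) (l.toFun i.succ) := PrimeSpectrum.ext heq
        exact this.ne (PrimeSpectrum.comap_injective_of_surjective _ hsurj heq2) }
  refine le_trans ?_ (Order.LTSeries.length_le_krullDim l')
  exact_mod_cast h2
/-- In characteristic two, coefficients of `p ^ 2 * q` only involve the squares of the
coefficients of `p`. -/
theorem jd_coeff_sq_mul {B : Type*} [CommRing B] (h2 : (2 : B) = 0) (p q : Polynomial B)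
    (n b : ℕ) (hb : b < 2) :
    (p ^ 2 * q).coeff (2 * n + b) =
      ∑ x ∈ antidiagonal n, p.coeff x.1 ^ 2 * q.coeff (2 * x.2 + b) := by
  induction p using Polynomial.induction_on' with
  | add p p' hp hp' =>
    have h2' : (2 : Polynomial B) = 0 := by
      rw [← map_ofNat Polynomial.C 2, h2, map_zero]
    have e1 : (p + p') ^ 2 * q = p ^ 2 * q + p' ^ 2 * q := by
      linear_combination (p * p' * q) * h2'
    rw [e1, Polynomial.coeff_add, hp, hp', ← Finset.sum_add_distrib]
    refine Finset.sum_congr rfl fun x _ => ?_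
    rw [Polynomial.coeff_add]
    linear_combination -(p.coeff x.1 * p'.coeff x.1 * q.coeff (2 * x.2 + b)) * h2
  | monomial i a =>
    have e1 : (Polynomial.monomial i a) ^ 2 * q
        = Polynomial.C (a ^ 2) * q * Polynomial.X ^ (2 * i) := by
      rw [← Polynomial.C_mul_X_pow_eq_monomial, Polynomial.C_pow]; ring
    rw [e1, Polynomial.coeff_mul_X_pow', Polynomial.coeff_C_mul]
    split_ifs with hi
    · rw [Finset.sum_eq_single (i, n - i)]
      · simp only [Polynomial.coeff_monomial, if_true]
        congr 2; omega
      · rintro ⟨u, v⟩ huv hne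
        rw [HasAntidiagonal.mem_antidiagonal] at huv
        have : i ≠ u := by
          rintro rfl
          apply hne
          simp only [Prod.mk.injEq, true_and]
          simp at huv
          omega
        simp [Polynomial.coeff_monomial, this]
      · intro hn
        exact absurd (HasAntidiagonal.mem_antidiagonal.2 (by simp; omega)) hn
    · symm
      refine Finset.sum_eq_zero ?_
      rintro ⟨u, v⟩ huv
      rw [HasAntidiagonal.mem_antidiagonal] at huv
      have : i ≠ u := by
        rintro rfl
        simp at huv
        omega
      simp [Polynomial.coeff_monomial, this]

/-- The universal coordinates, extended by zero. -/
noncomputable def jdV (k : Type*) [Field k] (m : ℕ) (j : Fin 3) (i : ℕ) :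
    MvPolynomial (Fin 3 × Fin (m + 1)) k :=
  if h : i < m + 1 then MvPolynomial.X (j, ⟨i, h⟩) else 0

theorem jd_jetSer_coeff (k : Type*) [Field k] (m : ℕ) (j : Fin 3) (i : ℕ) :
    (jetSer k m j).coeff i = jdV k m j i := by
  unfold jetSer jdV
  simp only [Polynomial.finsetSum_coeff, Polynomial.coeff_C_mul, Polynomial.coeff_X_pow]
  split_ifs with h
  · rw [Finset.sum_eq_single ⟨i, h⟩]
    · simp
    · intro b _ hb
      have : i ≠ b := by
        rintro rfl
        exact hb rfl
      simp [this]
    · simp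
  · refine Finset.sum_eq_zero fun b _ => ?_
    have : i ≠ b := by
      have := b.2
      omega
    simp [this]

theorem jd_two {k : Type*} [Field k] [CharP k 2] {A : Type*} [CommRing A] [Algebra k A] :
    (2 : A) = 0 := by
  have h : (2 : k) = 0 := CharTwo.two_eq_zero
  rw [← map_ofNat (algebraMap k A) 2, h, map_zero]

theorem jd_fC_odd (k : Type*) [Field k] [CharP k 2] (m q : ℕ) :
    fC k m (2 * q + 1) = ∑ x ∈ antidiagonal q,
      (jdV k m 1 x.1 ^ 2 * jdV k m 2 (2 * x.2 + 1) +
        jdV k m 2 x.1 ^ 2 * jdV k m 1 (2 * x.2 + 1)) := by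
  have h2 : (2 : MvPolynomial (Fin 3 × Fin (m + 1)) k) = 0 := jd_two (k := k)
  unfold fC
  have e : (jetSer k m 0) ^ 2 + (jetSer k m 1) ^ 2 * jetSer k m 2
    + jetSer k m 1 * (jetSer k m 2) ^ 2 = (jetSer k m 0) ^ 2 * 1 + (jetSer k m 1) ^ 2 * jetSer k m 2
    + (jetSer k m 2) ^ 2 * jetSer k m 1 := by ring
  rw [e, Polynomial.coeff_add, Polynomial.coeff_add, jd_coeff_sq_mul h2 _ _ _ 1 one_lt_two,
    jd_coeff_sq_mul h2 _ _ _ 1 one_lt_two, jd_coeff_sq_mul h2 _ _ _ 1 one_lt_two,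
    Finset.sum_add_distrib]
  simp [jd_jetSer_coeff, Polynomial.coeff_one]

theorem jd_fC_even (k : Type*) [Field k] [CharP k 2] (m q : ℕ) :
    fC k m (2 * q) = jdV k m 0 q ^ 2 + ∑ x ∈ antidiagonal q,
      (jdV k m 1 x.1 ^ 2 * jdV k m 2 (2 * x.2) +
        jdV k m 2 x.1 ^ 2 * jdV k m 1 (2 * x.2)) := by
  have h2 : (2 : MvPolynomial (Fin 3 × Fin (m + 1)) k) = 0 := jd_two (k := k)
  unfold fC
  have e : (jetSer k m 0) ^ 2 + (jetSer k m 1) ^ 2 * jetSer k m 2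
    + jetSer k m 1 * (jetSer k m 2) ^ 2 = (jetSer k m 0) ^ 2 * 1 + (jetSer k m 1) ^ 2 * jetSer k m 2
    + (jetSer k m 2) ^ 2 * jetSer k m 1 := by ring
  have h := fun p r => jd_coeff_sq_mul h2 p r q 0 two_pos
  simp only [add_zero] at h
  rw [e, Polynomial.coeff_add, Polynomial.coeff_add, h, h, h, Finset.sum_add_distrib, add_assoc]
  refine congrArg₂ (· + ·) ?_ ?_
  · rw [Finset.sum_eq_single (q, 0)]
    · simp [jd_jetSer_coeff]
    · rintro ⟨u, v⟩ huv hne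
      rw [HasAntidiagonal.mem_antidiagonal] at huv
      have : v ≠ 0 := by
        rintro rfl
        apply hne
        simpa using huv
      simp [Polynomial.coeff_one, this]
    · simp
  · simp [jd_jetSer_coeff]

/-- The triangular elimination of the odd coefficients of `z`. -/
theorem jd_elim {A : Type*} [CommRing A] (C : Subring A) (y z : ℕ → A) (e n : ℕ)
    (hy0 : ∀ i < e, y i = 0) (hz0 : ∀ i < e, z i = 0)
    (heq : ∀ q < n, ∑ x ∈ antidiagonal q,
      (y x.1 ^ 2 * z (2 * x.2 + 1) + z x.1 ^ 2 * y (2 * x.2 + 1)) = 0)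
    (h1 : ∀ a, y e ^ 2 * a ∈ C → a ∈ C)
    (h2 : Odd e → ∀ a, y e ^ 2 * a + a ^ 2 * y e ∈ C → a ∈ C)
    (hyC : ∀ i, y i ∈ C)
    (hzC : ∀ i, (∀ q, i = 2 * q + 1 → e ≤ i → n ≤ q + e) → z i ∈ C) : ∀ i, z i ∈ C := by
  intro i
  induction i using Nat.strong_induction_on with
  | _ i ih =>
  by_cases hi : ∀ q, i = 2 * q + 1 → e ≤ i → n ≤ q + e
  · exact hzC i hi
  push Not at hi
  obtain ⟨q, rfl, hei, hq⟩ := hi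
  have hs := heq (q + e) hq
  have hmem : (e, q) ∈ antidiagonal (q + e) := by simp [add_comm]
  rw [← Finset.add_sum_erase _ _ hmem] at hs
  -- the remaining terms
  have hrest : ∑ x ∈ (antidiagonal (q + e)).erase (e, q),
      (y x.1 ^ 2 * z (2 * x.2 + 1) + z x.1 ^ 2 * y (2 * x.2 + 1)) ∈ C := by
    refine sum_mem ?_
    rintro ⟨u, l⟩ hx
    simp only [mem_erase, HasAntidiagonal.mem_antidiagonal, ne_eq, Prod.mk.injEq, not_and] at hx
    obtain ⟨hne, hul⟩ := hx
    have hue : u ≠ e := fun h => hne h (by omega)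
    by_cases hlt : u < e
    · simp [hy0 u hlt, hz0 u hlt]
    refine add_mem (mul_mem (pow_mem (hyC _) _) (ih _ (by omega))) ?_
    by_cases hl : 2 * l + 1 < e
    · simp [hy0 _ hl]
    · exact mul_mem (pow_mem (ih _ (by omega)) _) (hyC _)
  have hmain : y e ^ 2 * z (2 * q + 1) + z e ^ 2 * y (2 * q + 1) ∈ C := by
    rw [eq_neg_of_add_eq_zero_left hs]
    exact neg_mem hrest
  by_cases hqe : e = 2 * q + 1
  · apply h2 (by rw [hqe]; exact odd_two_mul_add_one q)
    rw [← hqe] at hmain ⊢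
    exact hmain
  · apply h1
    have := sub_mem hmain (mul_mem (pow_mem (ih e (by omega)) 2) (hyC (2 * q + 1)))
    simpa using this

/-- The closure properties of an algebraically closed subring that are used below. -/
def jdClosed {A : Type*} [CommRing A] (C : Subring A) : Prop :=
  (∀ y a : A, y ≠ 0 → y ∈ C → y * a ∈ C → a ∈ C) ∧
  (∀ y a : A, y ≠ 0 → y ∈ C → y ^ 2 * a + a ^ 2 * y ∈ C → a ∈ C) ∧
  (∀ a : A, a ^ 2 ∈ C → a ∈ C)

theorem jd_closed_algebraicClosure {S A : Type*} [CommRing S] [IsDomain S] [CommRing A]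
    [IsDomain A] [Algebra S A] :
    jdClosed (Subalgebra.algebraicClosure S A).toSubring := by
  have hmul : ∀ y a : A, y ≠ 0 → IsAlgebraic S y → IsAlgebraic S (y * a) → IsAlgebraic S a :=
    fun y a hy h1 h2 => IsAlgebraic.of_mul (mem_nonZeroDivisors_of_ne_zero hy) h1 h2
  refine ⟨hmul, ?_, ?_⟩
  · intro y a hy hyC h
    have h' : IsAlgebraic S (y * (a ^ 2 + y * a)) := by
      have e : y * (a ^ 2 + y * a) = y ^ 2 * a + a ^ 2 * y := by ring
      rw [e]; exact h
    have hd := hmul _ _ hy hyC h'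
    let y' : Subalgebra.algebraicClosure S A := ⟨y, hyC⟩
    let d' : Subalgebra.algebraicClosure S A := ⟨_, hd⟩
    have halg : IsAlgebraic (Subalgebra.algebraicClosure S A) a := by
      apply IsIntegral.isAlgebraic
      refine ⟨Polynomial.X ^ 2 + Polynomial.C y' * Polynomial.X + Polynomial.C (-d'), ?_, ?_⟩
      · monicity!
      · simp [y', d', Polynomial.eval₂_add]
    by_contra hcon
    exact Transcendental.subalgebraAlgebraicClosure (R := S) hcon halg
  · intro a ha
    exact IsAlgebraic.of_pow two_pos ha

theorem jd_alg {k A : Type*} [Field k] [CommRing A] [IsDomain A] [Algebra k A] (S G : Set A)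
    (hG : Algebra.adjoin k G = ⊤)
    (h : ∀ C : Subring A, jdClosed C → S ⊆ C → G ⊆ C) :
    Algebra.IsAlgebraic (Algebra.adjoin k S) A := by
  have h1 := h (Subalgebra.algebraicClosure (Algebra.adjoin k S) A).toSubring
    jd_closed_algebraicClosure (fun s hs =>
      isAlgebraic_algebraMap (⟨s, Algebra.subset_adjoin hs⟩ : Algebra.adjoin k S))
  refine ⟨fun a => ?_⟩
  have h2 : Algebra.adjoin k G ≤
      (Subalgebra.algebraicClosure (Algebra.adjoin k S) A).restrictScalars k :=
    Algebra.adjoin_le h1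
  rw [hG] at h2
  exact h2 (Algebra.mem_top (x := a))

/-- A finite set of coordinates over which all the coordinates are algebraic. -/
def jdCover {A : Type*} [CommRing A] (v : Fin 3 → ℕ → A) (T : Finset (Fin 3 × ℕ)) : Prop :=
  ∀ C : Subring A, jdClosed C → (∀ t ∈ T, v t.1 t.2 ∈ C) → ∀ j i, v j i ∈ C

theorem jd_cover_erase {A : Type*} [CommRing A] (v : Fin 3 → ℕ → A) (T : Finset (Fin 3 × ℕ))
    (hT : jdCover v T) (t : Fin 3 × ℕ) (ht : v t.1 t.2 = 0) : jdCover v (T.erase t) := by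
  intro C hC h
  refine hT C hC fun s hs => ?_
  by_cases hst : s = t
  · rw [hst, ht]; exact zero_mem _
  · exact h s (Finset.mem_erase.2 ⟨hst, hs⟩)

theorem jd_adjoin {k : Type*} [Field k] (m : ℕ) (P : Ideal (MvPolynomial (Fin 3 × Fin (m + 1)) k)) :
    Algebra.adjoin k (Set.range fun t : Fin 3 × ℕ => Ideal.Quotient.mk P (jdV k m t.1 t.2)) = ⊤ := by
  rw [eq_top_iff]
  have h1 := congrArg (Subalgebra.map (Ideal.Quotient.mkₐ k P))
    (MvPolynomial.adjoin_range_X (R := k) (σ := Fin 3 × Fin (m + 1)))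
  rw [Algebra.map_top, (AlgHom.range_eq_top _).2 (Ideal.Quotient.mkₐ_surjective k P),
    AlgHom.map_adjoin] at h1
  rw [← h1]
  apply Algebra.adjoin_mono
  rintro _ ⟨_, ⟨⟨j, i⟩, rfl⟩, rfl⟩
  exact ⟨(j, i), by simp [jdV, Nat.le_of_lt_succ i.2]⟩

theorem jd_card {k : Type*} [Field k] (m : ℕ) (P : Ideal (MvPolynomial (Fin 3 × Fin (m + 1)) k))
    [P.IsPrime] (d : ℕ)
    (hd : (d : WithBot ℕ∞) ≤ ringKrullDim (MvPolynomial (Fin 3 × Fin (m + 1)) k ⧸ P))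
    (T : Finset (Fin 3 × ℕ)) (hT : jdCover (fun j i => Ideal.Quotient.mk P (jdV k m j i)) T) :
    d ≤ T.card ∧ (T.card ≤ d → AlgebraicIndependent k
      (fun t : T => Ideal.Quotient.mk P (jdV k m t.1.1 t.1.2))) ∧
      ringKrullDim (MvPolynomial (Fin 3 × Fin (m + 1)) k ⧸ P) ≤ T.card := by
  have halg : Algebra.IsAlgebraic (Algebra.adjoin k (Set.range
      (fun t : T => Ideal.Quotient.mk P (jdV k m t.1.1 t.1.2))))
      (MvPolynomial (Fin 3 × Fin (m + 1)) k ⧸ P) := by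
    refine jd_alg _ _ (jd_adjoin m P) fun C hC hS => ?_
    rintro _ ⟨⟨j, i⟩, rfl⟩
    exact hT C hC (fun t ht => hS ⟨⟨t, ht⟩, rfl⟩) j i
  have htr : Algebra.trdeg k (MvPolynomial (Fin 3 × Fin (m + 1)) k ⧸ P) ≤ T.card := by
    have h1 := Algebra.IsAlgebraic.trdeg_le_cardinalMk k (Set.range
      (fun t : T => Ideal.Quotient.mk P (jdV k m t.1.1 t.1.2)))
    refine h1.trans ?_
    have h2 := Cardinal.mk_range_le_lift
      (f := fun t : T => Ideal.Quotient.mk P (jdV k m t.1.1 t.1.2))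
    simpa using h2
  have hdim := jd_dim_le_trdeg _ htr
  refine ⟨by exact_mod_cast hd.trans hdim, fun hTd => ?_, hdim⟩
  have hfaith : @FaithfulSMul k (MvPolynomial (Fin 3 × Fin (m + 1)) k ⧸ P) Algebra.toSMul :=
    (faithfulSMul_iff_algebraMap_injective k _).2
      (algebraMap k (MvPolynomial (Fin 3 × Fin (m + 1)) k ⧸ P)).injective
  refine (Algebra.IsAlgebraic.isTranscendenceBasis_of_lift_le_trdeg_of_finite k
      (fun t : T => Ideal.Quotient.mk P (jdV k m t.1.1 t.1.2)) ?_).1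
  have h3 : (T.card : Cardinal) ≤ Algebra.trdeg k (MvPolynomial (Fin 3 × Fin (m + 1)) k ⧸ P) := by
    obtain ⟨n, hn⟩ := Cardinal.lt_aleph0.1 (htr.trans_lt (Cardinal.natCast_lt_aleph0))
    have h4 := hd.trans (jd_dim_le_trdeg n hn.le)
    have h5 : d ≤ n := by exact_mod_cast h4
    rw [hn]
    exact_mod_cast hTd.trans h5
  simpa using h3

/-- The explicit set of coordinates used in the dimension count. -/
def jdT (m : ℕ) (c c' : Fin 3) (e : ℕ) : Finset (Fin 3 × ℕ) :=
  ({0} ×ˢ Ioc (m / 2) m ∪ {c} ×ˢ Icc e m) ∪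
    {c'} ×ˢ (Icc e m \ (Ico (e / 2) ((m + 1) / 2 - e)).image fun q => 2 * q + 1)

theorem jdT_card (m : ℕ) (c c' : Fin 3) (e : ℕ) : (jdT m c c' e).card ≤
    (m - m / 2) + (m + 1 - e) + ((m + 1 - e) - ((m + 1) / 2 - e - e / 2)) := by
  unfold jdT
  refine (Finset.card_union_le _ _).trans (add_le_add ((Finset.card_union_le _ _).trans
    (add_le_add ?_ ?_)) ?_)
  · simp
  · simp
  · rw [Finset.card_product, Finset.card_sdiff_of_subset, Finset.card_image_of_injective]
    · simp
    · intro a b h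
      simpa using h
    · intro i hi
      simp only [mem_image, mem_Ico] at hi
      obtain ⟨q, hq, rfl⟩ := hi
      simp only [mem_Icc]
      omega

theorem jd_cover_T {A : Type*} [CommRing A] (v : Fin 3 → ℕ → A) (m : ℕ)
    (hv : ∀ j i, m < i → v j i = 0) (c c' : Fin 3) (hj : ∀ j, j = 0 ∨ j = c ∨ j = c')
    (hodd : ∀ q < (m + 1) / 2, ∑ x ∈ antidiagonal q,
      (v c x.1 ^ 2 * v c' (2 * x.2 + 1) + v c' x.1 ^ 2 * v c (2 * x.2 + 1)) = 0)
    (heven : ∀ q, 2 * q ≤ m → v 0 q ^ 2 + ∑ x ∈ antidiagonal q,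
      (v c x.1 ^ 2 * v c' (2 * x.2) + v c' x.1 ^ 2 * v c (2 * x.2)) = 0)
    (e : ℕ) (hce : ∀ i < e, v c i = 0) (hce' : ∀ i < e, v c' i = 0) (C : Subring A)
    (h1 : ∀ a, v c e ^ 2 * a ∈ C → a ∈ C)
    (h2 : Odd e → ∀ a, v c e ^ 2 * a + a ^ 2 * v c e ∈ C → a ∈ C)
    (hT : ∀ t ∈ jdT m c c' e, v t.1 t.2 ∈ C) :
    (∀ i, v c i ∈ C) ∧ (∀ i, v c' i ∈ C) ∧ ∀ i, v 0 i ^ 2 ∈ C := by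
  have hc : ∀ i, v c i ∈ C := by
    intro i
    by_cases hi : i < e
    · rw [hce i hi]; exact zero_mem _
    by_cases hi' : m < i
    · rw [hv _ i hi']; exact zero_mem _
    refine hT (c, i) ?_
    simp only [jdT, mem_union, mem_product, mem_singleton, mem_Icc]
    exact Or.inl (Or.inr ⟨trivial, by omega, by omega⟩)
  have hc' : ∀ i, v c' i ∈ C := by
    refine jd_elim C (v c) (v c') e ((m + 1) / 2) hce hce' hodd h1 h2 hc fun i hi => ?_
    by_cases hie : i < e
    · rw [hce' i hie]; exact zero_mem _
    by_cases hi' : m < i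
    · rw [hv _ i hi']; exact zero_mem _
    refine hT (c', i) ?_
    simp only [jdT, mem_union, mem_product, mem_singleton, mem_Icc, mem_sdiff, mem_image, mem_Ico]
    refine Or.inr ⟨trivial, ⟨by omega, by omega⟩, ?_⟩
    rintro ⟨q, hq, hqi⟩
    have := hi q hqi.symm (by omega)
    omega
  refine ⟨hc, hc', fun i => ?_⟩
  by_cases hi : 2 * i ≤ m
  · rw [eq_neg_of_add_eq_zero_left (heven i hi)]
    exact neg_mem (sum_mem fun x _ => add_mem (mul_mem (pow_mem (hc _) _) (hc' _))
      (mul_mem (pow_mem (hc' _) _) (hc _)))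
  · by_cases hi' : m < i
    · rw [hv _ i hi']; simp
    refine pow_mem (hT (0, i) ?_) 2
    simp only [jdT, mem_union, mem_product, mem_singleton, mem_Ioc]
    exact Or.inl (Or.inl ⟨trivial, by omega, by omega⟩)

/-- The equations of the jet scheme, in terms of values of the coordinates. -/
def jdEqs {A : Type*} [CommRing A] (v : Fin 3 → ℕ → A) (m : ℕ) (c c' : Fin 3) : Prop :=
  (∀ q < (m + 1) / 2, ∑ x ∈ antidiagonal q,
      (v c x.1 ^ 2 * v c' (2 * x.2 + 1) + v c' x.1 ^ 2 * v c (2 * x.2 + 1)) = 0) ∧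
  (∀ q, 2 * q ≤ m → v 0 q ^ 2 + ∑ x ∈ antidiagonal q,
      (v c x.1 ^ 2 * v c' (2 * x.2) + v c' x.1 ^ 2 * v c (2 * x.2)) = 0)

theorem jdEqs_symm {A : Type*} [CommRing A] {v : Fin 3 → ℕ → A} {m : ℕ} {c c' : Fin 3}
    (h : jdEqs v m c c') : jdEqs v m c' c := by
  refine ⟨fun q hq => ?_, fun q hq => ?_⟩
  · rw [← h.1 q hq]
    exact Finset.sum_congr rfl fun x _ => add_comm _ _
  · rw [← h.2 q hq]
    exact congrArg _ (Finset.sum_congr rfl fun x _ => add_comm _ _)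

theorem jd_cover_of_eqs {A : Type*} [CommRing A] [IsDomain A] (v : Fin 3 → ℕ → A) (m : ℕ)
    (hv : ∀ j i, m < i → v j i = 0) (c c' : Fin 3) (hj : ∀ j, j = 0 ∨ j = c ∨ j = c')
    (h : jdEqs v m c c')
    (e : ℕ) (hce : ∀ i < e, v c i = 0) (hce' : ∀ i < e, v c' i = 0) (hne : v c e ≠ 0) :
    jdCover v (jdT m c c' e) := by
  intro C hC hT
  have hem : e ≤ m := by
    by_contra hcon
    exact hne (hv c e (by omega))
  have heC : v c e ∈ C := by
    refine hT (c, e) ?_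
    simp only [jdT, mem_union, mem_product, mem_singleton, mem_Icc]
    exact Or.inl (Or.inr ⟨trivial, le_rfl, hem⟩)
  obtain ⟨r1, r2, r3⟩ := jd_cover_T v m hv c c' hj h.1 h.2 e hce hce' C
    (fun a ha => hC.1 _ a (pow_ne_zero 2 hne) (pow_mem heC 2) ha)
    (fun _ a ha => hC.2.1 _ a hne heC ha) hT
  intro j i
  rcases hj j with rfl | rfl | rfl
  · exact hC.2.2 _ (r3 i)
  · exact r1 i
  · exact r2 i

/-- On a component of dimension at least `2 m + 2`, the constant terms do not vanish. -/
theorem jd_nonzero {A : Type*} [CommRing A] [IsDomain A] (v : Fin 3 → ℕ → A) (m : ℕ)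
    (hv : ∀ j i, m < i → v j i = 0) (h : jdEqs v m 1 2)
    (hcard : ∀ T, jdCover v T → 2 * m + 2 ≤ T.card) : v 1 0 ≠ 0 ∧ v 2 0 ≠ 0 := by
  classical
  have hj12 : ∀ j : Fin 3, j = 0 ∨ j = 1 ∨ j = 2 := by decide
  have hj21 : ∀ j : Fin 3, j = 0 ∨ j = 2 ∨ j = 1 := by decide
  -- the two coordinates do not vanish identically
  have hex : ∃ e, v 1 e ≠ 0 ∨ v 2 e ≠ 0 := by
    by_contra hcon
    push Not at hcon
    have hcov : jdCover v (({0} : Finset (Fin 3)) ×ˢ Icc 0 m) := by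
      intro C hC hT j i
      rcases hj12 j with rfl | rfl | rfl
      · by_cases hi : m < i
        · rw [hv _ i hi]; exact zero_mem _
        · exact hT (0, i) (by simp; omega)
      · rw [(hcon i).1]; exact zero_mem _
      · rw [(hcon i).2]; exact zero_mem _
    have := hcard _ hcov
    simp at this
    omega
  have hlt : ∀ i < Nat.find hex, v 1 i = 0 ∧ v 2 i = 0 := by
    intro i hi
    have := Nat.find_min hex hi
    push Not at this
    exact this
  -- the key dimension count
  have key : ∀ c c' : Fin 3, (∀ j, j = 0 ∨ j = c ∨ j = c') → jdEqs v m c c' →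
      (∀ i < Nat.find hex, v c i = 0) → (∀ i < Nat.find hex, v c' i = 0) →
      v c (Nat.find hex) ≠ 0 → v c 0 ≠ 0 ∧ v c' 0 ≠ 0 := by
    intro c c' hj heq h1 h2 hne
    have hcov := jd_cover_of_eqs v m hv c c' hj heq _ h1 h2 hne
    have hem : Nat.find hex ≤ m := by
      by_contra hcon
      exact hne (hv c _ (by omega))
    have hb := (hcard _ hcov).trans (jdT_card m c c' _)
    have he : Nat.find hex = 0 := by omega
    rw [he] at hcov hne
    refine ⟨hne, fun h0 => ?_⟩
    have hcov2 := jd_cover_erase v _ hcov (c', 0) h0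
    have hmem : (c', 0) ∈ jdT m c c' 0 := by simp [jdT]
    have h3 := hcard _ hcov2
    rw [Finset.card_erase_of_mem hmem] at h3
    have h4 := jdT_card m c c' 0
    omega
  rcases Nat.find_spec hex with hne | hne
  · exact key 1 2 hj12 h (fun i hi => (hlt i hi).1) (fun i hi => (hlt i hi).2) hne
  · exact (key 2 1 hj21 (jdEqs_symm h) (fun i hi => (hlt i hi).2) (fun i hi => (hlt i hi).1)
      hne).symm

/-- The ideal of the jet scheme. -/
noncomputable def jdI (k : Type*) [Field k] (m : ℕ) :
    Ideal (MvPolynomial (Fin 3 × Fin (m + 1)) k) :=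
  Ideal.span {p : MvPolynomial (Fin 3 × Fin (m + 1)) k | ∃ j ≤ m, p = fC k m j}

theorem jd_eqs_quotient (k : Type*) [Field k] [CharP k 2] (m : ℕ)
    (J : Ideal (MvPolynomial (Fin 3 × Fin (m + 1)) k)) (hJ : jdI k m ≤ J) :
    jdEqs (fun j i => Ideal.Quotient.mk J (jdV k m j i)) m 1 2 := by
  have hz : ∀ j ≤ m, Ideal.Quotient.mk J (fC k m j) = 0 := fun j hj =>
    Ideal.Quotient.eq_zero_iff_mem.2 (hJ (Ideal.subset_span ⟨j, hj, rfl⟩))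
  refine ⟨fun q hq => ?_, fun q hq => ?_⟩
  · have h := hz (2 * q + 1) (by omega)
    rw [jd_fC_odd, map_sum] at h
    simpa only [map_add, map_mul, map_pow] using h
  · have h := hz (2 * q) hq
    rw [jd_fC_even, map_add, map_sum] at h
    simpa only [map_add, map_mul, map_pow] using h

theorem jd_vanish (k : Type*) [Field k] (m : ℕ)
    (J : Ideal (MvPolynomial (Fin 3 × Fin (m + 1)) k)) (j : Fin 3) (i : ℕ) (hi : m < i) :
    Ideal.Quotient.mk J (jdV k m j i) = 0 := by
  have : ¬ i < m + 1 := by omega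
  simp [jdV, this]

/-- Up to a power of `y_0`, squares are polynomials in the free coordinates modulo the ideal. -/
theorem jd_reduce (k : Type*) [Field k] [CharP k 2] (m : ℕ)
    (h : MvPolynomial (Fin 3 × Fin (m + 1)) k) :
    ∃ a : ℕ, ∃ r ∈ Algebra.adjoin k (Set.range fun t : jdT m 1 2 0 => jdV k m t.1.1 t.1.2),
      jdV k m 1 0 ^ a * h ^ 2 - r ∈ jdI k m := by
  set D := Algebra.adjoin k (Set.range fun t : jdT m 1 2 0 => jdV k m t.1.1 t.1.2) with hD
  set π := Ideal.Quotient.mk (jdI k m) with hπ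
  set y := jdV k m 1 0 with hy
  have hyD : y ∈ D := Algebra.subset_adjoin ⟨⟨(1, 0), by simp [jdT]⟩, rfl⟩
  let C : Subring (MvPolynomial (Fin 3 × Fin (m + 1)) k ⧸ jdI k m) :=
    { carrier := {b | ∃ a : ℕ, ∃ r ∈ D, π y ^ a * b = π r}
      mul_mem' := by
        rintro b b' ⟨a, r, hr, h1⟩ ⟨a', r', hr', h1'⟩
        refine ⟨a + a', r * r', mul_mem hr hr', ?_⟩
        rw [map_mul, ← h1, ← h1']; ring
      one_mem' := ⟨0, 1, one_mem _, by simp⟩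
      add_mem' := by
        rintro b b' ⟨a, r, hr, h1⟩ ⟨a', r', hr', h1'⟩
        refine ⟨a + a', y ^ a' * r + y ^ a * r', add_mem (mul_mem (pow_mem hyD _) hr)
          (mul_mem (pow_mem hyD _) hr'), ?_⟩
        rw [map_add, map_mul, map_mul, ← h1, ← h1', map_pow, map_pow]; ring
      zero_mem' := ⟨0, 0, zero_mem _, by simp⟩
      neg_mem' := by
        rintro b ⟨a, r, hr, h1⟩
        refine ⟨a, -r, neg_mem hr, ?_⟩
        rw [map_neg, ← h1]; ring }
  have hDC : ∀ r ∈ D, π r ∈ C := fun r hr => ⟨0, r, hr, by simp⟩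
  have heqs := jd_eqs_quotient k m (jdI k m) le_rfl
  obtain ⟨r1, r2, r3⟩ := jd_cover_T (fun j i => π (jdV k m j i)) m
    (jd_vanish k m (jdI k m)) 1 2 (by decide) heqs.1 heqs.2 0 (by simp) (by simp) C
    (by
      rintro b ⟨a, r, hr, h1⟩
      refine ⟨a + 2, r, hr, ?_⟩
      rw [← h1]; ring)
    (fun h0 => absurd h0 (by decide))
    (fun t ht => hDC _ (Algebra.subset_adjoin ⟨⟨t, ht⟩, rfl⟩))
  have h2 : (2 : MvPolynomial (Fin 3 × Fin (m + 1)) k ⧸ jdI k m) = 0 := jd_two (k := k)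
  have hall : ∀ p : MvPolynomial (Fin 3 × Fin (m + 1)) k, π p ^ 2 ∈ C := by
    intro p
    induction p using MvPolynomial.induction_on with
    | C c =>
      rw [← map_pow]
      exact hDC _ (pow_mem (D.algebraMap_mem c) 2)
    | add p q hp hq =>
      have e : π (p + q) ^ 2 = π p ^ 2 + π q ^ 2 := by
        rw [map_add]; linear_combination (π p * π q) * h2
      rw [e]
      exact add_mem hp hq
    | mul_X p t hp =>
      rw [map_mul, mul_pow]
      refine mul_mem hp ?_
      obtain ⟨j, i⟩ := t
      have hX : (MvPolynomial.X (j, i) : MvPolynomial (Fin 3 × Fin (m + 1)) k) = jdV k m j i := by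
        simp [jdV, Nat.le_of_lt_succ i.2]
      rw [hX]
      have hj12 : ∀ j : Fin 3, j = 0 ∨ j = 1 ∨ j = 2 := by decide
      rcases hj12 j with rfl | rfl | rfl
      · exact r3 i
      · exact pow_mem (r1 i) 2
      · exact pow_mem (r2 i) 2
  obtain ⟨a, r, hr, h1⟩ := hall h
  refine ⟨a, r, hr, ?_⟩
  rw [← Ideal.Quotient.eq, map_mul, map_pow, map_pow]
  exact h1

theorem jd_minimal (k : Type*) [Field k] [CharP k 2] (m : ℕ)
    (P : Ideal (MvPolynomial (Fin 3 × Fin (m + 1)) k)) (hP : P ∈ (jdI k m).minimalPrimes) :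
    ringKrullDim (MvPolynomial (Fin 3 × Fin (m + 1)) k ⧸ P) = ((2 * m + 2 : ℕ) : WithBot ℕ∞) ∧
    jdV k m 1 0 ∉ P ∧ AlgebraicIndependent k
      (fun t : jdT m 1 2 0 => Ideal.Quotient.mk P (jdV k m t.1.1 t.1.2)) := by
  classical
  have hPp : P.IsPrime := hP.1.1
  have hset : {p : MvPolynomial (Fin 3 × Fin (m + 1)) k | ∃ j ≤ m, p = fC k m j}
      = (((Finset.range (m + 1)).image (fC k m) : Finset _) : Set _) := by
    ext p
    simp [Nat.lt_succ_iff, eq_comm]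
  have hcard : ({p : MvPolynomial (Fin 3 × Fin (m + 1)) k | ∃ j ≤ m, p = fC k m j}).encard
      ≤ ((m + 1 : ℕ) : ℕ∞) := by
    rw [hset, Set.encard_coe_eq_coe_finsetCard]
    exact_mod_cast Finset.card_image_le.trans (by simp)
  have hd := jd_dim_ge _ P hP (m + 1) (2 * m + 2) hcard (by simp; omega)
  have hIP : jdI k m ≤ P := hP.1.2
  have hnz := jd_nonzero (fun j i => Ideal.Quotient.mk P (jdV k m j i)) m (jd_vanish k m P)
    (jd_eqs_quotient k m P hIP) (fun T hT => (jd_card m P _ hd T hT).1)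
  have hcov := jd_cover_of_eqs (fun j i => Ideal.Quotient.mk P (jdV k m j i)) m (jd_vanish k m P)
    1 2 (by decide) (jd_eqs_quotient k m P hIP) 0 (by simp) (by simp) hnz.1
  obtain ⟨c1, c2, c3⟩ := jd_card m P _ hd _ hcov
  have hT := jdT_card m 1 2 0
  have hT2 : (jdT m 1 2 0).card ≤ 2 * m + 2 := by omega
  refine ⟨le_antisymm (c3.trans ?_) hd, ?_, c2 hT2⟩
  · exact_mod_cast hT2
  · intro hmem
    exact hnz.1 (Ideal.Quotient.eq_zero_iff_mem.2 hmem)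

theorem jd_minimal_le (k : Type*) [Field k] [CharP k 2] (m : ℕ)
    (P Q : Ideal (MvPolynomial (Fin 3 × Fin (m + 1)) k)) (hP : P ∈ (jdI k m).minimalPrimes)
    (hQ : Q ∈ (jdI k m).minimalPrimes) : P ≤ Q := by
  intro h hh
  obtain ⟨a, r, hr, hmem⟩ := jd_reduce k m h
  obtain ⟨-, -, hind⟩ := jd_minimal k m P hP
  obtain ⟨-, hyQ, -⟩ := jd_minimal k m Q hQ
  have hQp : Q.IsPrime := hQ.1.1
  rw [Algebra.adjoin_range_eq_range_aeval] at hr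
  obtain ⟨p, rfl⟩ := hr
  have hrP : MvPolynomial.aeval (fun t : jdT m 1 2 0 => jdV k m t.1.1 t.1.2) p ∈ P := by
    have h1 := P.sub_mem (P.mul_mem_left (jdV k m 1 0 ^ a) (P.pow_mem_of_mem hh 2 two_pos))
      (hP.1.2 hmem)
    simpa using h1
  have h0 : MvPolynomial.aeval
      (fun t : jdT m 1 2 0 => Ideal.Quotient.mk P (jdV k m t.1.1 t.1.2)) p = 0 := by
    rw [← Ideal.Quotient.eq_zero_iff_mem] at hrP
    rw [← hrP]
    exact (AlgHom.congr_fun (MvPolynomial.comp_aeval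
      (fun t : jdT m 1 2 0 => jdV k m t.1.1 t.1.2) (Ideal.Quotient.mkₐ k P)) p).symm
  have hp : p = 0 := (injective_iff_map_eq_zero _).1 hind p h0
  rw [hp] at hmem
  have h2 : jdV k m 1 0 ^ a * h ^ 2 ∈ Q := hQ.1.2 (by simpa using hmem)
  rcases hQp.mem_or_mem h2 with h3 | h3
  · exact absurd (hQp.mem_of_pow_mem _ h3) hyQ
  · exact hQp.mem_of_pow_mem _ h3

theorem jd_ne_top (k : Type*) [Field k] [CharP k 2] (m : ℕ) : jdI k m ≠ ⊤ := by
  intro htop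
  have hle : jdI k m ≤ RingHom.ker
      (MvPolynomial.constantCoeff (σ := Fin 3 × Fin (m + 1)) (R := k)) := by
    have hV : ∀ j i, MvPolynomial.constantCoeff (jdV k m j i)
        = 0 := by
      intro j i
      unfold jdV
      split_ifs <;> simp
    refine Ideal.span_le.2 ?_
    rintro _ ⟨j, -, rfl⟩
    rw [SetLike.mem_coe, RingHom.mem_ker]
    rcases Nat.even_or_odd' j with ⟨q, rfl | rfl⟩
    · rw [jd_fC_even]
      simp [hV]
    · rw [jd_fC_odd]
      simp [hV]
  rw [htop, top_le_iff] at hle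
  exact RingHom.ker_ne_top _ hle

/-- Let `k` be an algebraically closed field of characteristic 2 and
`S = V(x^2 + y^2 z + y z^2) ⊆ A^3`.  The `m`-th jet scheme
`S_m = Spec R_m/(f^{(0)},...,f^{(m)})` is irreducible (its zero locus has a
prime radical ideal) of dimension `2m + 2`, for every `m ≥ 0`. -/
theorem jet_scheme_D40_irreducible_dim (k : Type*) [Field k] [IsAlgClosed k]
    [CharP k 2] (m : ℕ) :
    (Ideal.span {p : MvPolynomial (Fin 3 × Fin (m + 1)) k |
        ∃ j ≤ m, p = fC k m j}).radical.IsPrime ∧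
    ringKrullDim (MvPolynomial (Fin 3 × Fin (m + 1)) k ⧸
        Ideal.span {p : MvPolynomial (Fin 3 × Fin (m + 1)) k | ∃ j ≤ m, p = fC k m j})
      = ((2 * m + 2 : ℕ) : WithBot ℕ∞) := by
  change (jdI k m).radical.IsPrime ∧
    ringKrullDim (MvPolynomial (Fin 3 × Fin (m + 1)) k ⧸ jdI k m) = ((2 * m + 2 : ℕ) : WithBot ℕ∞)
  obtain ⟨P, hP⟩ := Ideal.nonempty_minimalPrimes (jd_ne_top k m)
  have hrad : (jdI k m).radical = P := by
    rw [← Ideal.sInf_minimalPrimes]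
    exact le_antisymm (sInf_le hP) (le_sInf fun Q hQ => jd_minimal_le k m P Q hP hQ)
  refine ⟨hrad ▸ hP.1.1, ?_⟩
  rw [← (jd_minimal k m P hP).1, ringKrullDim_quotient, ringKrullDim_quotient, ← hrad,
    PrimeSpectrum.zeroLocus_radical]
end

section
/- Let k be an algebraically closed field of characteristic 2, f = x^2+y^2z+yz^2, m >= 5, and R_m = k[x_0,...,x_m,y_0,...,y_m,z_0,...,z_m]. Let J = (x_0, x_1, y_0, y_1, z_0) + (f^{(0)},...,f^{(m)}). Then the extension of J to the localization (R_m)_{z_1} is a prime ideal of height m+2. -/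
open Finset

section helpers
open Polynomial in
theorem H_exists {S : Type*} [CommRing S] (G : Set (S →+* S)) (A B : S[X]) (u : S)
    (hu : B.coeff 0 * u = 1) (hA : ∀ φ ∈ G, A.map φ = A) (hB : ∀ φ ∈ G, B.map φ = B)
    (n : ℕ) : ∃ P : S[X], (∀ φ ∈ G, P.map φ = P) ∧
      X ^ n ∣ A ^ 2 + X * P ^ 2 * B + P * B ^ 2 := by
  have hu' : ∀ φ ∈ G, φ u = u := by
    intro φ hφ
    have h1 : φ (B.coeff 0) = B.coeff 0 := by
      rw [← Polynomial.coeff_map, hB φ hφ]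
    have h2 : B.coeff 0 * φ u = 1 := by rw [← h1, ← map_mul, hu, map_one]
    calc φ u = (B.coeff 0 * u) * φ u := by rw [hu, one_mul]
      _ = u * (B.coeff 0 * φ u) := by ring
      _ = u := by rw [h2, mul_one]
  induction n with
  | zero => exact ⟨0, by simp, by simp⟩
  | succ n ih =>
    obtain ⟨P, hP, D, hD⟩ := ih
    have hF : ∀ φ ∈ G, (A ^ 2 + X * P ^ 2 * B + P * B ^ 2).map φ
        = A ^ 2 + X * P ^ 2 * B + P * B ^ 2 := by
      intro φ hφ
      simp [hA φ hφ, hB φ hφ, hP φ hφ]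
    set c := u ^ 2 * (A ^ 2 + X * P ^ 2 * B + P * B ^ 2).coeff n with hc
    have hcD : c = u ^ 2 * D.coeff 0 := by
      rw [hc, hD]; simp [Polynomial.coeff_X_pow_mul']
    refine ⟨P - C c * X ^ n, ?_, ?_⟩
    · intro φ hφ
      have : φ c = c := by
        rw [hc, map_mul, map_pow, hu' φ hφ, ← Polynomial.coeff_map, hF φ hφ]
      simp [hP φ hφ, this]
    · have e : A ^ 2 + X * (P - C c * X ^ n) ^ 2 * B + (P - C c * X ^ n) * B ^ 2
          = X ^ n * (D - C c * B ^ 2 - X * (2 * P * C c * B - C c ^ 2 * X ^ n * B)) := by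
        linear_combination hD
      rw [e, pow_succ]
      apply mul_dvd_mul_left
      rw [Polynomial.X_dvd_iff]
      have : u ^ 2 * (B.coeff 0) ^ 2 = 1 := by
        rw [← mul_pow, mul_comm, hu, one_pow]
      simp only [pow_two, Polynomial.coeff_sub, Polynomial.mul_coeff_zero, Polynomial.coeff_X_zero,
        Polynomial.coeff_C_zero, zero_mul, sub_zero, hcD]
      linear_combination (-D.coeff 0) * this

open Polynomial in
theorem H_unique {S : Type*} [CommRing S] (A B P Q : S[X]) (hu : IsUnit (B.coeff 0)) (n : ℕ)
    (hP : X ^ n ∣ A ^ 2 + X * P ^ 2 * B + P * B ^ 2)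
    (hQ : X ^ n ∣ A ^ 2 + X * Q ^ 2 * B + Q * B ^ 2) : X ^ n ∣ P - Q := by
  have h := dvd_sub hP hQ
  have e : A ^ 2 + X * P ^ 2 * B + P * B ^ 2 - (A ^ 2 + X * Q ^ 2 * B + Q * B ^ 2)
    = (P - Q) * (X * (P + Q) * B + B ^ 2) := by ring
  rw [e] at h
  refine IsCoprime.dvd_of_dvd_mul_right ?_ h
  apply IsCoprime.pow_left
  obtain ⟨v, hv⟩ := hu.exists_right_inv
  obtain ⟨B', hB'⟩ : (X : S[X]) ∣ B - C (B.coeff 0) := by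
    rw [Polynomial.X_dvd_iff]; simp
  have hv' : C (B.coeff 0) * C v = (1 : S[X]) := by rw [← C_mul, hv, C_1]
  have hB : B = X * B' + C (B.coeff 0) := by linear_combination hB'
  generalize C (B.coeff 0) = b at *
  refine ⟨-((P + Q) * B + B' * (B + b)) * (C v) ^ 2, (C v) ^ 2, ?_⟩
  have : b ^ 2 * (C v) ^ 2 = 1 := by rw [← mul_pow, hv', one_pow]
  linear_combination this + (B + b) * (C v) ^ 2 * hB

open Polynomial in
theorem H_congr {S : Type*} [CommRing S] (A B P Q : S[X]) (n : ℕ)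
    (hP : X ^ n ∣ A ^ 2 + X * P ^ 2 * B + P * B ^ 2)
    (hQ : X ^ n ∣ Q - P) : X ^ n ∣ A ^ 2 + X * Q ^ 2 * B + Q * B ^ 2 := by
  have e : A ^ 2 + X * Q ^ 2 * B + Q * B ^ 2 = A ^ 2 + X * P ^ 2 * B + P * B ^ 2 +
     (Q - P) * (X * (P + Q) * B + B ^ 2) := by ring
  rw [e]
  exact dvd_add hP (hQ.mul_right _)

theorem H_coeff (k : Type*) [Field k] (m : ℕ) (j : Fin 3) (i : ℕ) :
    (jetSer k m j).coeff i =
      if h : i < m + 1 then MvPolynomial.X (j, ⟨i, h⟩) else 0 := by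
  unfold jetSer
  simp only [Polynomial.finsetSum_coeff, Polynomial.coeff_C_mul, Polynomial.coeff_X_pow]
  split_ifs with h
  · rw [Finset.sum_eq_single ⟨i, h⟩]
    · simp
    · intro b _ hb
      have : i ≠ b := fun h' => hb (Fin.ext h'.symm)
      simp [this]
    · simp
  · apply Finset.sum_eq_zero
    intro b _
    have : i ≠ b := by have := b.2; omega
    simp [this]

open Polynomial in
/-- shifted series -/
noncomputable def HX (k : Type*) [Field k] (m : ℕ) := (jetSer k m 0).divX.divX
noncomputable def HY (k : Type*) [Field k] (m : ℕ) := (jetSer k m 1).divX.divX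
noncomputable def HZ (k : Type*) [Field k] (m : ℕ) := (jetSer k m 2).divX

open Polynomial in
theorem H_key (k : Type*) [Field k] (m : ℕ) (hm : 5 ≤ m) (i0 : 0 < m + 1) (i1 : 1 < m + 1) {Q : Type*} [CommRing Q]
    (φ : MvPolynomial (Fin 3 × Fin (m + 1)) k →+* Q)
    (h1 : φ (MvPolynomial.X (0, ⟨0, i0⟩)) = 0)
    (h2 : φ (MvPolynomial.X (0, ⟨1, i1⟩)) = 0)
    (h3 : φ (MvPolynomial.X (1, ⟨0, i0⟩)) = 0)
    (h4 : φ (MvPolynomial.X (1, ⟨1, i1⟩)) = 0)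
    (h5 : φ (MvPolynomial.X (2, ⟨0, i0⟩)) = 0) :
    (∀ j ≤ m, φ (fC k m j) = 0) ↔ X ^ (m - 3) ∣ (HX k m).map φ ^ 2
      + X * (HY k m).map φ ^ 2 * (HZ k m).map φ + (HY k m).map φ * (HZ k m).map φ ^ 2 := by
  have hdiv : ∀ p : (MvPolynomial (Fin 3 × Fin (m + 1)) k)[X], φ (p.coeff 0) = 0 →
      p.map φ = X * p.divX.map φ := by
    intro p hp
    have h := congrArg (Polynomial.map φ) (Polynomial.X_mul_divX_add p)
    rw [← h]
    simp only [Polynomial.map_add, Polynomial.map_mul, Polynomial.map_X, Polynomial.map_C, hp,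
      C_0, add_zero]
  have eX : (jetSer k m 0).map φ = X ^ 2 * (HX k m).map φ := by
    rw [hdiv, hdiv, HX]
    · ring
    · rw [Polynomial.coeff_divX, H_coeff, dif_pos (by omega)]; exact h2
    · rw [H_coeff, dif_pos (by omega)]; exact h1
  have eY : (jetSer k m 1).map φ = X ^ 2 * (HY k m).map φ := by
    rw [hdiv, hdiv, HY]
    · ring
    · rw [Polynomial.coeff_divX, H_coeff, dif_pos (by omega)]; exact h4
    · rw [H_coeff, dif_pos (by omega)]; exact h3
  have eZ : (jetSer k m 2).map φ = X * (HZ k m).map φ := by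
    rw [hdiv, HZ]
    rw [H_coeff, dif_pos (by omega)]; exact h5
  have e : ∀ j, φ (fC k m j) = (X ^ 4 * ((HX k m).map φ ^ 2
      + X * (HY k m).map φ ^ 2 * (HZ k m).map φ + (HY k m).map φ * (HZ k m).map φ ^ 2)).coeff j := by
    intro j
    rw [fC, ← Polynomial.coeff_map]
    simp only [Polynomial.map_add, Polynomial.map_mul, Polynomial.map_pow, eX, eY, eZ]
    congr 1
    ring
  simp only [e, Polynomial.X_pow_dvd_iff, Polynomial.coeff_X_pow_mul']
  constructor
  · intro h d hd
    have := h (d + 4) (by omega)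
    simpa using this
  · intro h j hj
    split_ifs with h'
    · exact h _ (by omega)
    · rfl

theorem H_krull {S σ : Type*} [CommRing S] [IsNoetherianRing S] (V : Finset σ) (f : σ → S)
    (hp : (Ideal.span (Set.image f (V : Set σ))).IsPrime) :
    Order.height (⟨_, hp⟩ : PrimeSpectrum S) ≤ (V.card : ℕ∞) := by
  rw [← PrimeSpectrum.height_eq_orderHeight]
  refine (Ideal.height_le_spanFinrank _ hp.ne_top).trans ?_
  norm_cast
  refine (Submodule.spanFinrank_span_le_ncard_of_finite (V.finite_toSet.image _)).trans ?_
  refine (Set.ncard_image_le V.finite_toSet).trans ?_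
  simp

section general
variable {k : Type*} [Field k] {σ : Type*} [Finite σ] (z : σ)

local notation "SS" => Localization.Away (MvPolynomial.X z : MvPolynomial σ k)

/-- the variable in the localization -/
noncomputable def lX (i : σ) : Localization.Away (MvPolynomial.X z : MvPolynomial σ k) :=
  algebraMap (MvPolynomial σ k) _ (MvPolynomial.X i)

theorem lX_unit : IsUnit (lX (k := k) z z) := IsLocalization.Away.algebraMap_isUnit _

/-- substitution fixing z -/
noncomputable def sub (g : σ → SS) (hg : g z = lX z z) : SS →ₐ[k] SS :=
  IsLocalization.liftAlgHom (M := Submonoid.powers (MvPolynomial.X z : MvPolynomial σ k))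
    (f := MvPolynomial.aeval g) (by
      rintro ⟨_, n, rfl⟩
      simp only [map_pow, MvPolynomial.aeval_X, hg]
      exact (lX_unit z).pow n)

theorem sub_lX (g : σ → SS) (hg : g z = lX z z) (i : σ) : sub z g hg (lX z i) = g i := by
  simp [sub, lX]

theorem S_hom_ext {Q : Type*} [CommRing Q] [Algebra k Q] (φ ψ : SS →ₐ[k] Q)
    (h : ∀ i, φ (lX z i) = ψ (lX z i)) : φ = ψ := by
  apply IsLocalization.algHom_ext (Submonoid.powers (MvPolynomial.X z : MvPolynomial σ k))
  apply MvPolynomial.algHom_ext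
  intro i
  exact h i

theorem general_height (V : Finset σ) (hz : z ∉ V) (w : σ → SS)
    (hw : ∀ φ : SS →ₐ[k] SS, (∀ i ∉ V, φ (lX z i) = lX z i) → ∀ v ∈ V, φ (w v) = w v) :
    (∃ ψ : SS →ₐ[k] SS, (∀ v ∈ V, ψ (lX z v) = w v) ∧ (∀ i ∉ V, ψ (lX z i) = lX z i) ∧
      RingHom.ker ψ = Ideal.span (Set.image (fun v => lX z v - w v) (V : Set σ))) ∧
    ∃ h : (Ideal.span (Set.image (fun v => lX z v - w v) (V : Set σ))).IsPrime,
      Order.height (⟨_, h⟩ : PrimeSpectrum SS) = (V.card : ℕ∞) := by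
  classical
  have : IsDomain SS := IsLocalization.isDomain_localization
    (powers_le_nonZeroDivisors_of_noZeroDivisors (MvPolynomial.X_ne_zero z))
  have : IsNoetherianRing SS := IsLocalization.isNoetherianRing
    (Submonoid.powers (MvPolynomial.X z : MvPolynomial σ k)) _ inferInstance
  let g : Finset σ → σ → SS := fun U i => if i ∈ U ∧ i ∈ V then w i else lX z i
  have hg : ∀ U, g U z = lX z z := fun U => by simp [g, hz]
  let ψ : Finset σ → (SS →ₐ[k] SS) := fun U => sub z (g U) (hg U)
  have ψ1 : ∀ U, ∀ v ∈ U, v ∈ V → ψ U (lX z v) = w v := by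
    intro U v h1 h2
    simp [ψ, sub_lX, g, h1, h2]
  have ψ2 : ∀ U, ∀ v ∉ V, ψ U (lX z v) = lX z v := by
    intro U v h1
    simp [ψ, sub_lX, g, h1]
  have ψ3 : ∀ U, ∀ v ∉ U, ψ U (lX z v) = lX z v := by
    intro U v h1
    simp [ψ, sub_lX, g, h1]
  have ψw : ∀ U, ∀ v ∈ V, ψ U (w v) = w v := fun U => hw _ (ψ2 U)
  have hker : ∀ U, ∀ v ∈ U, v ∈ V → lX z v - w v ∈ RingHom.ker (ψ U) := by
    intro U v h1 h2
    rw [RingHom.mem_ker, map_sub, ψ1 U v h1 h2, ψw U v h2, sub_self]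
  have hprime : ∀ U, (RingHom.ker (ψ U)).IsPrime := fun U => RingHom.ker_isPrime _
  have hlow : ∀ U ⊆ V, (U.card : ℕ∞) ≤
      Order.height (⟨_, hprime U⟩ : PrimeSpectrum SS) := by
    intro U
    induction U using Finset.induction_on with
    | empty => simp
    | insert v U hv ih =>
      intro hU
      have hvV : v ∈ V := hU (Finset.mem_insert_self _ _)
      have hUV : U ⊆ V := fun x hx => hU (Finset.mem_insert_of_mem hx)
      rw [Finset.card_insert_of_notMem hv]
      push_cast
      have hlt : (⟨_, hprime U⟩ : PrimeSpectrum SS) < ⟨_, hprime (insert v U)⟩ := by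
        rw [← PrimeSpectrum.asIdeal_lt_asIdeal]
        refine lt_of_le_of_ne ?_ ?_
        · have hc : (ψ (insert v U)).comp (ψ U) = ψ (insert v U) := by
            apply S_hom_ext
            intro i
            by_cases hi : i ∈ U
            · rw [AlgHom.comp_apply, ψ1 U i hi (hUV hi), ψw _ i (hUV hi),
                ψ1 _ i (Finset.mem_insert_of_mem hi) (hUV hi)]
            · rw [AlgHom.comp_apply, ψ3 U i hi]
          intro s hs
          have hs' : ψ U s = 0 := hs
          change ψ (insert v U) s = 0
          rw [← hc, AlgHom.comp_apply, hs', map_zero]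
        · intro heq
          have h1 := hker (insert v U) v (Finset.mem_insert_self _ _) hvV
          have h2 : lX z v - w v ∈ RingHom.ker (ψ U) := by
            have heq' : RingHom.ker (ψ U) = RingHom.ker (ψ (insert v U)) := heq
            rw [heq']; exact h1
          rw [RingHom.mem_ker, map_sub, ψ3 U v hv, ψw U v hvV, sub_eq_zero] at h2
          have hzv : z ≠ v := fun h => hz (h ▸ hvV)
          let χ := sub (k := k) z (fun i => if i = v then lX z v + 1 else lX z i) (by simp [hzv])
          have h3 : χ (w v) = w v := by
            refine hw χ ?_ v hvV
            intro i hi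
            have : i ≠ v := fun h => hi (h ▸ hvV)
            simp [χ, sub_lX, this]
          rw [← h2] at h3
          simp [χ, sub_lX] at h3
      exact (add_le_add_left (ih hUV) 1).trans (Order.height_add_one_le hlt)
  have hkV : RingHom.ker (ψ V) = Ideal.span (Set.image (fun v => lX z v - w v) (V : Set σ)) := by
    apply le_antisymm
    · intro s hs
      set K := Ideal.span (Set.image (fun v => lX (k := k) z v - w v) (V : Set σ))
      have : (Ideal.Quotient.mkₐ k K).comp (ψ V) = Ideal.Quotient.mkₐ k K := by
        apply S_hom_ext
        intro i
        by_cases hi : i ∈ V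
        · rw [AlgHom.comp_apply, ψ1 V i hi hi]
          symm
          rw [← sub_eq_zero, ← map_sub]
          exact Ideal.Quotient.eq_zero_iff_mem.2 (Ideal.subset_span ⟨i, hi, rfl⟩)
        · rw [AlgHom.comp_apply, ψ3 V i hi]
      have hs' : ψ V s = 0 := hs
      have h2 := DFunLike.congr_fun this s
      rw [AlgHom.comp_apply, hs', map_zero] at h2
      exact Ideal.Quotient.eq_zero_iff_mem.1 h2.symm
    · rw [Ideal.span_le]
      rintro _ ⟨v, hv, rfl⟩
      exact hker V v hv hv
  refine ⟨⟨ψ V, fun v hv => ψ1 V v hv hv, ψ2 V, hkV⟩, hkV ▸ hprime V, ?_⟩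
  have hp : (Ideal.span (Set.image (fun v => lX (k := k) z v - w v) (V : Set σ))).IsPrime :=
    hkV ▸ hprime V
  apply le_antisymm
  · exact H_krull V _ hp
  · have := hlow V subset_rfl
    have heq : (⟨_, hprime V⟩ : PrimeSpectrum SS) = ⟨_, hp⟩ := PrimeSpectrum.ext hkV
    rw [heq] at this
    exact this

end general
end helpers

/-- Proposition 3.3: for `m ≥ 5`, the extension of
`J = (x_0, x_1, y_0, y_1, z_0) + (f^{(0)},...,f^{(m)})` to the localization
`(R_m)_{z_1}` is a prime ideal of height `m + 2`. -/
theorem Jm1_localized_prime_of_height (k : Type*) [Field k] [IsAlgClosed k]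
    [CharP k 2] (m : ℕ) (hm : 5 ≤ m) :
    let R := MvPolynomial (Fin 3 × Fin (m + 1)) k
    let z1 : R := MvPolynomial.X (2, ⟨1, by omega⟩)
    let J : Ideal R :=
      Ideal.span {MvPolynomial.X (0, ⟨0, by omega⟩), MvPolynomial.X (0, ⟨1, by omega⟩),
          MvPolynomial.X (1, ⟨0, by omega⟩), MvPolynomial.X (1, ⟨1, by omega⟩),
          MvPolynomial.X (2, ⟨0, by omega⟩)}
        ⊔ Ideal.span {p : R | ∃ j ≤ m, p = fC k m j}
    let Je : Ideal (Localization.Away z1) :=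
      J.map (algebraMap R (Localization.Away z1))
    ∃ h : Je.IsPrime,
      Order.height (⟨Je, h⟩ : PrimeSpectrum (Localization.Away z1))
        = ((m + 2 : ℕ) : ℕ∞) := by
  intro R z1 J Je
  classical
  let σ := Fin 3 × Fin (m + 1)
  let z : σ := (2, ⟨1, by omega⟩)
  let S := Localization.Away (MvPolynomial.X z : MvPolynomial σ k)
  let V : Finset σ := Finset.univ.filter fun p =>
    (p.2 : ℕ) < (if p.1 = 0 then 2 else if p.1 = 1 then m - 1 else 1)
  have hV : ∀ (j : Fin 3) (i : Fin (m + 1)), ((j, i) : σ) ∈ V ↔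
      (i : ℕ) < (if j = 0 then 2 else if j = 1 then m - 1 else 1) := by
    intro j i; simp [V]
  have hcard : V.card = m + 2 := by
    simp only [V, Finset.card_filter]
    rw [← Finset.univ_product_univ, Finset.sum_product, Fin.sum_univ_three]
    have e : ∀ c, (∑ i : Fin (m + 1), if (i : ℕ) < c then 1 else 0) = min (m + 1) c := by
      intro c; rw [← Finset.card_filter, Fin.card_filter_val_lt]
    refine (congrArg₂ (· + ·) (congrArg₂ (· + ·) (e 2) (e (m - 1))) (e 1)).trans ?_
    omega
  have hz : z ∉ V := by rw [hV]; simp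
  let al : MvPolynomial (Fin 3 × Fin (m + 1)) k →+* S := algebraMap R S
  let A := (HX k m).map al
  let B := (HZ k m).map al
  let G : Set (S →+* S) := {φ | ∀ i ∉ V, φ (lX z i) = lX z i}
  have hBc : B.coeff 0 = lX z z := by
    simp only [B, HZ, Polynomial.coeff_map, Polynomial.coeff_divX, H_coeff]
    rw [dif_pos (by omega)]
    rfl
  have hunit : IsUnit (B.coeff 0) := by rw [hBc]; exact lX_unit z
  obtain ⟨u, hu⟩ := hunit.exists_right_inv
  have hA : ∀ φ ∈ G, A.map φ = A := by
    intro φ hφ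
    ext n
    simp only [A, HX, Polynomial.coeff_map, Polynomial.coeff_divX, H_coeff]
    split_ifs with h
    · exact hφ _ (by rw [hV]; simp)
    · simp
  have hB : ∀ φ ∈ G, B.map φ = B := by
    intro φ hφ
    ext n
    simp only [B, HZ, Polynomial.coeff_map, Polynomial.coeff_divX, H_coeff]
    split_ifs with h
    · exact hφ _ (by rw [hV]; simp)
    · simp
  obtain ⟨P, hPG, hP⟩ := H_exists G A B u hu hA hB (m - 3)
  let w : σ → S := fun p => if p.1 = 1 ∧ 2 ≤ (p.2 : ℕ) then P.coeff ((p.2 : ℕ) - 2) else 0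
  have hw : ∀ φ : S →ₐ[k] S, (∀ i ∉ V, φ (lX z i) = lX z i) → ∀ v ∈ V, φ (w v) = w v := by
    intro φ hφ v _
    simp only [w]
    split_ifs
    · have := hPG (φ : S →+* S) hφ
      conv_rhs => rw [← this]
      rw [Polynomial.coeff_map]
      rfl
    · simp
  obtain ⟨⟨ψ, ψV, ψF, hker⟩, hprime, hheight⟩ := general_height (k := k) z V hz w hw
  set K : Ideal S := Ideal.span (Set.image (fun v => lX z v - w v) (V : Set σ)) with hK
  have hKJ : K = Je := by
    apply le_antisymm
    · let q := (Ideal.Quotient.mk Je)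
      let φ : MvPolynomial (Fin 3 × Fin (m + 1)) k →+* S ⧸ Je := q.comp al
      have hJ : ∀ r ∈ J, φ r = 0 := fun r hr =>
        Ideal.Quotient.eq_zero_iff_mem.2 (Ideal.mem_map_of_mem al hr)
      have hJ1 : ∀ r ∈ ({MvPolynomial.X (0, ⟨0, by omega⟩), MvPolynomial.X (0, ⟨1, by omega⟩),
          MvPolynomial.X (1, ⟨0, by omega⟩), MvPolynomial.X (1, ⟨1, by omega⟩),
          MvPolynomial.X (2, ⟨0, by omega⟩)} : Set R), φ r = 0 := fun r hr =>
        hJ r (Ideal.mem_sup_left (Ideal.subset_span hr))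
      have a1 := hJ1 (MvPolynomial.X (0, ⟨0, by omega⟩)) (by simp)
      have a2 := hJ1 (MvPolynomial.X (0, ⟨1, by omega⟩)) (by simp)
      have a3 := hJ1 (MvPolynomial.X (1, ⟨0, by omega⟩)) (by simp)
      have a4 := hJ1 (MvPolynomial.X (1, ⟨1, by omega⟩)) (by simp)
      have a5 := hJ1 (MvPolynomial.X (2, ⟨0, by omega⟩)) (by simp)
      have hd := (H_key k m hm (by omega) (by omega) φ a1 a2 a3 a4 a5).1 fun j hj =>
        hJ _ (Ideal.mem_sup_right (Ideal.subset_span ⟨j, hj, rfl⟩))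
      have eA : (HX k m).map φ = A.map q := by simp [A, φ, Polynomial.map_map]
      have eB : (HZ k m).map φ = B.map q := by simp [B, φ, Polynomial.map_map]
      rw [eA, eB] at hd
      have hP' : Polynomial.X ^ (m - 3) ∣ (A.map q) ^ 2 +
          Polynomial.X * (P.map q) ^ 2 * B.map q + P.map q * (B.map q) ^ 2 := by
        have := Polynomial.map_dvd q hP
        simpa using this
      have hdiff := H_unique _ _ _ _
        (by rw [Polynomial.coeff_map]; exact hunit.map q) (m - 3) hd hP'
      rw [Polynomial.X_pow_dvd_iff] at hdiff
      rw [hK, Ideal.span_le]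
      rintro _ ⟨⟨j, i, hi⟩, hv, rfl⟩
      have hv' := (hV _ _).1 hv
      refine Ideal.Quotient.eq_zero_iff_mem.1 ?_
      change q _ = 0
      simp only [map_sub]
      change φ (MvPolynomial.X _) - _ = 0
      fin_cases j
      · have : w (0, ⟨i, hi⟩) = 0 := by simp [w]
        simp at hv'
        simp only [Fin.zero_eta, Fin.isValue, this, map_zero, sub_zero]
        interval_cases i
        · exact a1
        · exact a2
      · simp at hv'
        by_cases h2 : 2 ≤ i
        · obtain ⟨d, rfl⟩ : ∃ d, i = d + 2 := ⟨i - 2, by omega⟩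
          have : w (1, ⟨d + 2, hi⟩) = P.coeff d := by simp [w]
          have h3 := hdiff d (by omega)
          simp only [HY, Polynomial.coeff_sub, Polynomial.coeff_map, Polynomial.coeff_divX,
            H_coeff] at h3
          rw [dif_pos (by omega)] at h3
          simp only [Fin.mk_one, Fin.isValue, this]
          exact h3
        · have : w (1, ⟨i, hi⟩) = 0 := by simp [w]; omega
          simp only [Fin.mk_one, Fin.isValue, this, map_zero, sub_zero]
          interval_cases i
          · exact a3
          · exact a4
      · have : w (2, ⟨i, hi⟩) = 0 := by simp [w]
        simp at hv'
        simp only [Fin.reduceFinMk, Fin.isValue, this, map_zero, sub_zero]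
        subst hv'
        exact a5
    · rw [← hker]
      let φ : MvPolynomial (Fin 3 × Fin (m + 1)) k →+* S := (ψ : S →+* S).comp al
      have hφ : ∀ i, φ (MvPolynomial.X i) = ψ (lX z i) := fun _ => rfl
      have b : ∀ (j : Fin 3) (i : Fin (m + 1)), (j, i) ∈ V → (j = 1 → (i : ℕ) < 2) →
          φ (MvPolynomial.X (j, i)) = 0 := by
        intro j i h1 h2
        rw [hφ, ψV _ h1]
        simp only [w]
        rw [if_neg]
        rintro ⟨h3, h4⟩
        have := h2 h3
        omega
      have a1 := b 0 ⟨0, by omega⟩ (by rw [hV]; simp) (by simp)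
      have a2 := b 0 ⟨1, by omega⟩ (by rw [hV]; simp) (by simp)
      have a3 := b 1 ⟨0, by omega⟩ (by rw [hV]; simp; omega) (by simp)
      have a4 := b 1 ⟨1, by omega⟩ (by rw [hV]; simp; omega) (by simp)
      have a5 := b 2 ⟨0, by omega⟩ (by rw [hV]; simp) (by simp)
      have eA : (HX k m).map φ = A := by
        rw [← hA (ψ : S →+* S) ψF]; simp [A, φ, Polynomial.map_map]
      have eB : (HZ k m).map φ = B := by
        rw [← hB (ψ : S →+* S) ψF]; simp [B, φ, Polynomial.map_map]
      have hf := (H_key k m hm (by omega) (by omega) φ a1 a2 a3 a4 a5).2 (by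
        rw [eA, eB]
        refine H_congr A B P _ _ hP ?_
        rw [Polynomial.X_pow_dvd_iff]
        intro d hd
        simp only [HY, Polynomial.coeff_sub, Polynomial.coeff_map, Polynomial.coeff_divX,
            H_coeff]
        rw [dif_pos (by omega), hφ, ψV _ (by rw [hV]; simp; omega)]
        simp [w])
      refine Ideal.map_le_iff_le_comap.2 (sup_le ?_ ?_)
      · rw [Ideal.span_le]
        intro r hr
        change φ r = 0
        simp only [Set.mem_insert_iff, Set.mem_singleton_iff] at hr
        rcases hr with rfl | rfl | rfl | rfl | rfl
        · exact a1
        · exact a2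
        · exact a3
        · exact a4
        · exact a5
      · rw [Ideal.span_le]
        rintro _ ⟨j, hj, rfl⟩
        exact hf j hj
  rw [← hcard]
  clear_value Je
  subst hKJ
  exact ⟨hprime, hheight⟩
end

section
/- Let k be an algebraically closed field of characteristic 2, S = V(x^2+y^2z+yz^2) in A^3, m >= 5, and S_m^0 the fiber of the m-th jet scheme S_m over the singular point. Then S_m^0 has exactly four irreducible components, each of dimension 2m+1. -/
open Finset

open MvPolynomial in
theorem ht_max {k : Type*} [Field k] [IsAlgClosed k] {σ : Type*} [Finite σ]
    (M : Ideal (MvPolynomial σ k)) (hM : M.IsMaximal) : M.height = Nat.card σ := by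
  have hdim : ringKrullDim (MvPolynomial σ k) = Nat.card σ := by
    rw [MvPolynomial.ringKrullDim_of_isNoetherianRing, ringKrullDim_eq_zero_of_field, zero_add]
  have : FiniteRingKrullDim (MvPolynomial σ k) := by
    rw [finiteRingKrullDim_iff_ne_bot_and_top, hdim]
    refine ⟨?_, ?_⟩
    · exact WithBot.coe_ne_bot (a := ((Nat.card σ : ℕ) : ℕ∞))
    · intro h
      have h2 : (((Nat.card σ : ℕ) : ℕ∞) : WithBot ℕ∞) = ((⊤ : ℕ∞) : WithBot ℕ∞) := h
      exact ENat.natCast_ne_top _ (WithBot.coe_inj.mp h2)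
  obtain ⟨M', hM', h'⟩ := Ideal.exists_isMaximal_height (R := MvPolynomial σ k)
  obtain ⟨x, rfl⟩ := isMaximal_iff_eq_vanishingIdeal_singleton.mp hM
  obtain ⟨x', rfl⟩ := isMaximal_iff_eq_vanishingIdeal_singleton.mp hM'
  let e : MvPolynomial σ k ≃ₐ[k] MvPolynomial σ k :=
    AlgEquiv.ofAlgHom (aeval fun i => X i + C (x' i - x i)) (aeval fun i => X i + C (x i - x' i))
      (by ext i; simp; ring) (by ext i; simp; ring)
  have he : ∀ p, aeval x (e p) = aeval x' p := by
    intro p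
    have : (aeval x).comp (e : MvPolynomial σ k →ₐ[k] MvPolynomial σ k) = aeval (R := k) x' := by
      ext i; simp [e]
    exact congrArg (fun f => f p) this
  have : (vanishingIdeal k {x}).comap e.toRingEquiv = vanishingIdeal k {x'} := by
    ext p
    simp only [Ideal.mem_comap]
    rw [mem_vanishingIdeal_singleton_iff, mem_vanishingIdeal_singleton_iff, ← he]
    rfl
  rw [← RingEquiv.height_comap e.toRingEquiv, this]
  rw [hdim] at h'
  exact_mod_cast h'

theorem ht_core {k : Type*} [Field k] [IsAlgClosed k] {σ : Type*} [Finite σ]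
    (p : Ideal (MvPolynomial σ k)) [hp : p.IsPrime] (g : MvPolynomial σ k) (hg : g ∉ p) :
    ((Nat.card σ : ℕ∞) : WithBot ℕ∞) ≤ Order.krullDim
      {q : PrimeSpectrum (MvPolynomial σ k) // p ≤ q.asIdeal ∧ g ∉ q.asIdeal} + p.height := by
  classical
  obtain ⟨s, hs, hcard⟩ := p.exists_finset_card_eq_height_of_isNoetherianRing
  -- an element separating p from the other minimal primes
  have hfin : (Ideal.span (s : Set (MvPolynomial σ k))).minimalPrimes.Finite :=
    Ideal.finite_minimalPrimes_of_isNoetherianRing _ _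
  have hsep : ∃ h ∉ p, ∀ q ∈ (Ideal.span (s : Set (MvPolynomial σ k))).minimalPrimes,
      q ≠ p → h ∈ q := by
    have : ∀ q ∈ (Ideal.span (s : Set (MvPolynomial σ k))).minimalPrimes, ∃ h ∉ p,
        q ≠ p → h ∈ q := by
      intro q hq
      by_cases hqp : q = p
      · exact ⟨1, fun h => hp.ne_top ((Ideal.eq_top_iff_one _).2 h), fun h => (h hqp).elim⟩
      · have : ¬ q ≤ p := fun hle => hqp (le_antisymm hle (hs.2 hq.1 hle))
        obtain ⟨h, h1, h2⟩ := Set.not_subset.mp this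
        exact ⟨h, h2, fun _ => h1⟩
    choose! h hh1 hh2 using this
    refine ⟨∏ q ∈ hfin.toFinset, h q, ?_, ?_⟩
    · intro hmem
      obtain ⟨q, hq, hq2⟩ := (hp.prod_mem_iff).mp hmem
      exact hh1 q (by simpa using hq) hq2
    · intro q hq hqp
      exact Ideal.mem_of_dvd _ (Finset.dvd_prod_of_mem _ (by simpa using hq)) (hh2 q hq hqp)
  obtain ⟨h, hhp, hh⟩ := hsep
  have hgh : g * h ∉ p := fun hm => (hp.mem_or_mem hm).elim hg hhp
  obtain ⟨M, hpM, hM, hgM⟩ : ∃ M : Ideal (MvPolynomial σ k), p ≤ M ∧ M.IsMaximal ∧ g * h ∉ M := by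
    have hj := (IsJacobsonRing.out (R := MvPolynomial σ k) inferInstance hp.isRadical)
    by_contra! hcon
    apply hgh
    rw [← hj, Ideal.jacobson, Ideal.mem_sInf]
    rintro I ⟨h1, h2⟩
    exact hcon I h1 h2
  have hgM' : g ∉ M := fun h' => hgM (Ideal.mul_mem_right _ _ h')
  have hhM : h ∉ M := fun h' => hgM (Ideal.mul_mem_left _ _ h')
  have hsM : (s : Set (MvPolynomial σ k)) ⊆ M := fun a ha => hpM (hs.1.2 (Ideal.subset_span ha))
  have key := Ideal.height_le_height_add_encard_of_subset (s : Set (MvPolynomial σ k)) hsM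
  rw [ht_max M hM] at key
  set π := Ideal.Quotient.mk (Ideal.span (s : Set (MvPolynomial σ k))) with hπ
  have hcomap : (M.map π).comap π = M := by
    rw [Ideal.comap_map_of_surjective π Ideal.Quotient.mk_surjective]
    refine sup_eq_left.mpr ?_
    intro a ha
    have : π a = 0 := by simpa using ha
    exact (Ideal.span_le.2 hsM) (Ideal.Quotient.eq_zero_iff_mem.mp this)
  have hMp : (M.map π).IsPrime := by
    apply Ideal.map_isPrime_of_surjective Ideal.Quotient.mk_surjective
    rw [Ideal.mk_ker]
    exact Ideal.span_le.2 hsM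
  have h2 : ((M.map π).height : WithBot ℕ∞) ≤ Order.krullDim
      {q : PrimeSpectrum (MvPolynomial σ k) // p ≤ q.asIdeal ∧ g ∉ q.asIdeal} := by
    rw [show (M.map π).height = Order.height (⟨M.map π, hMp⟩ : PrimeSpectrum _) from
      PrimeSpectrum.height_eq_orderHeight ⟨M.map π, hMp⟩, Order.height_eq_krullDim_Iic]
    have hle : ∀ q : Set.Iic (⟨M.map π, hMp⟩ : PrimeSpectrum (MvPolynomial σ k ⧸ _)),
        q.1.asIdeal.comap π ≤ M := by
      intro q
      exact (Ideal.comap_mono (show q.1.asIdeal ≤ M.map π from q.2)).trans hcomap.le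
    refine Order.krullDim_le_of_strictMono (fun q => ⟨PrimeSpectrum.comap π q.1, ?_, ?_⟩) ?_
    · have hsq : Ideal.span (s : Set (MvPolynomial σ k)) ≤ q.1.asIdeal.comap π := by
        intro a ha
        rw [Ideal.mem_comap, Ideal.Quotient.eq_zero_iff_mem.mpr ha]
        exact zero_mem _
      obtain ⟨q', hq', hq'le⟩ := Ideal.exists_minimalPrimes_le hsq
      by_cases hqp : q' = p
      · rw [← hqp]; exact hq'le
      · exact (hhM (hle q (hq'le (hh q' hq' hqp)))).elim
    · exact fun hgq => hgM' (hle q hgq)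
    · intro q q' hqq
      have : q.1.asIdeal < q'.1.asIdeal := hqq
      change q.1.asIdeal.comap π < q'.1.asIdeal.comap π
      refine lt_of_le_of_ne (Ideal.comap_mono this.le) fun heq => this.ne ?_
      exact Ideal.comap_injective_of_surjective π Ideal.Quotient.mk_surjective heq
  calc ((Nat.card σ : ℕ∞) : WithBot ℕ∞) ≤ (((M.map π).height + p.height : ℕ∞) : WithBot ℕ∞) := by
        refine WithBot.coe_le_coe.mpr (key.trans ?_)
        rw [← hcard, Set.encard_coe_eq_coe_finsetCard]
    _ = ((M.map π).height : WithBot ℕ∞) + p.height := by push_cast; rfl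
    _ ≤ _ := by gcongr

theorem dim_formula {k : Type*} [Field k] [IsAlgClosed k] {σ : Type*} [Finite σ]
    (p : Ideal (MvPolynomial σ k)) [hp : p.IsPrime] (h d : ℕ) (hh : p.height = h)
    (hd : h + d = Nat.card σ) :
    ringKrullDim (MvPolynomial σ k ⧸ p) = (d : WithBot ℕ∞) := by
  have hdim : ringKrullDim (MvPolynomial σ k) = Nat.card σ := by
    rw [MvPolynomial.ringKrullDim_of_isNoetherianRing, ringKrullDim_eq_zero_of_field, zero_add]
  have h1 := ht_core p 1 (fun h => hp.ne_top ((Ideal.eq_top_iff_one _).2 h))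
  have h2 : ringKrullDim (MvPolynomial σ k ⧸ p) =
      Order.coheight (⟨p, hp⟩ : PrimeSpectrum (MvPolynomial σ k)) := by
    rw [ringKrullDim_quotient, Order.coheight_eq_krullDim_Ici]
    rfl
  have h3 : Order.krullDim {q : PrimeSpectrum (MvPolynomial σ k) // p ≤ q.asIdeal ∧
      (1 : MvPolynomial σ k) ∉ q.asIdeal} ≤
      Order.coheight (⟨p, hp⟩ : PrimeSpectrum (MvPolynomial σ k)) := by
    rw [Order.coheight_eq_krullDim_Ici]
    exact Order.krullDim_le_of_strictMono (fun q => ⟨q.1, q.2.1⟩) (fun a b hab => hab)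
  have h4 : Order.height (⟨p, hp⟩ : PrimeSpectrum (MvPolynomial σ k)) +
      Order.coheight (⟨p, hp⟩ : PrimeSpectrum (MvPolynomial σ k)) ≤ Nat.card σ := by
    have : ((⨆ a : PrimeSpectrum (MvPolynomial σ k), Order.height a + Order.coheight a : ℕ∞) :
        WithBot ℕ∞) = ((Nat.card σ : ℕ∞) : WithBot ℕ∞) := by
      rw [← Order.krullDim_eq_iSup_height_add_coheight_of_nonempty]
      exact hdim
    rw [← WithBot.coe_inj.mp this]
    exact le_iSup (fun a : PrimeSpectrum (MvPolynomial σ k) =>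
      Order.height a + Order.coheight a) ⟨p, hp⟩
  rw [← PrimeSpectrum.height_eq_orderHeight] at h4
  rw [h2]
  replace h1 := h1.trans (add_le_add_left h3 _)
  change p.height + _ ≤ _ at h4
  rw [hh] at h1 h4
  generalize Order.coheight (⟨p, hp⟩ : PrimeSpectrum (MvPolynomial σ k)) = c at *
  have h1' : ((Nat.card σ : ℕ) : ℕ∞) ≤ c + h := by exact_mod_cast h1
  rw [← hd] at h1' h4
  have hc : c ≠ ⊤ := by
    rintro rfl
    simp at h4
  lift c to ℕ using hc
  norm_cast at *
  have : c = d := by omega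
  rw [this]

/-- Saturation of a subalgebra with respect to one of its elements. -/
def satA {k A : Type*} [CommRing k] [CommRing A] [Algebra k A] (S : Subalgebra k A) (g : A)
    (hg : g ∈ S) : Subalgebra k A where
  carrier := {v | ∃ N : ℕ, g ^ N * v ∈ S}
  mul_mem' := by
    rintro a b ⟨N, hN⟩ ⟨M, hM⟩
    refine ⟨N + M, ?_⟩
    have := S.mul_mem hN hM
    rwa [show g ^ (N + M) * (a * b) = g ^ N * a * (g ^ M * b) by ring]
  add_mem' := by
    rintro a b ⟨N, hN⟩ ⟨M, hM⟩
    refine ⟨N + M, ?_⟩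
    have h1 := S.mul_mem (S.pow_mem hg M) hN
    have h2 := S.mul_mem (S.pow_mem hg N) hM
    have := S.add_mem h1 h2
    rwa [show g ^ (N + M) * (a + b) = g ^ M * (g ^ N * a) + g ^ N * (g ^ M * b) by ring]
  algebraMap_mem' r := ⟨0, by simp⟩

theorem mem_satA {k A : Type*} [CommRing k] [CommRing A] [Algebra k A] {S : Subalgebra k A} {g : A}
    {hg : g ∈ S} {v : A} : v ∈ satA S g hg ↔ ∃ N : ℕ, g ^ N * v ∈ S := Iff.rfl

theorem le_satA {k A : Type*} [CommRing k] [CommRing A] [Algebra k A] {S : Subalgebra k A} {g : A}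
    {hg : g ∈ S} {v : A} (hv : v ∈ S) : v ∈ satA S g hg := ⟨0, by simpa using hv⟩

theorem satA_cancel {k A : Type*} [CommRing k] [CommRing A] [Algebra k A] {S : Subalgebra k A}
    {g : A} {hg : g ∈ S} {v : A} (n : ℕ) (hv : g ^ n * v ∈ satA S g hg) : v ∈ satA S g hg := by
  obtain ⟨N, hN⟩ := hv
  exact ⟨N + n, by rwa [pow_add, mul_assoc]⟩

/-- Elements whose square lies in the subalgebra, in characteristic two. -/
def rtA {k A : Type*} [CommRing k] [CommRing A] [Algebra k A] [CharP A 2] (S : Subalgebra k A) :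
    Subalgebra k A where
  carrier := {v | v ^ 2 ∈ S}
  mul_mem' := by
    intro a b ha hb
    change (a * b) ^ 2 ∈ S
    rw [mul_pow]
    exact S.mul_mem ha hb
  add_mem' := by
    intro a b ha hb
    change (a + b) ^ 2 ∈ S
    rw [CharTwo.add_sq]
    exact S.add_mem ha hb
  algebraMap_mem' r := S.pow_mem (S.algebraMap_mem r) 2

theorem mem_rtA {k A : Type*} [CommRing k] [CommRing A] [Algebra k A] [CharP A 2]
    {S : Subalgebra k A} {v : A} : v ∈ rtA S ↔ v ^ 2 ∈ S := Iff.rfl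

/-- `V` is generically algebraic (purely inseparable) over at most `d` elements. -/
def GenB (k : Type*) {A : Type*} [CommRing k] [CommRing A] [Algebra k A] (V : Set A) (d : ℕ) :
    Prop :=
  ∃ T : Finset A, T.card ≤ d ∧ ∃ (g : A) (hg : g ∈ Algebra.adjoin k (T : Set A)), g ≠ 0 ∧
    ∀ v ∈ V, v ^ 2 ∈ satA (Algebra.adjoin k (T : Set A)) g hg

theorem ht_ge {k : Type*} [Field k] [IsAlgClosed k] {σ : Type*} [Finite σ] [CharP k 2]
    (p : Ideal (MvPolynomial σ k)) [hp : p.IsPrime] (d : ℕ)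
    (hG : GenB k (Set.range fun i : σ => Ideal.Quotient.mk p (MvPolynomial.X i)) d) :
    ((Nat.card σ - d : ℕ) : ℕ∞) ≤ p.height := by
  obtain ⟨T, hT, g, hg, hg0, hV⟩ := hG
  have hchar : CharP (MvPolynomial σ k ⧸ p) 2 :=
    charP_of_injective_algebraMap (algebraMap k _).injective 2
  have hall : ∀ r : MvPolynomial σ k ⧸ p, r ^ 2 ∈ satA _ g hg := by
    intro r
    obtain ⟨r, rfl⟩ := Ideal.Quotient.mk_surjective r
    rw [← mem_rtA]
    induction r using MvPolynomial.induction_on with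
    | C a => exact Subalgebra.algebraMap_mem _ a
    | add a b ha hb => rw [map_add]; exact add_mem ha hb
    | mul_X a i ha => rw [map_mul]; exact mul_mem ha (hV _ ⟨i, rfl⟩)
  obtain ⟨G, rfl⟩ := Ideal.Quotient.mk_surjective g
  have hGp : G ∉ p := fun h => hg0 (Ideal.Quotient.eq_zero_iff_mem.mpr h)
  have h1 := ht_core p G hGp
  let ψ : MvPolynomial T k →ₐ[k] MvPolynomial σ k ⧸ p := MvPolynomial.aeval (fun t => (t : _))
  have hψ : ψ.range = Algebra.adjoin k (T : Set (MvPolynomial σ k ⧸ p)) := by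
    exact (Algebra.adjoin_eq_range k (T : Set (MvPolynomial σ k ⧸ p))).symm
  have hdim : ringKrullDim (MvPolynomial T k) = T.card := by
    rw [MvPolynomial.ringKrullDim_of_isNoetherianRing, ringKrullDim_eq_zero_of_field, zero_add]
    simp
  have hker : ∀ q : {q : PrimeSpectrum (MvPolynomial σ k) // p ≤ q.asIdeal ∧ G ∉ q.asIdeal},
      (q.1.asIdeal.map (Ideal.Quotient.mk p)).IsPrime := by
    intro q
    apply Ideal.map_isPrime_of_surjective Ideal.Quotient.mk_surjective
    rw [Ideal.mk_ker]
    exact q.2.1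
  have hmem : ∀ q : {q : PrimeSpectrum (MvPolynomial σ k) // p ≤ q.asIdeal ∧ G ∉ q.asIdeal},
      ∀ r, Ideal.Quotient.mk p r ∈ q.1.asIdeal.map (Ideal.Quotient.mk p) ↔ r ∈ q.1.asIdeal := by
    intro q r
    exact Ideal.mem_quotient_iff_mem q.2.1
  have h2 : Order.krullDim {q : PrimeSpectrum (MvPolynomial σ k) // p ≤ q.asIdeal ∧ G ∉ q.asIdeal}
      ≤ ringKrullDim (MvPolynomial T k) := by
    refine Order.krullDim_le_of_strictMono
      (fun q => PrimeSpectrum.comap ψ.toRingHom ⟨_, hker q⟩) ?_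
    intro q q' hqq
    have hlt : q.1.asIdeal < q'.1.asIdeal := hqq
    rw [← PrimeSpectrum.asIdeal_lt_asIdeal]
    rw [PrimeSpectrum.comap_asIdeal, PrimeSpectrum.comap_asIdeal]
    refine lt_of_le_not_ge (Ideal.comap_mono (Ideal.map_mono hlt.le)) ?_
    obtain ⟨r, hr', hr⟩ := Set.exists_of_ssubset hlt
    intro hle
    obtain ⟨N, hN⟩ := hall (Ideal.Quotient.mk p r)
    rw [← hψ] at hN
    obtain ⟨s, hs⟩ := hN
    have hs' : ψ s = Ideal.Quotient.mk p (G ^ N * r ^ 2) := by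
      rw [map_mul, map_pow, map_pow]; exact hs
    have h3 : s ∈ Ideal.comap ψ.toRingHom (q'.1.asIdeal.map (Ideal.Quotient.mk p)) := by
      change ψ s ∈ q'.1.asIdeal.map (Ideal.Quotient.mk p)
      rw [hs', hmem]
      exact Ideal.mul_mem_left _ _ (Ideal.pow_mem_of_mem _ hr' 2 (by norm_num))
    have h4 : ψ s ∈ q.1.asIdeal.map (Ideal.Quotient.mk p) := hle h3
    rw [hs', hmem] at h4
    rcases q.1.isPrime.mem_or_mem h4 with h5 | h5
    · exact q.2.2 (q.1.isPrime.mem_of_pow_mem _ h5)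
    · exact hr (q.1.isPrime.mem_of_pow_mem _ h5)
  rw [hdim] at h2
  have h3 := h1.trans (add_le_add_left h2 _)
  have h4 : ((Nat.card σ : ℕ) : ℕ∞) ≤ T.card + p.height := by exact_mod_cast h3
  have h5 : ((Nat.card σ : ℕ) : ℕ∞) ≤ d + p.height := h4.trans (by gcongr)
  push_cast
  exact tsub_le_iff_left.mpr h5

/-- Coefficient of the square of a series (characteristic two). -/
def SqC {A : Type*} [CommRing A] (x : ℕ → A) (j : ℕ) : A :=
  ∑ i ∈ Finset.range (j + 1), if 2 * i = j then x i ^ 2 else 0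

/-- Coefficient of `y^2 z` (characteristic two). -/
def CubC {A : Type*} [CommRing A] (y z : ℕ → A) (j : ℕ) : A :=
  ∑ i ∈ Finset.range (j + 1), if 2 * i ≤ j then y i ^ 2 * z (j - 2 * i) else 0

/-- Coefficient of `x^2 + y^2 z + z^2 y` (characteristic two). -/
def FF {A : Type*} [CommRing A] (x y z : ℕ → A) (j : ℕ) : A :=
  SqC x j + (CubC y z j + CubC z y j)

section FFsec

variable {A : Type*} [CommRing A]

theorem FF_symm (x y z : ℕ → A) (j : ℕ) : FF x z y j = FF x y z j := by
  unfold FF; ring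

theorem FF_shear [CharP A 2] (x y z : ℕ → A) (j : ℕ) :
    FF x y (fun i => y i + z i) j = FF x y z j := by
  unfold FF CubC
  rw [← Finset.sum_add_distrib, ← Finset.sum_add_distrib]
  congr 1
  refine Finset.sum_congr rfl fun i _ => ?_
  split_ifs
  · rw [CharTwo.add_sq]
    have := CharTwo.add_self_eq_zero (y i ^ 2 * y (j - 2 * i))
    linear_combination this
  · rfl

theorem SqC_shift (x : ℕ → A) (a : ℕ) (j : ℕ) :
    SqC x (j + 2 * a) = SqC (fun i => x (i + a)) j := by
  unfold SqC
  symm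
  rw [Finset.sum_ite, Finset.sum_const_zero, add_zero, Finset.sum_ite, Finset.sum_const_zero,
    add_zero]
  refine Finset.sum_bij (fun i _ => i + a) ?_ ?_ ?_ ?_
  · intro i hi
    simp only [Finset.mem_filter, Finset.mem_range] at hi ⊢
    omega
  · intro i _ i' _ h; omega
  · intro i hi
    simp only [Finset.mem_filter, Finset.mem_range] at hi
    exact ⟨i - a, by simp only [Finset.mem_filter, Finset.mem_range]; omega, by omega⟩
  · intro i _; rfl

theorem CubC_shift (y z : ℕ → A) (b : ℕ) (hy : ∀ i < b, y i = 0) (hz : ∀ i < b, z i = 0) (j : ℕ) :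
    CubC y z (j + 3 * b) = CubC (fun i => y (i + b)) (fun i => z (i + b)) j := by
  unfold CubC
  symm
  rw [Finset.sum_ite, Finset.sum_const_zero, add_zero, Finset.sum_ite, Finset.sum_const_zero,
    add_zero]
  refine Finset.sum_bij_ne_zero (fun i _ _ => i + b) ?_ ?_ ?_ ?_
  · intro i hi _
    simp only [Finset.mem_filter, Finset.mem_range] at hi ⊢
    omega
  · intro i _ _ i' _ _ h; omega
  · intro i hi hne
    simp only [Finset.mem_filter, Finset.mem_range] at hi
    have h1 : b ≤ i := by
      by_contra hlt
      apply hne; rw [hy i (by omega)]; ring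
    have h2 : b ≤ j + 3 * b - 2 * i := by
      by_contra hlt
      apply hne; rw [hz _ (by omega)]; ring
    refine ⟨i - b, by simp only [Finset.mem_filter, Finset.mem_range]; omega, ?_, by omega⟩
    have e1 : i - b + b = i := by omega
    have e2 : j - 2 * (i - b) + b = j + 3 * b - 2 * i := by omega
    simpa only [e1, e2] using hne
  · intro i hi _
    simp only [Finset.mem_filter, Finset.mem_range] at hi
    have e2 : j + 3 * b - 2 * (i + b) = j - 2 * i + b := by omega
    simp only [e2]

theorem FF_shift (x y z : ℕ → A) (hy : ∀ i < 2, y i = 0)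
    (hz : ∀ i < 2, z i = 0) (j : ℕ) :
    FF x y z (j + 6) = FF (fun i => x (i + 3)) (fun i => y (i + 2)) (fun i => z (i + 2)) j := by
  unfold FF
  rw [← SqC_shift x 3, ← CubC_shift y z 2 hy hz, ← CubC_shift z y 2 hz hy]

/-- Truncation of a sequence. -/
def trunc (j : ℕ) (y : ℕ → A) : ℕ → A := fun i => if i < j then y i else 0

theorem FF_lead (x y z : ℕ → A) (b j : ℕ) (hz : ∀ i < b, z i = 0) (hbj : b < j) :
    FF x y z (j + 2 * b) = z b ^ 2 * y j + FF x (trunc j y) z (j + 2 * b) := by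
  have h1 : CubC y z (j + 2 * b) = CubC (trunc j y) z (j + 2 * b) := by
    unfold CubC
    refine Finset.sum_congr rfl fun i _ => ?_
    split_ifs with h
    · by_cases hij : i < j
      · simp [trunc, hij]
      · rw [hz _ (by omega)]; ring
    · rfl
  have h2 : CubC z y (j + 2 * b) = z b ^ 2 * y j + CubC z (trunc j y) (j + 2 * b) := by
    unfold CubC
    have : z b ^ 2 * y j = ∑ i ∈ Finset.range (j + 2 * b + 1), if i = b then z b ^ 2 * y j else 0 := by
      rw [Finset.sum_ite_eq', if_pos (by simp; omega)]
    rw [this, ← Finset.sum_add_distrib]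
    refine Finset.sum_congr rfl fun i _ => ?_
    rcases lt_trichotomy i b with hib | hib | hib
    · rw [hz i hib]; simp [hib.ne]
    · subst hib
      rw [if_pos (by omega), if_pos rfl, if_pos (by omega), show j + 2 * i - 2 * i = j by omega]
      simp [trunc]
    · rw [if_neg hib.ne', zero_add]
      split_ifs with h
      · rw [trunc, if_pos (by omega)]
      · rfl
  unfold FF
  rw [h1, h2]; ring

theorem FF_mem {k : Type*} [CommRing k] [Algebra k A] (S : Subalgebra k A) (x y z : ℕ → A) (j : ℕ)
    (hx : ∀ i ≤ j, x i ^ 2 ∈ S) (hy : ∀ i ≤ j, y i ∈ S) (hz : ∀ i ≤ j, z i ∈ S) :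
    FF x y z j ∈ S := by
  unfold FF SqC CubC
  refine add_mem (sum_mem fun i hi => ?_) (add_mem (sum_mem fun i hi => ?_) (sum_mem fun i hi => ?_))
  all_goals
    have hi' : i ≤ j := by simp only [Finset.mem_range] at hi; omega
    split_ifs
  · exact hx i hi'
  · exact zero_mem _
  · exact mul_mem (pow_mem (hy i hi') 2) (hz _ (by omega))
  · exact zero_mem _
  · exact mul_mem (pow_mem (hz i hi') 2) (hy _ (by omega))
  · exact zero_mem _

theorem FF_map {B : Type*} [CommRing B] (φ : A →+* B) (x y z : ℕ → A) (j : ℕ) :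
    φ (FF x y z j) = FF (fun i => φ (x i)) (fun i => φ (y i)) (fun i => φ (z i)) j := by
  unfold FF SqC CubC
  simp only [map_add, map_sum, apply_ite φ, map_pow, map_mul, map_zero]

theorem FF_congr {x y z x' y' z' : ℕ → A} {j : ℕ} (hx : ∀ i ≤ j, x i = x' i)
    (hy : ∀ i ≤ j, y i = y' i) (hz : ∀ i ≤ j, z i = z' i) : FF x y z j = FF x' y' z' j := by
  unfold FF SqC CubC
  congr 1
  · refine Finset.sum_congr rfl fun i hi => ?_
    simp only [Finset.mem_range] at hi
    rw [hx i (by omega)]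
  · congr 1 <;>
    · refine Finset.sum_congr rfl fun i hi => ?_
      simp only [Finset.mem_range] at hi
      rw [hy _ (by omega), hz _ (by omega)]

/-- Solving for the `y`-coefficients. -/
theorem solve_y {k : Type*} [CommRing k] [Algebra k A] (S : Subalgebra k A) (x y z : ℕ → A)
    (n b : ℕ) (hg : z b ∈ S) (hx : ∀ i ≤ n, x i ^ 2 ∈ satA S (z b) hg)
    (hz : ∀ i ≤ n, z i ∈ satA S (z b) hg) (hz0 : ∀ i < b, z i = 0)
    (hylow : ∀ i ≤ b, y i ∈ satA S (z b) hg)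
    (hyhigh : ∀ i ≤ n, n < i + 2 * b → y i ∈ satA S (z b) hg)
    (heq : ∀ j, b < j → j + 2 * b ≤ n → FF x y z (j + 2 * b) = 0) :
    ∀ j ≤ n, y j ∈ satA S (z b) hg := by
  intro j
  induction j using Nat.strong_induction_on with
  | _ j ih =>
    intro hj
    by_cases h1 : j ≤ b
    · exact hylow j h1
    by_cases h2 : n < j + 2 * b
    · exact hyhigh j hj h2
    have h3 := heq j (by omega) (by omega)
    rw [FF_lead x y z b j hz0 (by omega)] at h3
    refine satA_cancel 2 ?_
    rw [eq_neg_of_add_eq_zero_left h3]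
    refine neg_mem (FF_mem _ _ _ _ _ (fun i hi => hx i (by omega)) (fun i hi => ?_)
      (fun i hi => hz i (by omega)))
    unfold trunc
    split_ifs with h
    · exact ih i h (by omega)
    · exact zero_mem _

end FFsec

section GenSec

variable (k : Type*) {A : Type*} [CommRing k] [CommRing A] [Algebra k A]

/-- The set of coefficients up to order `n`. -/
def VV (x y z : ℕ → A) (n : ℕ) : Set A := {v | ∃ i ≤ n, v = x i ∨ v = y i ∨ v = z i}

theorem VV_symm (x y z : ℕ → A) (n : ℕ) : VV x z y n = VV x y z n := by
  ext v; unfold VV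
  constructor <;>
  · rintro ⟨i, hi, h | h | h⟩ <;> exact ⟨i, hi, by simp [h]⟩

variable {k}

theorem GenB_mono {V V' : Set A} {d d' : ℕ} (h : GenB k V d) (hV : V' ⊆ V) (hd : d ≤ d') :
    GenB k V' d' := by
  obtain ⟨T, hT, g, hg, hg0, h⟩ := h
  exact ⟨T, hT.trans hd, g, hg, hg0, fun v hv => h v (hV hv)⟩

theorem satA_mono {S S' : Subalgebra k A} (hS : S ≤ S') {g : A} (hg : g ∈ S) {v : A}
    (hv : v ∈ satA S g hg) : v ∈ satA S' g (hS hg) := by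
  obtain ⟨N, hN⟩ := hv
  exact ⟨N, hS hN⟩

theorem GenB_extend {V V' : Set A} {d d' : ℕ} (h : GenB k V d) (W : Finset A)
    (hV : ∀ v ∈ V', v = 0 ∨ v ∈ V ∨ v ∈ W) (hd : d + W.card ≤ d') : GenB k V' d' := by
  classical
  obtain ⟨T, hT, g, hg, hg0, h⟩ := h
  have hle : Algebra.adjoin k (T : Set A) ≤ Algebra.adjoin k ((T ∪ W : Finset A) : Set A) :=
    Algebra.adjoin_mono (by simp)
  refine ⟨T ∪ W, (Finset.card_union_le _ _).trans (by omega), g, hle hg, hg0, fun v hv => ?_⟩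
  rcases hV v hv with rfl | h1 | h1
  · exact pow_mem (zero_mem _) 2
  · exact satA_mono hle hg (h v h1)
  · exact pow_mem (le_satA (Algebra.subset_adjoin (by simp [h1]))) 2

theorem GenB_empty [Nontrivial A] : GenB k (∅ : Set A) 0 :=
  ⟨∅, le_rfl, 1, one_mem _, one_ne_zero, by simp⟩

theorem GenB_solve (x y z : ℕ → A) (n b d : ℕ) (T : Finset A) (hT : T.card ≤ d) (hb : b ≤ n)
    (hzb : z b ≠ 0) (hx : ∀ i ≤ n, x i ^ 2 ∈ Algebra.adjoin k (T : Set A))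
    (hz : ∀ i ≤ n, z i ∈ Algebra.adjoin k (T : Set A)) (hz0 : ∀ i < b, z i = 0)
    (hylow : ∀ i ≤ b, y i ∈ Algebra.adjoin k (T : Set A))
    (hyhigh : ∀ i ≤ n, n < i + 2 * b → y i ∈ Algebra.adjoin k (T : Set A))
    (heq : ∀ j ≤ n, FF x y z j = 0) : GenB k (VV x y z n) d := by
  have hs := solve_y (Algebra.adjoin k (T : Set A)) x y z n b (hz b hb)
    (fun i hi => le_satA (hx i hi)) (fun i hi => le_satA (hz i hi)) hz0
    (fun i hi => le_satA (hylow i hi)) (fun i hi h => le_satA (hyhigh i hi h))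
    (fun j _ h => heq _ h)
  refine ⟨T, hT, z b, hz b hb, hzb, ?_⟩
  rintro v ⟨i, hi, rfl | rfl | rfl⟩
  · exact le_satA (hx i hi)
  · exact pow_mem (hs i hi) 2
  · exact pow_mem (le_satA (hz i hi)) 2

theorem GenB_shear [CharP A 2] (x y z : ℕ → A) (n d : ℕ)
    (h : GenB k (VV x y (fun i => y i + z i) n) d) : GenB k (VV x y z n) d := by
  obtain ⟨T, hT, g, hg, hg0, h⟩ := h
  refine ⟨T, hT, g, hg, hg0, ?_⟩
  rintro v ⟨i, hi, rfl | rfl | rfl⟩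
  · exact h _ ⟨i, hi, by simp⟩
  · exact h _ ⟨i, hi, by simp⟩
  · have h1 := h (y i) ⟨i, hi, by simp⟩
    have h2 := h (y i + z i) ⟨i, hi, by simp⟩
    have := add_mem h1 h2
    rwa [CharTwo.add_sq, ← add_assoc, CharTwo.add_self_eq_zero, zero_add] at this

theorem FF_zero (x y z : ℕ → A) : FF x y z 0 = x 0 ^ 2 + (y 0 ^ 2 * z 0 + z 0 ^ 2 * y 0) := by
  simp [FF, SqC, CubC]

theorem FF_two (x y z : ℕ → A) (hy : y 0 = 0) (hz : z 0 = 0) : FF x y z 2 = x 1 ^ 2 := by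
  simp [FF, SqC, CubC, Finset.sum_range_succ, hy, hz]

theorem FF_three (x y z : ℕ → A) (hy : y 0 = 0) (hz : z 0 = 0) :
    FF x y z 3 = y 1 ^ 2 * z 1 + z 1 ^ 2 * y 1 := by
  simp [FF, SqC, CubC, Finset.sum_range_succ, hy, hz]

theorem FF_four (x y z : ℕ → A) (hy : y 0 = 0) (hz : z 0 = 0) (hy1 : y 1 = 0) (hz1 : z 1 = 0) :
    FF x y z 4 = x 2 ^ 2 := by
  simp [FF, SqC, CubC, Finset.sum_range_succ, hy, hz, hy1, hz1]

theorem G2a (x y z : ℕ → A) (n : ℕ) (heq : ∀ j ≤ n, FF x y z j = 0) (hz : z 0 ≠ 0) :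
    GenB k (VV x y z n) (2 * n + 2) := by
  classical
  let T : Finset A := (Finset.Icc 1 n).image x ∪ ({y 0} ∪ (Finset.Icc 0 n).image z)
  have hcard : T.card ≤ 2 * n + 2 := by
    have h1 := Finset.card_image_le (s := Finset.Icc 1 n) (f := x)
    have h2 := Finset.card_image_le (s := Finset.Icc 0 n) (f := z)
    have h3 := Finset.card_union_le ((Finset.Icc 1 n).image x) ({y 0} ∪ (Finset.Icc 0 n).image z)
    have h4 := Finset.card_union_le {y 0} ((Finset.Icc 0 n).image z)
    simp only [Nat.card_Icc, Finset.card_singleton] at h1 h2 h3 h4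
    change Finset.card (_ ∪ _) ≤ _
    omega
  have hTx : ∀ i, 1 ≤ i → i ≤ n → x i ∈ Algebra.adjoin k (T : Set A) := fun i h1 h2 =>
    Algebra.subset_adjoin (by
      simp only [T, Finset.coe_union]
      exact Or.inl (by simpa using ⟨i, ⟨h1, h2⟩, rfl⟩))
  have hTz : ∀ i ≤ n, z i ∈ Algebra.adjoin k (T : Set A) := fun i h2 =>
    Algebra.subset_adjoin (by
      simp only [T, Finset.coe_union]
      exact Or.inr (Or.inr (by simpa using ⟨i, h2, rfl⟩)))
  have hTy : y 0 ∈ Algebra.adjoin k (T : Set A) := Algebra.subset_adjoin (by simp [T])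
  refine GenB_solve x y z n 0 _ T hcard (Nat.zero_le _) hz ?_ hTz (by simp) ?_ ?_ heq
  · intro i hi
    rcases Nat.eq_zero_or_pos i with rfl | h
    · have := heq 0 (Nat.zero_le _)
      rw [FF_zero] at this
      rw [eq_neg_of_add_eq_zero_left this]
      exact neg_mem (add_mem (mul_mem (pow_mem hTy 2) (hTz 0 (Nat.zero_le _)))
        (mul_mem (pow_mem (hTz 0 (Nat.zero_le _)) 2) hTy))
    · exact pow_mem (hTx i h hi) 2
  · intro i hi
    obtain rfl : i = 0 := by omega
    exact hTy
  · intro i hi h; omega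

theorem G1a (x y z : ℕ → A) (n : ℕ) (hn : 1 ≤ n) (heq : ∀ j ≤ n, FF x y z j = 0)
    (hx0 : x 0 = 0) (hx1 : x 1 = 0) (hy0 : y 0 = 0) (hy1 : y 1 = 0) (hz0 : z 0 = 0)
    (hz : z 1 ≠ 0) : GenB k (VV x y z n) (2 * n + 1) := by
  classical
  let T : Finset A := (Finset.Icc 2 n).image x ∪
    ((Finset.Icc (n - 1) n).image y ∪ (Finset.Icc 1 n).image z)
  have hcard : T.card ≤ 2 * n + 1 := by
    have h1 := Finset.card_image_le (s := Finset.Icc 2 n) (f := x)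
    have h2 := Finset.card_image_le (s := Finset.Icc 1 n) (f := z)
    have h5 := Finset.card_image_le (s := Finset.Icc (n - 1) n) (f := y)
    have h3 := Finset.card_union_le ((Finset.Icc 2 n).image x)
      ((Finset.Icc (n - 1) n).image y ∪ (Finset.Icc 1 n).image z)
    have h4 := Finset.card_union_le ((Finset.Icc (n - 1) n).image y) ((Finset.Icc 1 n).image z)
    simp only [Nat.card_Icc] at h1 h2 h3 h4 h5
    change Finset.card (_ ∪ _) ≤ _
    omega
  have hTx : ∀ i, 2 ≤ i → i ≤ n → x i ∈ Algebra.adjoin k (T : Set A) := fun i h1 h2 =>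
    Algebra.subset_adjoin (by
      simp only [T, Finset.coe_union]
      exact Or.inl (by simpa using ⟨i, ⟨h1, h2⟩, rfl⟩))
  have hTy : ∀ i, n - 1 ≤ i → i ≤ n → y i ∈ Algebra.adjoin k (T : Set A) := fun i h1 h2 =>
    Algebra.subset_adjoin (by
      simp only [T, Finset.coe_union]
      exact Or.inr (Or.inl (by simpa using ⟨i, ⟨by omega, h2⟩, rfl⟩)))
  have hTz : ∀ i, 1 ≤ i → i ≤ n → z i ∈ Algebra.adjoin k (T : Set A) := fun i h1 h2 =>
    Algebra.subset_adjoin (by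
      simp only [T, Finset.coe_union]
      exact Or.inr (Or.inr (by simpa using ⟨i, ⟨h1, h2⟩, rfl⟩)))
  refine GenB_solve x y z n 1 _ T hcard hn hz ?_ ?_ ?_ ?_ ?_ heq
  · intro i hi
    rcases lt_or_ge i 2 with h | h
    · have : x i = 0 := by interval_cases i <;> assumption
      rw [this]; exact pow_mem (zero_mem _) 2
    · exact pow_mem (hTx i h hi) 2
  · intro i hi
    rcases Nat.eq_zero_or_pos i with rfl | h
    · rw [hz0]; exact zero_mem _
    · exact hTz i h hi
  · intro i hi
    obtain rfl : i = 0 := by omega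
    exact hz0
  · intro i hi
    have : y i = 0 := by interval_cases i <;> assumption
    rw [this]; exact zero_mem _
  · intro i hi h; exact hTy i (by omega) hi

theorem G_shift (x y z : ℕ → A) (n d : ℕ) (hn : 6 ≤ n)
    (hx : ∀ i < 3, x i = 0) (hy : ∀ i < 2, y i = 0) (hz : ∀ i < 2, z i = 0)
    (h : GenB k (VV (fun i => x (i + 3)) (fun i => y (i + 2)) (fun i => z (i + 2)) (n - 6)) d) :
    GenB k (VV x y z n) (d + 11) := by
  classical
  have h1 := Finset.card_image_le (s := Finset.Icc (n - 2) n) (f := x)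
  have h2 := Finset.card_image_le (s := Finset.Icc (n - 3) n) (f := z)
  have h5 := Finset.card_image_le (s := Finset.Icc (n - 3) n) (f := y)
  have h3 := Finset.card_union_le ((Finset.Icc (n - 2) n).image x)
    ((Finset.Icc (n - 3) n).image y ∪ (Finset.Icc (n - 3) n).image z)
  have h4 := Finset.card_union_le ((Finset.Icc (n - 3) n).image y) ((Finset.Icc (n - 3) n).image z)
  simp only [Nat.card_Icc] at h1 h2 h3 h4 h5
  refine GenB_extend h ((Finset.Icc (n - 2) n).image x ∪
    ((Finset.Icc (n - 3) n).image y ∪ (Finset.Icc (n - 3) n).image z)) ?_ (by omega)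
  rintro v ⟨i, hi, rfl | rfl | rfl⟩
  · rcases lt_or_ge i 3 with h | h
    · exact Or.inl (hx i h)
    rcases lt_or_ge i (n - 2) with h' | h'
    · exact Or.inr (Or.inl ⟨i - 3, by omega, Or.inl (by congr 1; omega)⟩)
    · exact Or.inr (Or.inr (Finset.mem_union_left _
        (Finset.mem_image_of_mem _ (Finset.mem_Icc.2 ⟨h', hi⟩))))
  · rcases lt_or_ge i 2 with h | h
    · exact Or.inl (hy i h)
    rcases lt_or_ge i (n - 3) with h' | h'
    · exact Or.inr (Or.inl ⟨i - 2, by omega, Or.inr (Or.inl (by congr 1; omega))⟩)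
    · exact Or.inr (Or.inr (Finset.mem_union_right _ (Finset.mem_union_left _
        (Finset.mem_image_of_mem _ (Finset.mem_Icc.2 ⟨h', hi⟩)))))
  · rcases lt_or_ge i 2 with h | h
    · exact Or.inl (hz i h)
    rcases lt_or_ge i (n - 3) with h' | h'
    · exact Or.inr (Or.inl ⟨i - 2, by omega, Or.inr (Or.inr (by congr 1; omega))⟩)
    · exact Or.inr (Or.inr (Finset.mem_union_right _ (Finset.mem_union_right _
        (Finset.mem_image_of_mem _ (Finset.mem_Icc.2 ⟨h', hi⟩)))))

theorem G_free [Nontrivial A] (x y z : ℕ → A) (n a b d : ℕ)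
    (hx : ∀ i < a, x i = 0) (hy : ∀ i < b, y i = 0) (hz : ∀ i < b, z i = 0)
    (hd : (n + 1 - a) + 2 * (n + 1 - b) ≤ d) :
    GenB k (VV x y z n) d := by
  classical
  have h1 := Finset.card_image_le (s := Finset.Icc a n) (f := x)
  have h2 := Finset.card_image_le (s := Finset.Icc b n) (f := z)
  have h5 := Finset.card_image_le (s := Finset.Icc b n) (f := y)
  have h3 := Finset.card_union_le ((Finset.Icc a n).image x)
    ((Finset.Icc b n).image y ∪ (Finset.Icc b n).image z)
  have h4 := Finset.card_union_le ((Finset.Icc b n).image y) ((Finset.Icc b n).image z)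
  simp only [Nat.card_Icc] at h1 h2 h3 h4 h5
  refine GenB_extend GenB_empty ((Finset.Icc a n).image x ∪
    ((Finset.Icc b n).image y ∪ (Finset.Icc b n).image z)) ?_ (by omega)
  rintro v ⟨i, hi, rfl | rfl | rfl⟩
  · rcases lt_or_ge i a with h | h
    · exact Or.inl (hx i h)
    · exact Or.inr (Or.inr (Finset.mem_union_left _
        (Finset.mem_image_of_mem _ (Finset.mem_Icc.2 ⟨h, hi⟩))))
  · rcases lt_or_ge i b with h | h
    · exact Or.inl (hy i h)
    · exact Or.inr (Or.inr (Finset.mem_union_right _ (Finset.mem_union_left _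
        (Finset.mem_image_of_mem _ (Finset.mem_Icc.2 ⟨h, hi⟩)))))
  · rcases lt_or_ge i b with h | h
    · exact Or.inl (hz i h)
    · exact Or.inr (Or.inr (Finset.mem_union_right _ (Finset.mem_union_right _
        (Finset.mem_image_of_mem _ (Finset.mem_Icc.2 ⟨h, hi⟩)))))

variable [IsDomain A] [CharP A 2]

theorem G1_of (n : ℕ) (IH : ∀ n' < n, ∀ x y z : ℕ → A, (∀ j ≤ n', FF x y z j = 0) →
      GenB k (VV x y z n') (2 * n' + 2)) (x y z : ℕ → A)
    (heq : ∀ j ≤ n, FF x y z j = 0) (hx0 : x 0 = 0) (hy0 : y 0 = 0) (hz0 : z 0 = 0) :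
    GenB k (VV x y z n) (2 * n + 1) := by
  have e1 : ∀ {w : ℕ → A}, w 0 = 0 → ∀ i < 1, w i = 0 := fun h i hi => by
    obtain rfl : i = 0 := by omega
    exact h
  have e2 : ∀ {w : ℕ → A}, w 0 = 0 → w 1 = 0 → ∀ i < 2, w i = 0 := fun h h' i hi => by
    interval_cases i <;> assumption
  have e3 : ∀ {w : ℕ → A}, w 0 = 0 → w 1 = 0 → w 2 = 0 → ∀ i < 3, w i = 0 := fun h h' h'' i hi => by
    interval_cases i <;> assumption
  by_cases hn2 : n < 2
  · exact G_free x y z n 1 1 _ (e1 hx0) (e1 hy0) (e1 hz0) (by omega)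
  have hx1 : x 1 = 0 := by
    have := heq 2 (by omega)
    rw [FF_two x y z hy0 hz0] at this
    exact pow_eq_zero_iff (two_ne_zero) |>.mp this
  by_cases hn3 : n < 3
  · exact G_free x y z n 2 1 _ (e2 hx0 hx1) (e1 hy0) (e1 hz0) (by omega)
  have h3 := heq 3 (by omega)
  rw [FF_three x y z hy0 hz0, show y 1 ^ 2 * z 1 + z 1 ^ 2 * y 1 = y 1 * z 1 * (y 1 + z 1) by ring]
    at h3
  by_cases hy1 : y 1 = 0
  · by_cases hz1 : z 1 = 0
    · by_cases hn4 : n < 4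
      · exact G_free x y z n 2 2 _ (e2 hx0 hx1) (e2 hy0 hy1) (e2 hz0 hz1) (by omega)
      have hx2 : x 2 = 0 := by
        have := heq 4 (by omega)
        rw [FF_four x y z hy0 hz0 hy1 hz1] at this
        exact pow_eq_zero_iff (two_ne_zero) |>.mp this
      by_cases hn6 : n < 6
      · exact G_free x y z n 3 2 _ (e3 hx0 hx1 hx2) (e2 hy0 hy1) (e2 hz0 hz1) (by omega)
      refine GenB_mono (G_shift x y z n (2 * (n - 6) + 2) (by omega) (e3 hx0 hx1 hx2) (e2 hy0 hy1)
        (e2 hz0 hz1) (IH (n - 6) (by omega) _ _ _ ?_)) le_rfl (by omega)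
      intro j hj
      rw [← FF_shift x y z (e2 hy0 hy1) (e2 hz0 hz1)]
      exact heq _ (by omega)
    · exact G1a x y z n (by omega) heq hx0 hx1 hy0 hy1 hz0 hz1
  · by_cases hz1 : z 1 = 0
    · rw [← VV_symm]
      exact G1a x z y n (by omega) (fun j hj => by rw [FF_symm]; exact heq j hj)
        hx0 hx1 hz0 hz1 hy0 hy1
    · apply GenB_shear
      rw [← VV_symm]
      refine G1a x (fun i => y i + z i) y n (by omega)
        (fun j hj => by rw [FF_symm, FF_shear]; exact heq j hj)
        hx0 hx1 (by simp [hy0, hz0]) ?_ hy0 hy1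
      simpa [hy1, hz1] using h3

theorem G2 (n : ℕ) : ∀ x y z : ℕ → A, (∀ j ≤ n, FF x y z j = 0) →
      GenB k (VV x y z n) (2 * n + 2) := by
  induction n using Nat.strong_induction_on with
  | _ n ih =>
    intro x y z heq
    by_cases hz0 : z 0 = 0
    · by_cases hy0 : y 0 = 0
      · have := heq 0 (by omega)
        rw [FF_zero, hy0, hz0] at this
        have hx0 : x 0 = 0 := by simpa using this
        exact GenB_mono (G1_of n ih x y z heq hx0 hy0 hz0) le_rfl (by omega)
      · rw [← VV_symm]
        exact G2a x z y n (fun j hj => by rw [FF_symm]; exact heq j hj) hy0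
    · exact G2a x y z n heq hz0

theorem G1 (n : ℕ) (x y z : ℕ → A) (heq : ∀ j ≤ n, FF x y z j = 0) (hx0 : x 0 = 0) (hy0 : y 0 = 0)
    (hz0 : z 0 = 0) : GenB k (VV x y z n) (2 * n + 1) :=
  G1_of n (fun n' _ => G2 n') x y z heq hx0 hy0 hz0

theorem G0 (n : ℕ) (hn : 5 ≤ n) (x y z : ℕ → A) (heq : ∀ j ≤ n, FF x y z j = 0)
    (hx : ∀ i < 3, x i = 0) (hy : ∀ i < 3, y i = 0) (hz : ∀ i < 3, z i = 0) :
    GenB k (VV x y z n) (2 * n) := by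
  by_cases hn6 : n < 6
  · exact G_free x y z n 3 3 _ hx hy hz (by omega)
  have hy' : ∀ i < 2, y i = 0 := fun i hi => hy i (by omega)
  have hz' : ∀ i < 2, z i = 0 := fun i hi => hz i (by omega)
  have heq' : ∀ j ≤ n - 6,
      FF (fun i => x (i + 3)) (fun i => y (i + 2)) (fun i => z (i + 2)) j = 0 := by
    intro j hj
    rw [← FF_shift x y z hy' hz']
    exact heq _ (by omega)
  have hx3 : x 3 = 0 := by
    have := heq' 0 (by omega)
    rw [FF_zero] at this
    simpa [hy 2, hz 2] using this
  refine GenB_mono (G_shift x y z n (2 * (n - 6) + 1) (by omega) hx hy' hz'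
    (G1 (n - 6) _ _ _ heq' hx3 (hy 2 (by omega)) (hz 2 (by omega)))) le_rfl (by omega)

end GenSec

section SeqSec

open MvPolynomial

/-- The coordinate sequences in the jet ring. -/
noncomputable def sqn (k : Type*) [Field k] (m : ℕ) (c : Fin 3) (i : ℕ) :
    MvPolynomial (Fin 3 × Fin (m + 1)) k :=
  if h : i < m + 1 then X (c, ⟨i, h⟩) else 0

theorem jetSer_coeff (k : Type*) [Field k] (m : ℕ) (c : Fin 3) (i : ℕ) :
    (jetSer k m c).coeff i = sqn k m c i := by
  unfold jetSer sqn
  rw [Polynomial.finsetSum_coeff]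
  simp only [Polynomial.coeff_C_mul_X_pow]
  split_ifs with h
  · rw [Finset.sum_eq_single (⟨i, h⟩ : Fin (m + 1))]
    · simp
    · intro b _ hb
      rw [if_neg]
      rintro rfl
      exact hb rfl
    · simp
  · refine Finset.sum_eq_zero fun b _ => ?_
    rw [if_neg]
    have := b.2
    omega

theorem coeff_sq_two {A : Type*} [CommRing A] [CharP A 2] (P : Polynomial A) (j : ℕ) :
    (P ^ 2).coeff j = if 2 ∣ j then P.coeff (j / 2) ^ 2 else 0 := by
  have h := Polynomial.map_frobenius_expand (R := A) 2 (f := P)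
  rw [← h, Polynomial.map_expand, Polynomial.coeff_expand (by norm_num)]
  split_ifs
  · simp [frobenius_def]
  · rfl

theorem coeff_SqC {A : Type*} [CommRing A] [CharP A 2] (P : Polynomial A) (j : ℕ) :
    (P ^ 2).coeff j = SqC P.coeff j := by
  rw [coeff_sq_two, SqC]
  split_ifs with h
  · rw [Finset.sum_eq_single (j / 2)]
    · rw [if_pos (by omega)]
    · intro b _ hb
      rw [if_neg (by omega)]
    · intro hb
      simp at hb
      omega
  · symm
    refine Finset.sum_eq_zero fun b _ => ?_
    rw [if_neg (by omega)]

theorem coeff_CubC {A : Type*} [CommRing A] [CharP A 2] (P Q : Polynomial A) (j : ℕ) :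
    (P ^ 2 * Q).coeff j = CubC P.coeff Q.coeff j := by
  rw [Polynomial.coeff_mul, Finset.Nat.sum_antidiagonal_eq_sum_range_succ_mk, CubC]
  simp only [coeff_sq_two, ite_mul, zero_mul]
  rw [Finset.sum_ite, Finset.sum_const_zero, add_zero, Finset.sum_ite, Finset.sum_const_zero,
    add_zero]
  symm
  refine Finset.sum_bij (fun i _ => 2 * i) ?_ ?_ ?_ ?_
  · intro i hi
    simp only [Finset.mem_filter, Finset.mem_range] at hi ⊢
    omega
  · intro i _ i' _ h; omega
  · intro i hi
    simp only [Finset.mem_filter, Finset.mem_range] at hi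
    exact ⟨i / 2, by simp only [Finset.mem_filter, Finset.mem_range]; omega, by omega⟩
  · intro i _
    simp

theorem fC_eq (k : Type*) [Field k] [CharP k 2] (m j : ℕ) :
    fC k m j = FF (sqn k m 0) (sqn k m 1) (sqn k m 2) j := by
  unfold fC FF
  have hc : ∀ c, (jetSer k m c).coeff = sqn k m c := fun c => funext (jetSer_coeff k m c)
  rw [Polynomial.coeff_add, Polynomial.coeff_add, mul_comm (jetSer k m 1), coeff_SqC, coeff_CubC,
    coeff_CubC, hc, hc, hc, add_assoc]

end SeqSec

section LeastSec

open MvPolynomial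

theorem E_abs {k : Type*} [Field k] [CharP k 2] {σ : Type*} {K : Type*} [Field K] [Algebra k K]
    (J : Ideal (MvPolynomial σ k)) (g : MvPolynomial σ k) (τ : Set σ)
    (hg : Ideal.Quotient.mk J g ∈
      Algebra.adjoin k ((fun v => Ideal.Quotient.mk J (X v)) '' τ))
    (hsq : ∀ v, (Ideal.Quotient.mk J (X v)) ^ 2 ∈
      satA (Algebra.adjoin k ((fun v => Ideal.Quotient.mk J (X v)) '' τ)) _ hg)
    (φ ι : MvPolynomial σ k →ₐ[k] K) (hι : Function.Injective ι)
    (hφ : ∀ v ∈ τ, φ (X v) = ι (X v)) (hJ : ∀ r ∈ J, φ r = 0)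
    (p : Ideal (MvPolynomial σ k)) (hp : p.IsPrime) (hJp : J ≤ p) (hgp : g ∉ p) :
    RingHom.ker φ ≤ p := by
  have hnt : Nontrivial (MvPolynomial σ k ⧸ J) := by
    refine Ideal.Quotient.nontrivial_iff.mpr ?_
    rintro rfl
    exact hgp (hJp trivial)
  have hchar : CharP (MvPolynomial σ k ⧸ J) 2 :=
    charP_of_injective_algebraMap (algebraMap k _).injective 2
  have hall : ∀ r : MvPolynomial σ k ⧸ J, r ^ 2 ∈ satA _ _ hg := by
    intro r
    obtain ⟨r, rfl⟩ := Ideal.Quotient.mk_surjective r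
    rw [← mem_rtA]
    induction r using MvPolynomial.induction_on with
    | C a => exact Subalgebra.algebraMap_mem _ a
    | add a b ha hb => rw [map_add]; exact add_mem ha hb
    | mul_X a i ha => rw [map_mul]; exact mul_mem ha (hsq i)
  intro r hr
  obtain ⟨N, hN⟩ := hall (Ideal.Quotient.mk J r)
  have himg : Algebra.adjoin k ((fun v => Ideal.Quotient.mk J (X v)) '' τ) =
      (Algebra.adjoin k ((X : σ → MvPolynomial σ k) '' τ)).map (Ideal.Quotient.mkₐ k J) := by
    rw [AlgHom.map_adjoin, Set.image_image]
    rfl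
  rw [himg] at hN
  obtain ⟨s, hs, hsN⟩ := hN
  have hs1 : s - g ^ N * r ^ 2 ∈ J := by
    rw [← Ideal.Quotient.eq]
    rw [map_mul, map_pow, map_pow]
    exact hsN
  have hφr : φ r = 0 := hr
  have h1 : φ s = 0 := by
    have := hJ _ hs1
    rw [map_sub, map_mul, map_pow φ r, hφr] at this
    simpa using this
  have h2 : φ s = ι s := by
    have : Algebra.adjoin k ((X : σ → MvPolynomial σ k) '' τ) ≤ AlgHom.equalizer φ ι := by
      rw [Algebra.adjoin_le_iff]
      rintro _ ⟨v, hv, rfl⟩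
      exact hφ v hv
    exact this hs
  have h3 : s = 0 := hι (by rw [← h2, h1, map_zero])
  rw [h3, zero_sub, neg_mem_iff] at hs1
  rcases hp.mem_or_mem (hJp hs1) with h | h
  · exact absurd (hp.mem_of_pow_mem _ h) hgp
  · exact hp.mem_of_pow_mem _ h

theorem exists_y {K : Type*} [Field K] (x z c : ℕ → K) (n b : ℕ) (hz0 : ∀ i < b, z i = 0)
    (hzb : z b ≠ 0) : ∃ y : ℕ → K, (∀ i, ¬ (b < i ∧ i + 2 * b ≤ n) → y i = c i) ∧
      ∀ j, b < j → j + 2 * b ≤ n → FF x y z (j + 2 * b) = 0 := by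
  have key : ∀ N, ∃ y : ℕ → K, (∀ i, ¬ (b < i ∧ i + 2 * b ≤ n) → y i = c i) ∧
      ∀ j < N, b < j → j + 2 * b ≤ n → FF x y z (j + 2 * b) = 0 := by
    intro N
    induction N with
    | zero => exact ⟨c, fun _ _ => rfl, fun j hj => absurd hj (Nat.not_lt_zero _)⟩
    | succ N ih =>
      obtain ⟨y, hy1, hy2⟩ := ih
      by_cases hN : b < N ∧ N + 2 * b ≤ n
      · refine ⟨fun i => if i = N then -(FF x (trunc N y) z (N + 2 * b)) / z b ^ 2 else y i,
          ?_, ?_⟩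
        · intro i hi
          have : i ≠ N := by rintro rfl; exact hi hN
          simp only [if_neg this]
          exact hy1 i hi
        · intro j hj hbj hjn
          rw [FF_lead x _ z b j hz0 hbj]
          have htr : ∀ v, trunc j (fun i => if i = N then v else y i) = trunc j y := by
            intro v
            funext i
            unfold trunc
            by_cases hij : i < j
            · have : i ≠ N := by omega
              simp only [if_pos hij, if_neg this]
            · simp only [if_neg hij]
          rw [htr]
          rcases Nat.lt_succ_iff_lt_or_eq.mp hj with h | h
          · have := hy2 j h hbj hjn
            rw [FF_lead x _ z b j hz0 hbj] at this
            simp only [if_neg h.ne]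
            exact this
          · subst h
            simp only [if_pos]
            field_simp
            ring
      · refine ⟨y, hy1, ?_⟩
        intro j hj hbj hjn
        rcases Nat.lt_succ_iff_lt_or_eq.mp hj with h | h
        · exact hy2 j h hbj hjn
        · subst h
          exact absurd ⟨hbj, hjn⟩ hN
  obtain ⟨y, h1, h2⟩ := key (n + 1)
  exact ⟨y, h1, fun j hb hj => h2 j (by omega) hb hj⟩

theorem FF_one {A : Type*} [CommRing A] (x y z : ℕ → A) (hy : y 0 = 0) (hz : z 0 = 0) :
    FF x y z 1 = 0 := by
  simp [FF, SqC, CubC, Finset.sum_range_succ, hy, hz]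

theorem FF_five {A : Type*} [CommRing A] (x y z : ℕ → A) (hy : y 0 = 0) (hz : z 0 = 0)
    (hy1 : y 1 = 0) (hz1 : z 1 = 0) : FF x y z 5 = 0 := by
  simp [FF, SqC, CubC, Finset.sum_range_succ, hy, hz, hy1, hz1]

theorem FF_six {A : Type*} [CommRing A] (x y z : ℕ → A) (hy : y 0 = 0) (hz : z 0 = 0)
    (hy1 : y 1 = 0) (hz1 : z 1 = 0) :
    FF x y z 6 = x 3 ^ 2 + (y 2 ^ 2 * z 2 + z 2 ^ 2 * y 2) := by
  simp [FF, SqC, CubC, Finset.sum_range_succ, hy, hz, hy1, hz1]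

end LeastSec

section ConcreteSec

open MvPolynomial

variable (k : Type*) [Field k] (m : ℕ)

/-- The ideal of the singular fibre. -/
noncomputable def IZ : Ideal (MvPolynomial (Fin 3 × Fin (m + 1)) k) :=
  Ideal.span {sqn k m 0 0, sqn k m 1 0, sqn k m 2 0} ⊔
    Ideal.span {p | ∃ j ≤ m, p = FF (sqn k m 0) (sqn k m 1) (sqn k m 2) j}

variable {k m}

theorem IZ_le_iff (p : Ideal (MvPolynomial (Fin 3 × Fin (m + 1)) k)) :
    IZ k m ≤ p ↔ (∀ c, sqn k m c 0 ∈ p) ∧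
      ∀ j ≤ m, FF (sqn k m 0) (sqn k m 1) (sqn k m 2) j ∈ p := by
  unfold IZ
  rw [sup_le_iff, Ideal.span_le, Ideal.span_le]
  constructor
  · rintro ⟨h1, h2⟩
    refine ⟨?_, fun j hj => h2 ⟨j, hj, rfl⟩⟩
    intro c
    fin_cases c
    · exact h1 (by simp)
    · exact h1 (by simp)
    · exact h1 (by simp)
  · rintro ⟨h1, h2⟩
    constructor
    · rintro _ (rfl | rfl | rfl)
      · exact h1 0
      · exact h1 1
      · exact h1 2
    · rintro _ ⟨j, hj, rfl⟩
      exact h2 j hj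

theorem mk_FF (J : Ideal (MvPolynomial (Fin 3 × Fin (m + 1)) k)) (j : ℕ) :
    FF (fun i => Ideal.Quotient.mk J (sqn k m 0 i)) (fun i => Ideal.Quotient.mk J (sqn k m 1 i))
      (fun i => Ideal.Quotient.mk J (sqn k m 2 i)) j =
    Ideal.Quotient.mk J (FF (sqn k m 0) (sqn k m 1) (sqn k m 2) j) :=
  (FF_map (Ideal.Quotient.mk J) _ _ _ j).symm

theorem range_VV (J : Ideal (MvPolynomial (Fin 3 × Fin (m + 1)) k)) :
    (Set.range fun i : Fin 3 × Fin (m + 1) => Ideal.Quotient.mk J (X i)) ⊆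
    VV (fun i => Ideal.Quotient.mk J (sqn k m 0 i)) (fun i => Ideal.Quotient.mk J (sqn k m 1 i))
      (fun i => Ideal.Quotient.mk J (sqn k m 2 i)) m := by
  rintro _ ⟨⟨c, i⟩, rfl⟩
  have h : ∀ c, sqn k m c i = X (c, i) := by
    intro c
    unfold sqn
    rw [dif_pos i.2]
  refine ⟨i, by have := i.2; omega, ?_⟩
  simp only [h]
  fin_cases c <;> simp

variable [CharP k 2] 

theorem mem_x1 (hm : 5 ≤ m) (p : Ideal (MvPolynomial (Fin 3 × Fin (m + 1)) k)) (hp : p.IsPrime)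
    (hI : IZ k m ≤ p) : sqn k m 0 1 ∈ p := by
  rw [IZ_le_iff] at hI
  have h := hI.2 2 (by omega)
  rw [← Ideal.Quotient.eq_zero_iff_mem, ← mk_FF,
    FF_two _ _ _ (Ideal.Quotient.eq_zero_iff_mem.mpr (hI.1 1))
      (Ideal.Quotient.eq_zero_iff_mem.mpr (hI.1 2)), ← map_pow,
    Ideal.Quotient.eq_zero_iff_mem] at h
  exact hp.mem_of_pow_mem _ h

theorem mem_cases (hm : 5 ≤ m) (p : Ideal (MvPolynomial (Fin 3 × Fin (m + 1)) k)) (hp : p.IsPrime)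
    (hI : IZ k m ≤ p) : sqn k m 1 1 ∈ p ∨ sqn k m 2 1 ∈ p ∨ sqn k m 1 1 + sqn k m 2 1 ∈ p := by
  rw [IZ_le_iff] at hI
  have h := hI.2 3 (by omega)
  rw [← Ideal.Quotient.eq_zero_iff_mem, ← mk_FF,
    FF_three _ _ _ (Ideal.Quotient.eq_zero_iff_mem.mpr (hI.1 1))
      (Ideal.Quotient.eq_zero_iff_mem.mpr (hI.1 2)), ← map_pow, ← map_pow, ← map_mul, ← map_mul,
    ← map_add, Ideal.Quotient.eq_zero_iff_mem] at h
  have e : sqn k m 1 1 ^ 2 * sqn k m 2 1 + sqn k m 2 1 ^ 2 * sqn k m 1 1 =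
    sqn k m 1 1 * (sqn k m 2 1 * (sqn k m 1 1 + sqn k m 2 1)) := by ring
  rw [e] at h
  rcases hp.mem_or_mem h with h | h
  · exact Or.inl h
  · exact Or.inr (hp.mem_or_mem h)

theorem mem_x2 (hm : 5 ≤ m) (p : Ideal (MvPolynomial (Fin 3 × Fin (m + 1)) k)) (hp : p.IsPrime)
    (hI : IZ k m ≤ p) (hy : sqn k m 1 1 ∈ p) (hz : sqn k m 2 1 ∈ p) : sqn k m 0 2 ∈ p := by
  rw [IZ_le_iff] at hI
  have h := hI.2 4 (by omega)
  rw [← Ideal.Quotient.eq_zero_iff_mem, ← mk_FF,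
    FF_four _ _ _ (Ideal.Quotient.eq_zero_iff_mem.mpr (hI.1 1))
      (Ideal.Quotient.eq_zero_iff_mem.mpr (hI.1 2)) (Ideal.Quotient.eq_zero_iff_mem.mpr hy)
      (Ideal.Quotient.eq_zero_iff_mem.mpr hz), ← map_pow,
    Ideal.Quotient.eq_zero_iff_mem] at h
  exact hp.mem_of_pow_mem _ h

theorem ht_lb [IsAlgClosed k] (hm : 5 ≤ m) (p : Ideal (MvPolynomial (Fin 3 × Fin (m + 1)) k))
    (hp : p.IsPrime) (hI : IZ k m ≤ p) : ((m + 2 : ℕ) : ℕ∞) ≤ p.height := by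
  rw [IZ_le_iff] at hI
  have hchar : CharP (MvPolynomial (Fin 3 × Fin (m + 1)) k ⧸ p) 2 :=
    charP_of_injective_algebraMap (algebraMap k _).injective 2
  have h := G1 (k := k) m (fun i => Ideal.Quotient.mk p (sqn k m 0 i))
    (fun i => Ideal.Quotient.mk p (sqn k m 1 i)) (fun i => Ideal.Quotient.mk p (sqn k m 2 i))
    (fun j hj => by
      rw [mk_FF]; exact Ideal.Quotient.eq_zero_iff_mem.mpr (hI.2 j hj))
    (Ideal.Quotient.eq_zero_iff_mem.mpr (hI.1 0)) (Ideal.Quotient.eq_zero_iff_mem.mpr (hI.1 1))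
    (Ideal.Quotient.eq_zero_iff_mem.mpr (hI.1 2))
  have h2 := ht_ge p _ (GenB_mono h (range_VV p) le_rfl)
  rw [Nat.card_prod, Nat.card_fin, Nat.card_fin,
    show 3 * (m + 1) - (2 * m + 1) = m + 2 by omega] at h2
  exact h2

theorem ht_lb' [IsAlgClosed k] (hm : 5 ≤ m) (p : Ideal (MvPolynomial (Fin 3 × Fin (m + 1)) k))
    (hp : p.IsPrime) (hI : IZ k m ≤ p) (h1 : ∀ c, sqn k m c 1 ∈ p) (h2 : ∀ c, sqn k m c 2 ∈ p) :
    ((m + 3 : ℕ) : ℕ∞) ≤ p.height := by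
  rw [IZ_le_iff] at hI
  have hchar : CharP (MvPolynomial (Fin 3 × Fin (m + 1)) k ⧸ p) 2 :=
    charP_of_injective_algebraMap (algebraMap k _).injective 2
  have h3 : ∀ c, ∀ i < 3, Ideal.Quotient.mk p (sqn k m c i) = 0 := by
    intro c i hi
    rw [Ideal.Quotient.eq_zero_iff_mem]
    interval_cases i
    · exact hI.1 c
    · exact h1 c
    · exact h2 c
  have h := G0 (k := k) m hm (fun i => Ideal.Quotient.mk p (sqn k m 0 i))
    (fun i => Ideal.Quotient.mk p (sqn k m 1 i)) (fun i => Ideal.Quotient.mk p (sqn k m 2 i))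
    (fun j hj => by
      rw [mk_FF]; exact Ideal.Quotient.eq_zero_iff_mem.mpr (hI.2 j hj))
    (h3 0) (h3 1) (h3 2)
  have h2 := ht_ge p _ (GenB_mono h (range_VV p) le_rfl)
  rw [Nat.card_prod, Nat.card_fin, Nat.card_fin,
    show 3 * (m + 1) - (2 * m) = m + 3 by omega] at h2
  exact h2

theorem least_gen {K : Type*} [Field K] [Algebra k K]
    (J : Ideal (MvPolynomial (Fin 3 × Fin (m + 1)) k)) (t : Fin 3 → ℕ → Prop) (b : ℕ)
    (hb : b ≤ m) (ht : t 2 b)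
    (hF : ∀ j ≤ m, FF (sqn k m 0) (sqn k m 1) (sqn k m 2) j ∈ J)
    (hx : ∀ i ≤ m, ¬ t 0 i → sqn k m 0 i ∈ J ∨ ∃ q ∈ Algebra.adjoin k
      {r | ∃ c, ∃ i ≤ m, t c i ∧ r = sqn k m c i}, sqn k m 0 i ^ 2 - q ∈ J)
    (hz : ∀ i ≤ m, ¬ t 2 i → sqn k m 2 i ∈ J) (hz0 : ∀ i < b, sqn k m 2 i ∈ J)
    (hylow : ∀ i ≤ b, ¬ t 1 i → sqn k m 1 i ∈ J)
    (hyhigh : ∀ i ≤ m, m < i + 2 * b → ¬ t 1 i → sqn k m 1 i ∈ J)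
    (φ ι : MvPolynomial (Fin 3 × Fin (m + 1)) k →ₐ[k] K) (hι : Function.Injective ι)
    (hφ : ∀ c, ∀ i ≤ m, t c i → φ (sqn k m c i) = ι (sqn k m c i)) (hJ : ∀ r ∈ J, φ r = 0)
    (p : Ideal (MvPolynomial (Fin 3 × Fin (m + 1)) k)) (hp : p.IsPrime) (hJp : J ≤ p)
    (hgp : sqn k m 2 b ∉ p) : RingHom.ker φ ≤ p := by
  have hX : ∀ v : Fin 3 × Fin (m + 1), X v = sqn k m v.1 v.2 := by
    intro v
    unfold sqn
    rw [dif_pos v.2.2]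
  let τ : Set (Fin 3 × Fin (m + 1)) := {v | t v.1 v.2}
  let S := Algebra.adjoin k ((fun v => Ideal.Quotient.mk J (X v)) '' τ)
  have hS : ∀ c, ∀ i ≤ m, t c i → Ideal.Quotient.mk J (sqn k m c i) ∈ S := by
    intro c i hi h
    refine Algebra.subset_adjoin ⟨(c, ⟨i, by omega⟩), h, ?_⟩
    simp only [hX]
  have hJ0 : ∀ r ∈ J, Ideal.Quotient.mk J r = 0 := fun r hr => Ideal.Quotient.eq_zero_iff_mem.mpr hr
  have hg := hS 2 b hb ht
  have hxS : ∀ i ≤ m, Ideal.Quotient.mk J (sqn k m 0 i) ^ 2 ∈ S := by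
    intro i hi
    by_cases h : t 0 i
    · exact pow_mem (hS 0 i hi h) 2
    · rcases hx i hi h with h | ⟨q, hq, h⟩
      · rw [hJ0 _ h]; exact pow_mem (zero_mem _) 2
      · rw [← map_pow, Ideal.Quotient.eq.mpr h]
        have h1 : Algebra.adjoin k {r | ∃ c, ∃ i ≤ m, t c i ∧ r = sqn k m c i} ≤
            S.comap (Ideal.Quotient.mkₐ k J) := by
          rw [Algebra.adjoin_le_iff]
          rintro _ ⟨c, i, hi, hc, rfl⟩
          exact hS c i hi hc
        exact h1 hq
  have hzS : ∀ i ≤ m, Ideal.Quotient.mk J (sqn k m 2 i) ∈ S := by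
    intro i hi
    by_cases h : t 2 i
    · exact hS 2 i hi h
    · rw [hJ0 _ (hz i hi h)]; exact zero_mem _
  have hy := solve_y S (fun i => Ideal.Quotient.mk J (sqn k m 0 i))
    (fun i => Ideal.Quotient.mk J (sqn k m 1 i)) (fun i => Ideal.Quotient.mk J (sqn k m 2 i))
    m b hg (fun i hi => le_satA (hxS i hi)) (fun i hi => le_satA (hzS i hi))
    (fun i hi => hJ0 _ (hz0 i hi))
    (fun i hi => by
      refine le_satA ?_
      by_cases h : t 1 i
      · exact hS 1 i (by omega) h
      · rw [hJ0 _ (hylow i hi h)]; exact zero_mem _)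
    (fun i hi hi2 => by
      refine le_satA ?_
      by_cases h : t 1 i
      · exact hS 1 i (by omega) h
      · rw [hJ0 _ (hyhigh i hi hi2 h)]; exact zero_mem _)
    (fun j _ hj => by rw [mk_FF, hJ0 _ (hF _ hj)])
  refine E_abs J (sqn k m 2 b) τ hg ?_ φ ι hι ?_ hJ p hp hJp hgp
  · rintro ⟨c, i⟩
    have hi : (i : ℕ) ≤ m := by have := i.2; omega
    rw [hX]
    fin_cases c
    · exact le_satA (hxS i hi)
    · exact pow_mem (hy i hi) 2
    · exact le_satA (pow_mem (hzS i hi) 2)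
  · intro v hv
    rw [hX]
    exact hφ _ _ (by have := v.2.2; omega) hv

/-- The homomorphism given by three sequences. -/
noncomputable def phi {K : Type*} [Field K] [Algebra k K] (s : Fin 3 → ℕ → K) :
    MvPolynomial (Fin 3 × Fin (m + 1)) k →ₐ[k] K := aeval fun v => s v.1 v.2

theorem phi_sqn {K : Type*} [Field K] [Algebra k K] (s : Fin 3 → ℕ → K) (c : Fin 3) (i : ℕ)
    (hi : i ≤ m) : phi s (sqn k m c i) = s c i := by
  unfold phi sqn
  rw [dif_pos (by omega), aeval_X]

theorem phi_FF {K : Type*} [Field K] [Algebra k K] (s : Fin 3 → ℕ → K) (j : ℕ)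
    (hj : j ≤ m) : phi s (FF (sqn k m 0) (sqn k m 1) (sqn k m 2) j) = FF (s 0) (s 1) (s 2) j := by
  have := FF_map (phi s : MvPolynomial (Fin 3 × Fin (m + 1)) k →ₐ[k] K).toRingHom
    (sqn k m 0) (sqn k m 1) (sqn k m 2) j
  refine this.trans ?_
  exact FF_congr (fun i hi => phi_sqn s 0 i (by omega)) (fun i hi => phi_sqn s 1 i (by omega))
    (fun i hi => phi_sqn s 2 i (by omega))

end ConcreteSec

section ExistSec

open MvPolynomial

variable {k : Type*} [Field k] [CharP k 2] {m : ℕ}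

theorem exists_big.{u, v} {k : Type u} [Field k] (σ : Type v) : ∃ (K : Type (max u v)) (_ : Field K) (_ : Algebra k K)
    (ι : MvPolynomial σ k →ₐ[k] K), IsAlgClosed K ∧ Function.Injective ι := by
  refine ⟨AlgebraicClosure (FractionRing (MvPolynomial σ k)), inferInstance, inferInstance,
    IsScalarTower.toAlgHom k _ _, inferInstance, ?_⟩
  have h : Function.Injective (algebraMap (MvPolynomial σ k)
      (AlgebraicClosure (FractionRing (MvPolynomial σ k)))) := by
    rw [IsScalarTower.algebraMap_eq (MvPolynomial σ k) (FractionRing (MvPolynomial σ k))]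
    exact (algebraMap (FractionRing (MvPolynomial σ k)) _).injective.comp
      (IsFractionRing.injective _ _)
  exact h

theorem sqn_ne (c : Fin 3) (i : ℕ) (hi : i ≤ m) : sqn k m c i ≠ 0 := by
  unfold sqn
  rw [dif_pos (by omega)]
  exact X_ne_zero _

theorem P1_exists (hm : 5 ≤ m) : ∃ P : Ideal (MvPolynomial (Fin 3 × Fin (m + 1)) k), P.IsPrime ∧
    IZ k m ≤ P ∧ sqn k m 1 1 ∈ P ∧ sqn k m 2 1 ∉ P ∧
    ∀ p : Ideal (MvPolynomial (Fin 3 × Fin (m + 1)) k), p.IsPrime → IZ k m ≤ p →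
      sqn k m 1 1 ∈ p → sqn k m 2 1 ∉ p → P ≤ p := by
  obtain ⟨K, _, _, ι, _, hι⟩ := exists_big (k := k) (Fin 3 × Fin (m + 1))
  have hne : ∀ c, ∀ i ≤ m, ι (sqn k m c i) ≠ 0 := fun c i hi h =>
    sqn_ne c i hi (hι (by rw [h, map_zero]))
  let x : ℕ → K := fun i => if 2 ≤ i then ι (sqn k m 0 i) else 0
  let z : ℕ → K := fun i => if 1 ≤ i then ι (sqn k m 2 i) else 0
  let c : ℕ → K := fun i => if m < i + 2 then ι (sqn k m 1 i) else 0
  obtain ⟨y, hy1, hy2⟩ := exists_y x z c m 1 (fun i hi => by simp [z]; omega)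
    (by simpa [z] using hne 2 1 (by omega))
  have hx0 : x 0 = 0 := by simp [x]
  have hx1 : x 1 = 0 := by simp [x]
  have hz0 : z 0 = 0 := by simp [z]
  have hz1 : z 1 = ι (sqn k m 2 1) := by simp [z]
  have hy0 : y 0 = 0 := by rw [hy1 0 (by omega)]; simp only [c]; rw [if_neg (by omega)]
  have hy1' : y 1 = 0 := by rw [hy1 1 (by omega)]; simp only [c]; rw [if_neg (by omega)]
  let s : Fin 3 → ℕ → K := ![x, y, z]
  have hFF : ∀ j ≤ m, FF x y z j = 0 := by
    intro j hj
    rcases Nat.lt_or_ge j 4 with h | h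
    · interval_cases j
      · rw [FF_zero, hx0, hy0, hz0]; ring
      · exact FF_one _ _ _ hy0 hz0
      · rw [FF_two _ _ _ hy0 hz0, hx1]; ring
      · rw [FF_three _ _ _ hy0 hz0, hy1']; ring
    · have := hy2 (j - 2) (by omega) (by omega)
      rwa [show j - 2 + 2 * 1 = j by omega] at this
  let φ : MvPolynomial (Fin 3 × Fin (m + 1)) k →ₐ[k] K := phi s
  have hI : IZ k m ≤ RingHom.ker φ := by
    rw [IZ_le_iff]
    refine ⟨?_, ?_⟩
    · intro c
      rw [RingHom.mem_ker, phi_sqn _ _ _ (by omega)]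
      fin_cases c
      · exact hx0
      · exact hy0
      · exact hz0
    · intro j hj
      rw [RingHom.mem_ker, phi_FF _ _ hj]
      exact hFF j hj
  have hyk : sqn k m 1 1 ∈ RingHom.ker φ := by
    rw [RingHom.mem_ker, phi_sqn _ _ _ (by omega)]
    exact hy1'
  have hprime : (RingHom.ker φ).IsPrime := RingHom.ker_isPrime _
  refine ⟨RingHom.ker φ, hprime, hI, hyk, ?_, ?_⟩
  · rw [RingHom.mem_ker, phi_sqn _ _ _ (by omega)]
    change z 1 ≠ 0
    rw [hz1]; exact hne 2 1 (by omega)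
  · intro p hp hIp hyp hzp
    let J := IZ k m ⊔ Ideal.span {sqn k m 0 1, sqn k m 1 1}
    have hJle : ∀ q : Ideal (MvPolynomial (Fin 3 × Fin (m + 1)) k), q.IsPrime → IZ k m ≤ q →
        sqn k m 1 1 ∈ q → J ≤ q := by
      intro q hq hIq hyq
      refine sup_le hIq ?_
      rw [Ideal.span_le]
      rintro _ (rfl | rfl)
      · exact mem_x1 hm q hq hIq
      · exact hyq
    have hIJ : IZ k m ≤ J := le_sup_left
    have hIJ' := (IZ_le_iff J).mp hIJ
    have hJx : sqn k m 0 1 ∈ J := Ideal.mem_sup_right (Ideal.subset_span (by simp))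
    have hJy : sqn k m 1 1 ∈ J := Ideal.mem_sup_right (Ideal.subset_span (by simp))
    let t : Fin 3 → ℕ → Prop := ![fun i => 2 ≤ i, fun i => m < i + 2, fun i => 1 ≤ i]
    refine least_gen J t 1 (by omega) (show 1 ≤ 1 from le_rfl) hIJ'.2 ?_ ?_ ?_ ?_ ?_ φ ι hι ?_
      (hJle _ hprime hI hyk) p hp (hJle p hp hIp hyp) hzp
    · intro i hi h
      have h' : ¬ 2 ≤ i := h
      left
      obtain rfl | rfl : i = 0 ∨ i = 1 := by omega
      · exact hIJ'.1 0
      · exact hJx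
    · intro i hi h
      have h' : ¬ 1 ≤ i := h
      obtain rfl : i = 0 := by omega
      exact hIJ'.1 2
    · intro i hi
      obtain rfl : i = 0 := by omega
      exact hIJ'.1 2
    · intro i hi _
      obtain rfl | rfl : i = 0 ∨ i = 1 := by omega
      · exact hIJ'.1 1
      · exact hJy
    · intro i hi h1 h2
      exact absurd h1 h2
    · intro c' i hi h
      rw [phi_sqn _ _ _ hi]
      fin_cases c'
      · have h' : 2 ≤ i := h
        change x i = _
        simp only [x]; rw [if_pos h']; rfl
      · have h' : m < i + 2 := h
        change y i = _
        rw [hy1 i (by omega)]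
        simp only [c]; rw [if_pos h']; rfl
      · have h' : 1 ≤ i := h
        change z i = _
        simp only [z]; rw [if_pos h']; rfl

theorem T1_exists (hm : 5 ≤ m) : ∃ P : Ideal (MvPolynomial (Fin 3 × Fin (m + 1)) k), P.IsPrime ∧
    IZ k m ≤ P ∧ sqn k m 1 1 ∈ P ∧ sqn k m 2 1 ∈ P ∧ sqn k m 1 2 ∉ P ∧ sqn k m 2 2 ∉ P ∧
    ∀ p : Ideal (MvPolynomial (Fin 3 × Fin (m + 1)) k), p.IsPrime → IZ k m ≤ p →
      sqn k m 1 1 ∈ p → sqn k m 2 1 ∈ p → sqn k m 2 2 ∉ p → P ≤ p := by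
  obtain ⟨K, _, _, ι, _, hι⟩ := exists_big (k := k) (Fin 3 × Fin (m + 1))
  have hne : ∀ c, ∀ i ≤ m, ι (sqn k m c i) ≠ 0 := fun c i hi h =>
    sqn_ne c i hi (hι (by rw [h, map_zero]))
  obtain ⟨w, hw⟩ := IsAlgClosed.exists_pow_nat_eq
    (-(ι (sqn k m 1 2) ^ 2 * ι (sqn k m 2 2) + ι (sqn k m 2 2) ^ 2 * ι (sqn k m 1 2)))
    (n := 2) (by norm_num)
  let x : ℕ → K := fun i => if 4 ≤ i ∨ (i = 3 ∧ m = 5) then ι (sqn k m 0 i) else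
    if i = 3 then w else 0
  let z : ℕ → K := fun i => if 2 ≤ i then ι (sqn k m 2 i) else 0
  let c : ℕ → K := fun i => if i = 2 ∨ (2 ≤ i ∧ m < i + 4) then ι (sqn k m 1 i) else 0
  obtain ⟨y, hy1, hy2⟩ := exists_y x z c m 2 (fun i hi => by simp [z]; omega)
    (by simpa [z] using hne 2 2 (by omega))
  have hx0 : x 0 = 0 := by simp [x]
  have hx1 : x 1 = 0 := by simp [x]
  have hx2 : x 2 = 0 := by simp [x]
  have hz0 : z 0 = 0 := by simp [z]
  have hz1 : z 1 = 0 := by simp [z]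
  have hz2 : z 2 = ι (sqn k m 2 2) := by simp [z]
  have hy0 : y 0 = 0 := by rw [hy1 0 (by omega)]; simp only [c]; rw [if_neg (by omega)]
  have hy1' : y 1 = 0 := by rw [hy1 1 (by omega)]; simp only [c]; rw [if_neg (by omega)]
  have hy2' : y 2 = ι (sqn k m 1 2) := by
    rw [hy1 2 (by omega)]; simp [c]
  let s : Fin 3 → ℕ → K := ![x, y, z]
  have hFF : ∀ j ≤ m, FF x y z j = 0 := by
    intro j hj
    rcases Nat.lt_or_ge j 7 with h | h
    · interval_cases j
      · rw [FF_zero, hx0, hy0, hz0]; ring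
      · exact FF_one _ _ _ hy0 hz0
      · rw [FF_two _ _ _ hy0 hz0, hx1]; ring
      · rw [FF_three _ _ _ hy0 hz0, hy1']; ring
      · rw [FF_four _ _ _ hy0 hz0 hy1' hz1, hx2]; ring
      · exact FF_five _ _ _ hy0 hz0 hy1' hz1
      · have hx3 : x 3 = w := by
          simp only [x]; rw [if_neg (by omega), if_pos trivial]
        rw [FF_six _ _ _ hy0 hz0 hy1' hz1, hx3, hw, hy2', hz2]; ring
    · have := hy2 (j - 4) (by omega) (by omega)
      rwa [show j - 4 + 2 * 2 = j by omega] at this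
  let φ : MvPolynomial (Fin 3 × Fin (m + 1)) k →ₐ[k] K := phi s
  have hI : IZ k m ≤ RingHom.ker φ := by
    rw [IZ_le_iff]
    refine ⟨?_, ?_⟩
    · intro c
      rw [RingHom.mem_ker, phi_sqn _ _ _ (by omega)]
      fin_cases c
      · exact hx0
      · exact hy0
      · exact hz0
    · intro j hj
      rw [RingHom.mem_ker, phi_FF _ _ hj]
      exact hFF j hj
  have hyk : sqn k m 1 1 ∈ RingHom.ker φ := by
    rw [RingHom.mem_ker, phi_sqn _ _ _ (by omega)]
    exact hy1'
  have hzk : sqn k m 2 1 ∈ RingHom.ker φ := by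
    rw [RingHom.mem_ker, phi_sqn _ _ _ (by omega)]
    exact hz1
  have hprime : (RingHom.ker φ).IsPrime := RingHom.ker_isPrime _
  refine ⟨RingHom.ker φ, hprime, hI, hyk, hzk, ?_, ?_, ?_⟩
  · rw [RingHom.mem_ker, phi_sqn _ _ _ (by omega)]
    change y 2 ≠ 0
    rw [hy2']; exact hne 1 2 (by omega)
  · rw [RingHom.mem_ker, phi_sqn _ _ _ (by omega)]
    change z 2 ≠ 0
    rw [hz2]; exact hne 2 2 (by omega)
  · intro p hp hIp hyp hzp hzp2
    let J := IZ k m ⊔ Ideal.span {sqn k m 0 1, sqn k m 0 2, sqn k m 1 1, sqn k m 2 1}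
    have hJle : ∀ q : Ideal (MvPolynomial (Fin 3 × Fin (m + 1)) k), q.IsPrime → IZ k m ≤ q →
        sqn k m 1 1 ∈ q → sqn k m 2 1 ∈ q → J ≤ q := by
      intro q hq hIq hyq hzq
      refine sup_le hIq ?_
      rw [Ideal.span_le]
      rintro _ (rfl | rfl | rfl | rfl)
      · exact mem_x1 hm q hq hIq
      · exact mem_x2 hm q hq hIq hyq hzq
      · exact hyq
      · exact hzq
    have hIJ : IZ k m ≤ J := le_sup_left
    have hIJ' := (IZ_le_iff J).mp hIJ
    have hJx : sqn k m 0 1 ∈ J := Ideal.mem_sup_right (Ideal.subset_span (by simp))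
    have hJx2 : sqn k m 0 2 ∈ J := Ideal.mem_sup_right (Ideal.subset_span (by simp))
    have hJy : sqn k m 1 1 ∈ J := Ideal.mem_sup_right (Ideal.subset_span (by simp))
    have hJz : sqn k m 2 1 ∈ J := Ideal.mem_sup_right (Ideal.subset_span (by simp))
    let t : Fin 3 → ℕ → Prop := ![fun i => 4 ≤ i ∨ (i = 3 ∧ m = 5),
      fun i => i = 2 ∨ (2 ≤ i ∧ m < i + 4), fun i => 2 ≤ i]
    refine least_gen J t 2 (by omega) (show 2 ≤ 2 from le_rfl) hIJ'.2 ?_ ?_ ?_ ?_ ?_ φ ι hι ?_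
      (hJle _ hprime hI hyk hzk) p hp (hJle p hp hIp hyp hzp) hzp2
    · intro i hi h
      have h' : ¬ (4 ≤ i ∨ (i = 3 ∧ m = 5)) := h
      have hcase : i = 0 ∨ i = 1 ∨ i = 2 ∨ (i = 3 ∧ 6 ≤ m) := by omega
      rcases hcase with rfl | rfl | rfl | ⟨rfl, h6⟩
      · exact Or.inl (hIJ'.1 0)
      · exact Or.inl hJx
      · exact Or.inl hJx2
      · right
        have hy : sqn k m 1 2 ∈ Algebra.adjoin k
            {r | ∃ c, ∃ i ≤ m, t c i ∧ r = sqn k m c i} :=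
          Algebra.subset_adjoin ⟨1, 2, by omega, Or.inl rfl, rfl⟩
        have hz : sqn k m 2 2 ∈ Algebra.adjoin k
            {r | ∃ c, ∃ i ≤ m, t c i ∧ r = sqn k m c i} :=
          Algebra.subset_adjoin ⟨2, 2, by omega, show 2 ≤ 2 from le_rfl, rfl⟩
        refine ⟨-(sqn k m 1 2 ^ 2 * sqn k m 2 2 + sqn k m 2 2 ^ 2 * sqn k m 1 2),
          neg_mem (add_mem (mul_mem (pow_mem hy 2) hz) (mul_mem (pow_mem hz 2) hy)), ?_⟩
        have h := hIJ'.2 6 h6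
        rw [← Ideal.Quotient.eq_zero_iff_mem, ← mk_FF,
          FF_six _ _ _ (Ideal.Quotient.eq_zero_iff_mem.mpr (hIJ'.1 1))
            (Ideal.Quotient.eq_zero_iff_mem.mpr (hIJ'.1 2))
            (Ideal.Quotient.eq_zero_iff_mem.mpr hJy) (Ideal.Quotient.eq_zero_iff_mem.mpr hJz)] at h
        rw [← Ideal.Quotient.eq_zero_iff_mem, sub_neg_eq_add]
        simpa only [map_add, map_mul, map_pow] using h
    · intro i hi h
      have h' : ¬ 2 ≤ i := h
      obtain rfl | rfl : i = 0 ∨ i = 1 := by omega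
      · exact hIJ'.1 2
      · exact hJz
    · intro i hi
      obtain rfl | rfl : i = 0 ∨ i = 1 := by omega
      · exact hIJ'.1 2
      · exact hJz
    · intro i hi h
      have h' : ¬ (i = 2 ∨ (2 ≤ i ∧ m < i + 4)) := h
      obtain rfl | rfl : i = 0 ∨ i = 1 := by omega
      · exact hIJ'.1 1
      · exact hJy
    · intro i hi h1 h2
      exact absurd (Or.inr ⟨by omega, by omega⟩) h2
    · intro c' i hi h
      rw [phi_sqn _ _ _ hi]
      fin_cases c'
      · have h' : 4 ≤ i ∨ (i = 3 ∧ m = 5) := h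
        change x i = _
        simp only [x]; rw [if_pos h']; rfl
      · have h' : i = 2 ∨ (2 ≤ i ∧ m < i + 4) := h
        change y i = _
        rw [hy1 i (by omega)]
        simp only [c]; rw [if_pos h']; rfl
      · have h' : 2 ≤ i := h
        change z i = _
        simp only [z]; rw [if_pos h']; rfl

end ExistSec

section SymmSec

open MvPolynomial

variable {k : Type*} [Field k] {m : ℕ}

/-- Exchange of `y` and `z`. -/
noncomputable def alp : MvPolynomial (Fin 3 × Fin (m + 1)) k →ₐ[k]
    MvPolynomial (Fin 3 × Fin (m + 1)) k :=
  aeval fun v => (![sqn k m 0, sqn k m 2, sqn k m 1] : Fin 3 → ℕ → _) v.1 v.2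

/-- The shear `z ↦ y + z`. -/
noncomputable def bet : MvPolynomial (Fin 3 × Fin (m + 1)) k →ₐ[k]
    MvPolynomial (Fin 3 × Fin (m + 1)) k :=
  aeval fun v => (![sqn k m 0, sqn k m 1, fun i => sqn k m 1 i + sqn k m 2 i] :
    Fin 3 → ℕ → _) v.1 v.2

theorem sqn_eq_zero (c : Fin 3) (i : ℕ) (hi : ¬ i < m + 1) : sqn k m c i = 0 := by
  unfold sqn; rw [dif_neg hi]

theorem X_eq_sqn (v : Fin 3 × Fin (m + 1)) : (X v : MvPolynomial _ k) = sqn k m v.1 v.2 := by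
  unfold sqn; rw [dif_pos v.2.2]

theorem alp_sqn (c : Fin 3) (i : ℕ) : alp (sqn k m c i) =
    (![sqn k m 0, sqn k m 2, sqn k m 1] : Fin 3 → ℕ → _) c i := by
  by_cases hi : i < m + 1
  · conv_lhs => rw [sqn, dif_pos hi]
    rw [alp, aeval_X]
  · rw [sqn_eq_zero c i hi, map_zero]
    fin_cases c <;> simp [sqn_eq_zero _ i hi]

theorem bet_sqn (c : Fin 3) (i : ℕ) : bet (sqn k m c i) =
    (![sqn k m 0, sqn k m 1, fun i => sqn k m 1 i + sqn k m 2 i] : Fin 3 → ℕ → _) c i := by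
  by_cases hi : i < m + 1
  · conv_lhs => rw [sqn, dif_pos hi]
    rw [bet, aeval_X]
  · rw [sqn_eq_zero c i hi, map_zero]
    fin_cases c <;> simp [sqn_eq_zero _ i hi]

theorem alp_alp (r : MvPolynomial (Fin 3 × Fin (m + 1)) k) : alp (alp r) = r := by
  have : (alp (k := k) (m := m)).comp alp = AlgHom.id k _ := by
    ext1 v
    rw [AlgHom.comp_apply, X_eq_sqn]
    obtain ⟨c, i⟩ := v
    fin_cases c <;> simp [alp_sqn]
  exact congrArg (fun f => f r) this

theorem bet_bet [CharP k 2] (r : MvPolynomial (Fin 3 × Fin (m + 1)) k) : bet (bet r) = r := by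
  have : (bet (k := k) (m := m)).comp bet = AlgHom.id k _ := by
    ext1 v
    rw [AlgHom.comp_apply, X_eq_sqn]
    obtain ⟨c, i⟩ := v
    fin_cases c <;> simp [bet_sqn, ← add_assoc, CharTwo.add_self_eq_zero]
  exact congrArg (fun f => f r) this

theorem alp_IZ (p : Ideal (MvPolynomial (Fin 3 × Fin (m + 1)) k)) (h : IZ k m ≤ p) :
    IZ k m ≤ p.comap alp := by
  rw [IZ_le_iff] at h ⊢
  refine ⟨?_, ?_⟩
  · intro c
    rw [Ideal.mem_comap, alp_sqn]
    fin_cases c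
    · exact h.1 0
    · exact h.1 2
    · exact h.1 1
  · intro j hj
    rw [Ideal.mem_comap]
    have := FF_map (alp (k := k) (m := m)).toRingHom (sqn k m 0) (sqn k m 1) (sqn k m 2) j
    have h2 : alp (FF (sqn k m 0) (sqn k m 1) (sqn k m 2) j) =
        FF (sqn k m 0) (sqn k m 2) (sqn k m 1) j := by
      refine this.trans ?_
      exact FF_congr (fun i _ => alp_sqn 0 i) (fun i _ => alp_sqn 1 i) (fun i _ => alp_sqn 2 i)
    rw [h2, FF_symm]
    exact h.2 j hj

theorem bet_IZ [CharP k 2] (p : Ideal (MvPolynomial (Fin 3 × Fin (m + 1)) k)) (h : IZ k m ≤ p) :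
    IZ k m ≤ p.comap bet := by
  rw [IZ_le_iff] at h ⊢
  refine ⟨?_, ?_⟩
  · intro c
    rw [Ideal.mem_comap, bet_sqn]
    fin_cases c
    · exact h.1 0
    · exact h.1 1
    · exact add_mem (h.1 1) (h.1 2)
  · intro j hj
    rw [Ideal.mem_comap]
    have := FF_map (bet (k := k) (m := m)).toRingHom (sqn k m 0) (sqn k m 1) (sqn k m 2) j
    have h2 : bet (FF (sqn k m 0) (sqn k m 1) (sqn k m 2) j) =
        FF (sqn k m 0) (sqn k m 1) (fun i => sqn k m 1 i + sqn k m 2 i) j := by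
      refine this.trans ?_
      exact FF_congr (fun i _ => bet_sqn 0 i) (fun i _ => bet_sqn 1 i) (fun i _ => bet_sqn 2 i)
    rw [h2, FF_shear]
    exact h.2 j hj

theorem P2_exists [CharP k 2] (hm : 5 ≤ m) :
    ∃ P : Ideal (MvPolynomial (Fin 3 × Fin (m + 1)) k), P.IsPrime ∧
    IZ k m ≤ P ∧ sqn k m 2 1 ∈ P ∧ sqn k m 1 1 ∉ P ∧
    ∀ p : Ideal (MvPolynomial (Fin 3 × Fin (m + 1)) k), p.IsPrime → IZ k m ≤ p →
      sqn k m 2 1 ∈ p → sqn k m 1 1 ∉ p → P ≤ p := by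
  obtain ⟨P, hP, hI, hy, hz, hmin⟩ := P1_exists (k := k) hm
  have e1 : alp (sqn k m 1 1) = sqn k m 2 1 := alp_sqn 1 1
  have e2 : alp (sqn k m 2 1) = sqn k m 1 1 := alp_sqn 2 1
  refine ⟨P.comap alp, Ideal.comap_isPrime _ _, alp_IZ P hI, ?_, ?_, ?_⟩
  · rw [Ideal.mem_comap, e2]; exact hy
  · rw [Ideal.mem_comap, e1]; exact hz
  · intro p hp hIp h1 h2
    have := hmin (p.comap alp) (Ideal.comap_isPrime _ _) (alp_IZ p hIp)
      (by rw [Ideal.mem_comap, e1]; exact h1) (by rw [Ideal.mem_comap, e2]; exact h2)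
    intro r hr
    have h3 := this hr
    rwa [Ideal.mem_comap, alp_alp] at h3

theorem P3_exists [CharP k 2] (hm : 5 ≤ m) :
    ∃ P : Ideal (MvPolynomial (Fin 3 × Fin (m + 1)) k), P.IsPrime ∧
    IZ k m ≤ P ∧ sqn k m 1 1 + sqn k m 2 1 ∈ P ∧ sqn k m 1 1 ∉ P ∧
    ∀ p : Ideal (MvPolynomial (Fin 3 × Fin (m + 1)) k), p.IsPrime → IZ k m ≤ p →
      sqn k m 1 1 + sqn k m 2 1 ∈ p → sqn k m 1 1 ∉ p → P ≤ p := by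
  obtain ⟨P, hP, hI, hy, hz, hmin⟩ := P2_exists (k := k) hm
  have e1 : bet (sqn k m 1 1) = sqn k m 1 1 := bet_sqn 1 1
  have e2 : bet (sqn k m 2 1) = sqn k m 1 1 + sqn k m 2 1 := bet_sqn 2 1
  have e3 : bet (sqn k m 1 1 + sqn k m 2 1) = sqn k m 2 1 := by rw [← e2, bet_bet]
  refine ⟨P.comap bet, Ideal.comap_isPrime _ _, bet_IZ P hI, ?_, ?_, ?_⟩
  · rw [Ideal.mem_comap, e3]; exact hy
  · rw [Ideal.mem_comap, e1]; exact hz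
  · intro p hp hIp h1 h2
    have := hmin (p.comap bet) (Ideal.comap_isPrime _ _) (bet_IZ p hIp)
      (by rw [Ideal.mem_comap, e2]; exact h1) (by rw [Ideal.mem_comap, e1]; exact h2)
    intro r hr
    have h3 := this hr
    rwa [Ideal.mem_comap, bet_bet] at h3

theorem Q_exists [CharP k 2] (hm : 5 ≤ m) :
    ∃ P : Ideal (MvPolynomial (Fin 3 × Fin (m + 1)) k), P.IsPrime ∧
    IZ k m ≤ P ∧ sqn k m 1 1 ∈ P ∧ sqn k m 2 1 ∈ P ∧
    ∀ p : Ideal (MvPolynomial (Fin 3 × Fin (m + 1)) k), p.IsPrime → IZ k m ≤ p →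
      sqn k m 1 1 ∈ p → sqn k m 2 1 ∈ p → (sqn k m 1 2 ∉ p ∨ sqn k m 2 2 ∉ p) → P ≤ p := by
  obtain ⟨P, hP, hI, hy, hz, hy2, hz2, hmin⟩ := T1_exists (k := k) hm
  have e1 : ∀ i, alp (sqn k m 1 i) = sqn k m 2 i := fun i => alp_sqn 1 i
  have e2 : ∀ i, alp (sqn k m 2 i) = sqn k m 1 i := fun i => alp_sqn 2 i
  refine ⟨P, hP, hI, hy, hz, ?_⟩
  intro p hp hIp h1 h2 h3
  rcases h3 with h3 | h3
  · have hP' : P ≤ P.comap alp := hmin _ (Ideal.comap_isPrime _ _) (alp_IZ P hI)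
      (by rw [Ideal.mem_comap, e1]; exact hz) (by rw [Ideal.mem_comap, e2]; exact hy)
      (by rw [Ideal.mem_comap, e2]; exact hy2)
    have := hmin (p.comap alp) (Ideal.comap_isPrime _ _) (alp_IZ p hIp)
      (by rw [Ideal.mem_comap, e1]; exact h2) (by rw [Ideal.mem_comap, e2]; exact h1)
      (by rw [Ideal.mem_comap, e2]; exact h3)
    intro r hr
    have h4 := this (hP' hr)
    rwa [Ideal.mem_comap, alp_alp] at h4
  · exact hmin p hp hIp h1 h2 h3

end SymmSec

section FinalSec

open MvPolynomial

theorem ht_ub_gen {R : Type*} [CommRing R] [IsNoetherianRing R] (s : Finset R) (C : Ideal R → Prop)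
    (hC : ∀ q : Ideal R, q.IsPrime → (Ideal.span (s : Set R) ≤ q ↔ C q)) (N : ℕ)
    (hs : s.card ≤ N) (p : Ideal R) (hp : p.IsPrime) (hCp : C p)
    (hmin : ∀ q : Ideal R, q.IsPrime → C q → q ≤ p → p ≤ q) : p.height ≤ (N : ℕ∞) := by
  have hmem : p ∈ (Ideal.span (s : Set R)).minimalPrimes :=
    ⟨⟨hp, (hC p hp).mpr hCp⟩, fun q hq hqp => hmin q hq.1 ((hC q hq.1).mp hq.2) hqp⟩
  exact (Ideal.height_le_card_of_mem_minimalPrimes_span_finset hmem).trans (by exact_mod_cast hs)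

variable {k : Type*} [Field k] {m : ℕ}

theorem FF_mem_low (q : Ideal (MvPolynomial (Fin 3 × Fin (m + 1)) k))
    (h0 : ∀ c, sqn k m c 0 ∈ q) (h1 : sqn k m 0 1 ∈ q) (j : ℕ) (hj : j < 3) :
    FF (sqn k m 0) (sqn k m 1) (sqn k m 2) j ∈ q := by
  have e : ∀ r ∈ q, Ideal.Quotient.mk q r = 0 := fun r hr => Ideal.Quotient.eq_zero_iff_mem.mpr hr
  rw [← Ideal.Quotient.eq_zero_iff_mem, ← mk_FF]
  interval_cases j
  · rw [FF_zero, e _ (h0 0), e _ (h0 1), e _ (h0 2)]; ring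
  · exact FF_one _ _ _ (e _ (h0 1)) (e _ (h0 2))
  · rw [FF_two _ _ _ (e _ (h0 1)) (e _ (h0 2)), e _ h1]; ring

theorem FF_mem_low' (q : Ideal (MvPolynomial (Fin 3 × Fin (m + 1)) k))
    (h0 : ∀ c, sqn k m c 0 ∈ q) (h1 : ∀ c, sqn k m c 1 ∈ q) (h2 : sqn k m 0 2 ∈ q) (j : ℕ)
    (hj : j < 6) : FF (sqn k m 0) (sqn k m 1) (sqn k m 2) j ∈ q := by
  rcases Nat.lt_or_ge j 3 with h3 | h3
  · exact FF_mem_low q h0 (h1 0) j h3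
  have e : ∀ r ∈ q, Ideal.Quotient.mk q r = 0 := fun r hr => Ideal.Quotient.eq_zero_iff_mem.mpr hr
  rw [← Ideal.Quotient.eq_zero_iff_mem, ← mk_FF]
  interval_cases j
  · rw [FF_three _ _ _ (e _ (h0 1)) (e _ (h0 2)), e _ (h1 1)]; ring
  · rw [FF_four _ _ _ (e _ (h0 1)) (e _ (h0 2)) (e _ (h1 1)) (e _ (h1 2)), e _ h2]; ring
  · exact FF_five _ _ _ (e _ (h0 1)) (e _ (h0 2)) (e _ (h1 1)) (e _ (h1 2))

theorem ht_ub [CharP k 2] (hm : 5 ≤ m) (p : Ideal (MvPolynomial (Fin 3 × Fin (m + 1)) k))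
    (hp : p ∈ (IZ k m).minimalPrimes) : p.height ≤ ((m + 2 : ℕ) : ℕ∞) := by
  classical
  let F := FF (sqn k m 0) (sqn k m 1) (sqn k m 2)
  let s : Finset (MvPolynomial (Fin 3 × Fin (m + 1)) k) :=
    {sqn k m 0 0, sqn k m 0 1, sqn k m 1 0, sqn k m 2 0} ∪ (Finset.Icc 3 m).image F
  refine ht_ub_gen s (fun q => IZ k m ≤ q) ?_ (m + 2) ?_ p hp.1.1 hp.1.2
    (fun q hq hq2 hqp => hp.2 ⟨hq, hq2⟩ hqp)
  · intro q hq
    rw [Ideal.span_le]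
    constructor
    · intro h
      have h0 : ∀ c, sqn k m c 0 ∈ q := by
        intro c
        fin_cases c
        · exact h (by simp [s])
        · exact h (by simp [s])
        · exact h (by simp [s])
      refine (IZ_le_iff q).mpr ⟨h0, fun j hj => ?_⟩
      rcases Nat.lt_or_ge j 3 with h3 | h3
      · exact FF_mem_low q h0 (h (by simp [s])) j h3
      · refine h ?_
        simp only [s, Finset.coe_union]
        exact Or.inr (by simpa using ⟨j, ⟨h3, hj⟩, rfl⟩)
    · intro hI r hr
      have hI' := (IZ_le_iff q).mp hI
      simp only [s, Finset.coe_union, Finset.coe_insert, Finset.coe_singleton,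
        Finset.coe_image] at hr
      rcases hr with (rfl | rfl | rfl | rfl) | ⟨j, hj, rfl⟩
      · exact hI'.1 0
      · exact mem_x1 hm q hq hI
      · exact hI'.1 1
      · exact hI'.1 2
      · exact hI'.2 j (by simp at hj; exact hj.2)
  · have h1 := Finset.card_image_le (s := Finset.Icc 3 m) (f := F)
    have h2 := Finset.card_union_le
      {sqn k m 0 0, sqn k m 0 1, sqn k m 1 0, sqn k m 2 0} ((Finset.Icc 3 m).image F)
    have h3 := Finset.card_le_four (a := sqn k m 0 0) (b := sqn k m 0 1) (c := sqn k m 1 0)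
      (d := sqn k m 2 0)
    simp only [Nat.card_Icc] at h1
    change Finset.card (_ ∪ _) ≤ _
    omega

theorem Q_main [CharP k 2] [IsAlgClosed k] (hm : 5 ≤ m) :
    ∃ P : Ideal (MvPolynomial (Fin 3 × Fin (m + 1)) k), P ∈ (IZ k m).minimalPrimes ∧
    sqn k m 1 1 ∈ P ∧ sqn k m 2 1 ∈ P ∧
    ∀ p : Ideal (MvPolynomial (Fin 3 × Fin (m + 1)) k), p.IsPrime → IZ k m ≤ p →
      sqn k m 1 1 ∈ p → sqn k m 2 1 ∈ p → P ≤ p := by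
  classical
  obtain ⟨Q, hQ, hQI, hQy, hQz, hQmin⟩ := Q_exists (k := k) hm
  let F := FF (sqn k m 0) (sqn k m 1) (sqn k m 2)
  let s : Finset (MvPolynomial (Fin 3 × Fin (m + 1)) k) :=
    {sqn k m 0 0, sqn k m 0 1, sqn k m 0 2, sqn k m 1 0} ∪
      ({sqn k m 1 1, sqn k m 2 0, sqn k m 2 1} ∪ (Finset.Icc 6 m).image F)
  have hcard : s.card ≤ m + 2 := by
    have h1 := Finset.card_image_le (s := Finset.Icc 6 m) (f := F)
    have h2 := Finset.card_union_le
      {sqn k m 0 0, sqn k m 0 1, sqn k m 0 2, sqn k m 1 0}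
      ({sqn k m 1 1, sqn k m 2 0, sqn k m 2 1} ∪ (Finset.Icc 6 m).image F)
    have h2' := Finset.card_union_le
      {sqn k m 1 1, sqn k m 2 0, sqn k m 2 1} ((Finset.Icc 6 m).image F)
    have h3 := Finset.card_le_four (a := sqn k m 0 0) (b := sqn k m 0 1) (c := sqn k m 0 2)
      (d := sqn k m 1 0)
    have h4 := Finset.card_le_three (a := sqn k m 1 1) (b := sqn k m 2 0) (c := sqn k m 2 1)
    simp only [Nat.card_Icc] at h1
    change Finset.card (_ ∪ _) ≤ _
    omega
  have hiff : ∀ q : Ideal (MvPolynomial (Fin 3 × Fin (m + 1)) k), q.IsPrime →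
      (Ideal.span (s : Set _) ≤ q ↔ IZ k m ≤ q ∧ sqn k m 1 1 ∈ q ∧ sqn k m 2 1 ∈ q) := by
    intro q hq
    rw [Ideal.span_le]
    constructor
    · intro h
      have h0 : ∀ c, sqn k m c 0 ∈ q := by
        intro c
        fin_cases c
        · exact h (by simp [s])
        · exact h (by simp [s])
        · exact h (by simp [s])
      have h1 : ∀ c, sqn k m c 1 ∈ q := by
        intro c
        fin_cases c
        · exact h (by simp [s])
        · exact h (by simp [s])
        · exact h (by simp [s])
      refine ⟨(IZ_le_iff q).mpr ⟨h0, fun j hj => ?_⟩, h1 1, h1 2⟩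
      rcases Nat.lt_or_ge j 6 with h3 | h3
      · exact FF_mem_low' q h0 h1 (h (by simp [s])) j h3
      · refine h ?_
        simp only [s, Finset.coe_union]
        exact Or.inr (Or.inr (by simpa using ⟨j, ⟨h3, hj⟩, rfl⟩))
    · rintro ⟨hI, hy, hz⟩ r hr
      have hI' := (IZ_le_iff q).mp hI
      simp only [s, Finset.coe_union, Finset.coe_insert, Finset.coe_singleton,
        Finset.coe_image] at hr
      rcases hr with (rfl | rfl | rfl | rfl) | (rfl | rfl | rfl) | ⟨j, hj, rfl⟩
      · exact hI'.1 0
      · exact mem_x1 hm q hq hI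
      · exact mem_x2 hm q hq hI hy hz
      · exact hI'.1 1
      · exact hy
      · exact hI'.1 2
      · exact hz
      · exact hI'.2 j (by simp at hj; exact hj.2)
  have hminQ : ∀ p ∈ (Ideal.span (s : Set _)).minimalPrimes,
      p.height ≤ ((m + 2 : ℕ) : ℕ∞) ∧ Q ≤ p := by
    intro p hp
    have hpp : p.IsPrime := hp.1.1
    have hht : p.height ≤ ((m + 2 : ℕ) : ℕ∞) :=
      (Ideal.height_le_card_of_mem_minimalPrimes_span_finset hp).trans (by exact_mod_cast hcard)
    refine ⟨hht, ?_⟩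
    obtain ⟨hI, hy, hz⟩ := (hiff p hpp).mp hp.1.2
    refine hQmin p hpp hI hy hz ?_
    by_contra hcon
    push Not at hcon
    have h1 : ∀ c, sqn k m c 1 ∈ p := by
      intro c
      fin_cases c
      · exact mem_x1 hm p hpp hI
      · exact hy
      · exact hz
    have h2 : ∀ c, sqn k m c 2 ∈ p := by
      intro c
      fin_cases c
      · exact mem_x2 hm p hpp hI hy hz
      · exact hcon.1
      · exact hcon.2
    have h3 := (ht_lb' hm p hpp hI h1 h2).trans hht
    have h4 : m + 3 ≤ m + 2 := by exact_mod_cast h3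
    omega
  have hle : ∀ p : Ideal (MvPolynomial (Fin 3 × Fin (m + 1)) k), p.IsPrime → IZ k m ≤ p →
      sqn k m 1 1 ∈ p → sqn k m 2 1 ∈ p → Q ≤ p := by
    intro p hp hI hy hz
    obtain ⟨p', hp', hle⟩ := Ideal.exists_minimalPrimes_le ((hiff p hp).mpr ⟨hI, hy, hz⟩)
    exact (hminQ p' hp').2.trans hle
  have hQht : Q.height ≤ ((m + 2 : ℕ) : ℕ∞) := by
    obtain ⟨p', hp', hle⟩ := Ideal.exists_minimalPrimes_le ((hiff Q hQ).mpr ⟨hQI, hQy, hQz⟩)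
    obtain ⟨h1, h2⟩ := hminQ p' hp'
    rwa [le_antisymm hle h2] at h1
  refine ⟨Q, ⟨⟨hQ, hQI⟩, ?_⟩, hQy, hQz, hle⟩
  intro q hq hqQ
  by_contra hcon
  have hlt : q < Q := lt_of_le_not_ge hqQ hcon
  have hqp : q.IsPrime := hq.1
  have h1 := ht_lb hm q hq.1 hq.2
  have hfin : q.FiniteHeight := inferInstance
  have h2 := Ideal.height_strict_mono_of_isPrime_of_isPrime hlt
  exact absurd (h1.trans_lt h2) (not_lt.mpr hQht)

theorem main_IZ [CharP k 2] [IsAlgClosed k] (hm : 5 ≤ m) :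
    (IZ k m).minimalPrimes.ncard = 4 ∧ ∀ p ∈ (IZ k m).minimalPrimes,
      ringKrullDim (MvPolynomial (Fin 3 × Fin (m + 1)) k ⧸ p) =
        ((2 * m + 1 : ℕ) : WithBot ℕ∞) := by
  refine ⟨?_, ?_⟩
  · obtain ⟨P1, hp1, hI1, hy1, hz1, hmin1⟩ := P1_exists (k := k) hm
    obtain ⟨P2, hp2, hI2, hz2, hy2, hmin2⟩ := P2_exists (k := k) hm
    obtain ⟨P3, hp3, hI3, hs3, hy3, hmin3⟩ := P3_exists (k := k) hm
    obtain ⟨Q, hQ, hQy, hQz, hminQ⟩ := Q_main (k := k) hm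
    have hz3 : sqn k m 2 1 ∉ P3 := fun h => hy3 ((Ideal.add_mem_iff_left _ h).mp hs3)
    have hs1 : sqn k m 1 1 + sqn k m 2 1 ∉ P1 := fun h => hz1 ((Ideal.add_mem_iff_right _ hy1).mp h)
    have hs2 : sqn k m 1 1 + sqn k m 2 1 ∉ P2 := fun h => hy2 ((Ideal.add_mem_iff_left _ hz2).mp h)
    have hset : (IZ k m).minimalPrimes = {P1, P2, P3, Q} := by
      ext p
      constructor
      · intro hp
        have hpp : p.IsPrime := hp.1.1
        have hpI : IZ k m ≤ p := hp.1.2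
        by_cases hy : sqn k m 1 1 ∈ p
        · by_cases hz : sqn k m 2 1 ∈ p
          · have h := hminQ p hpp hpI hy hz
            rw [le_antisymm (hp.2 hQ.1 h) h]; simp
          · have h := hmin1 p hpp hpI hy hz
            rw [le_antisymm (hp.2 ⟨hp1, hI1⟩ h) h]; simp
        · rcases mem_cases hm p hpp hpI with h | h | h
          · exact absurd h hy
          · have h := hmin2 p hpp hpI h hy
            rw [le_antisymm (hp.2 ⟨hp2, hI2⟩ h) h]; simp
          · have h := hmin3 p hpp hpI h hy
            rw [le_antisymm (hp.2 ⟨hp3, hI3⟩ h) h]; simp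
      · rintro (rfl | rfl | rfl | rfl)
        · refine ⟨⟨hp1, hI1⟩, fun q hq hle => ?_⟩
          rcases mem_cases hm q hq.1 hq.2 with h | h | h
          · exact hmin1 q hq.1 hq.2 h (fun h' => hz1 (hle h'))
          · exact absurd (hle h) hz1
          · exact absurd (hle h) hs1
        · refine ⟨⟨hp2, hI2⟩, fun q hq hle => ?_⟩
          rcases mem_cases hm q hq.1 hq.2 with h | h | h
          · exact absurd (hle h) hy2
          · exact hmin2 q hq.1 hq.2 h (fun h' => hy2 (hle h'))
          · exact absurd (hle h) hs2
        · refine ⟨⟨hp3, hI3⟩, fun q hq hle => ?_⟩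
          rcases mem_cases hm q hq.1 hq.2 with h | h | h
          · exact absurd (hle h) hy3
          · exact absurd (hle h) hz3
          · exact hmin3 q hq.1 hq.2 h (fun h' => hy3 (hle h'))
        · exact hQ
    have h12 : P1 ≠ P2 := by rintro rfl; exact hy2 hy1
    have h13 : P1 ≠ P3 := by rintro rfl; exact hy3 hy1
    have h1Q : P1 ≠ Q := by rintro rfl; exact hz1 hQz
    have h23 : P2 ≠ P3 := by rintro rfl; exact hz3 hz2
    have h2Q : P2 ≠ Q := by rintro rfl; exact hy2 hQy
    have h3Q : P3 ≠ Q := by rintro rfl; exact hy3 hQy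
    rw [hset, Set.ncard_insert_of_notMem (by simp [h12, h13, h1Q]),
      Set.ncard_insert_of_notMem (by simp [h23, h2Q]), Set.ncard_pair h3Q]
  · intro p hp
    have hpp : p.IsPrime := hp.1.1
    refine dim_formula p (m + 2) (2 * m + 1)
      (le_antisymm (ht_ub hm p hp) (ht_lb hm p hpp hp.1.2)) ?_
    rw [Nat.card_prod, Nat.card_fin, Nat.card_fin]
    omega

end FinalSec

/-- Theorem 3.6: for `m ≥ 5`, the singular fiber
`S_m^0 = V((x_0, y_0, z_0) + (f^{(0)},...,f^{(m)}))` of the `m`-th jet scheme of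
the `D_4^0`-surface has exactly four irreducible components (i.e. the defining
ideal has exactly four minimal primes), each of dimension `2m + 1`. -/
theorem singular_fiber_D40_components (k : Type*) [Field k] [IsAlgClosed k]
    [CharP k 2] (m : ℕ) (hm : 5 ≤ m) :
    let R := MvPolynomial (Fin 3 × Fin (m + 1)) k
    let I0 : Ideal R :=
      Ideal.span {MvPolynomial.X (0, ⟨0, by omega⟩), MvPolynomial.X (1, ⟨0, by omega⟩),
          MvPolynomial.X (2, ⟨0, by omega⟩)}
        ⊔ Ideal.span {p : R | ∃ j ≤ m, p = fC k m j}
    I0.minimalPrimes.ncard = 4 ∧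
      ∀ p ∈ I0.minimalPrimes, ringKrullDim (R ⧸ p) = ((2 * m + 1 : ℕ) : WithBot ℕ∞) := by
  intro R I0
  have hI : I0 = IZ k m := by
    have e : ∀ c, (MvPolynomial.X (c, ⟨0, by omega⟩) : R) = sqn k m c 0 := by
      intro c
      unfold sqn
      rw [dif_pos (by omega)]
    simp only [I0, IZ, e, fC_eq]
    rfl
  rw [hI]
  exact main_IZ hm
end
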